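/- arXiv:1609.00345 — 8 statements merged into one kernel-verified Lean document; each statement's English description precedes it below -/
import Mathlib

section
/- Let p be a prime, k a perfect field of characteristic p, n a natural number, and R = W(k)[[T₁,…,Tₙ]] the ring of formal power series in n variables over the ring of p-typical Witt vectors of k. Then for every commutative R-algebra S that is finite as an R-module and whose structure map R → S is injective, the map R → S admits an R-linear retraction. -/
namespace DirectSummand

/-- The first Koszul homology of `x` modulo `I` is killed by `c`. -/
def KoszulExact {A ι : Type*} [CommRing A] [Fintype ι] (x : ι → A) (I : Ideal A) (c : A) : Prop :=
  ∀ a : ι → A, ∑ i, x i * a i ∈ I →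
    ∃ b : ι → ι → A, ∀ i, c * a i - ∑ j, (b i j - b j i) * x j ∈ I

theorem mem_span_image_iff_sum {A ι : Type*} [CommRing A] (x : ι → A) (s : Finset ι) (y : A) :
    y ∈ Ideal.span (x '' s) ↔ ∃ c : ι → A, y = ∑ i ∈ s, c i * x i := by
  classical
  rw [← Finset.coe_image]
  constructor
  · intro h
    obtain ⟨c, hc⟩ := (Submodule.mem_span_image_finset_iff_exists_fun' A).1
      (by simpa using h : y ∈ Submodule.span A (x '' s))
    exact ⟨c, by simpa using hc.symm⟩
  · rintro ⟨c, rfl⟩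
    exact Ideal.sum_mem _ fun i hi => Ideal.mul_mem_left _ _
      (Ideal.subset_span (by simpa using ⟨i, hi, rfl⟩))

theorem mem_span_range_iff_sum {A ι : Type*} [CommRing A] [Fintype ι] (x : ι → A) (y : A) :
    y ∈ Ideal.span (Set.range x) ↔ ∃ c : ι → A, y = ∑ i, c i * x i := by
  rw [← mem_span_image_iff_sum]; simp

theorem exists_koszul_of_regular {A ι : Type*} [CommRing A] (x : ι → A)
    (hx : ∀ (s : Finset ι) (i : ι), i ∉ s → ∀ c, x i * c ∈ Ideal.span (x '' s) →
      c ∈ Ideal.span (x '' s)) (s : Finset ι) :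
    ∀ a : ι → A, ∑ i ∈ s, x i * a i = 0 →
      ∃ b : ι → ι → A, ∀ i ∈ s, a i = ∑ j ∈ s, (b i j - b j i) * x j := by
  classical
  induction s using Finset.induction_on with
  | empty => intro a _; exact ⟨0, by simp⟩
  | insert k s hk ih =>
    intro a ha
    rw [Finset.sum_insert hk] at ha
    obtain ⟨c, hc⟩ := (mem_span_image_iff_sum x s (a k)).1 <| hx s k hk (a k) <| by
      rw [eq_neg_of_add_eq_zero_left ha]
      exact neg_mem ((mem_span_image_iff_sum x s _).2 ⟨a, by simp [mul_comm]⟩)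
    obtain ⟨b, hb⟩ := ih (fun i => a i + x k * c i) <| by
      rw [← ha, hc]
      simp only [mul_add, Finset.sum_add_distrib, Finset.mul_sum]
      rw [add_comm]
      congr 1
      exact Finset.sum_congr rfl fun i _ => by ring
    refine ⟨fun i j => if i = k then (if j = k then 0 else c j) else if j = k then 0 else b i j, ?_⟩
    intro i hi
    rw [Finset.sum_insert hk]
    rcases Finset.mem_insert.1 hi with rfl | his
    · rw [hc]
      simp only [if_true, sub_self, zero_mul, zero_add]
      refine Finset.sum_congr rfl fun j hj => ?_
      have : j ≠ i := fun h => hk (h ▸ hj)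
      simp [this]
    · have hik : i ≠ k := fun h => hk (h ▸ his)
      have := hb i his
      have h2 : ∑ j ∈ s, ((if i = k then (if j = k then 0 else c j) else if j = k then 0 else b i j)
          - (if j = k then (if i = k then 0 else c i) else if i = k then 0 else b j i)) * x j
          = ∑ j ∈ s, (b i j - b j i) * x j := by
        refine Finset.sum_congr rfl fun j hj => ?_
        have : j ≠ k := fun h => hk (h ▸ hj)
        simp [this, hik]
      rw [h2, ← this]
      simp [hik]
      ring

theorem KoszulExact.of_regular {A ι : Type*} [CommRing A] [Fintype ι] (x : ι → A)
    (hx : ∀ (s : Finset ι) (i : ι), i ∉ s → ∀ c, x i * c ∈ Ideal.span (x '' s) →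
      c ∈ Ideal.span (x '' s)) : KoszulExact x ⊥ 1 := by
  intro a ha
  obtain ⟨b, hb⟩ := exists_koszul_of_regular x hx Finset.univ a (by simpa using ha)
  exact ⟨b, fun i => by simp [← hb i (Finset.mem_univ i)]⟩

theorem KoszulExact.of_flat {A B ι : Type*} [CommRing A] [CommRing B] [Algebra A B]
    [Module.Flat A B] [Fintype ι] {x : ι → A} (hx : KoszulExact x ⊥ 1) :
    KoszulExact (fun i => algebraMap A B (x i)) ⊥ 1 := by
  intro a ha
  have ha' : ∑ i, x i • a i = 0 := by simpa [Algebra.smul_def] using ha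
  obtain ⟨k, r, y, h1, h2⟩ := Module.Flat.isTrivialRelation_of_sum_smul_eq_zero
    (R := A) (M := B) (f := x) (x := a) ha'
  have h3 : ∀ l : Fin k, ∃ b : ι → ι → A, ∀ i, r i l = ∑ j, (b i j - b j i) * x j := by
    intro l
    obtain ⟨b, hb⟩ := hx (fun i => r i l) (by simpa using h2 l)
    exact ⟨b, fun i => by simpa [sub_eq_zero] using hb i⟩
  choose b hb using h3
  refine ⟨fun i j => ∑ l, algebraMap A B (b l i j) * y l, fun i => ?_⟩
  simp only [one_mul, Ideal.mem_bot, sub_eq_zero]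
  rw [h1 i]
  simp only [Algebra.smul_def, hb, map_sum, map_mul, map_sub, Finset.sum_mul]
  rw [Finset.sum_comm]
  refine Finset.sum_congr rfl fun j _ => ?_
  rw [← Finset.sum_sub_distrib, Finset.sum_mul]
  exact Finset.sum_congr rfl fun l _ => by ring

theorem sum_koszul_eq_zero {A ι : Type*} [CommRing A] [Fintype ι] (x : ι → A) (b : ι → ι → A) :
    ∑ i, x i * ∑ j, (b i j - b j i) * x j = 0 := by
  have h : ∑ i, x i * ∑ j, (b i j - b j i) * x j
      = ∑ i, ∑ j, b i j * (x i * x j) - ∑ i, ∑ j, b j i * (x i * x j) := by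
    rw [← Finset.sum_sub_distrib]
    refine Finset.sum_congr rfl fun i _ => ?_
    rw [← Finset.sum_sub_distrib, Finset.mul_sum]
    exact Finset.sum_congr rfl fun j _ => by ring
  rw [h, sub_eq_zero, Finset.sum_comm]
  exact Finset.sum_congr rfl fun i _ => Finset.sum_congr rfl fun j _ => by ring

theorem KoszulExact.mem_of_mul_mem {A ι : Type*} [CommRing A] [Fintype ι] {x : ι → A} {ϖ c : A}
    (hϖ : ∀ y, ϖ * y = 0 → y = 0) (hx : KoszulExact x (Ideal.span {ϖ}) c) {y : A}
    (hy : ϖ * y ∈ Ideal.span (Set.range x)) : c * y ∈ Ideal.span (Set.range x) := by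
  obtain ⟨a, ha⟩ := (mem_span_range_iff_sum x _).1 hy
  obtain ⟨b, hb⟩ := hx a (by
    rw [Ideal.mem_span_singleton]; exact ⟨y, by rw [ha]; simp [mul_comm]⟩)
  choose d hd using fun i => Ideal.mem_span_singleton.1 (hb i)
  refine (mem_span_range_iff_sum x _).2 ⟨d, ?_⟩
  rw [← sub_eq_zero]
  apply hϖ
  have h1 : ∑ i, x i * (c * a i - ∑ j, (b i j - b j i) * x j) = ∑ i, x i * (ϖ * d i) :=
    Finset.sum_congr rfl fun i _ => by rw [hd]
  simp only [mul_sub, Finset.sum_sub_distrib, sum_koszul_eq_zero, sub_zero] at h1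
  have h2 : c * (ϖ * y) = ∑ i, x i * (ϖ * d i) := by
    rw [← h1, ha, Finset.mul_sum]
    exact Finset.sum_congr rfl fun i _ => by ring
  rw [mul_sub, Finset.mul_sum, sub_eq_zero, mul_left_comm, h2]
  exact Finset.sum_congr rfl fun i _ => by ring

theorem KoszulExact.mem_of_pow_mul_mem {A ι : Type*} [CommRing A] [Fintype ι] {x : ι → A} {ϖ c : A}
    (hϖ : ∀ y, ϖ * y = 0 → y = 0) (hx : KoszulExact x (Ideal.span {ϖ}) c) (N : ℕ) {y : A}
    (hy : ϖ ^ N * y ∈ Ideal.span (Set.range x)) : c ^ N * y ∈ Ideal.span (Set.range x) := by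
  induction N generalizing y with
  | zero => simpa using hy
  | succ N ih =>
    rw [pow_succ, mul_assoc]
    apply ih
    have := hx.mem_of_mul_mem hϖ (y := ϖ ^ N * y) (by rwa [← mul_assoc, ← pow_succ'])
    rwa [mul_left_comm] at this

theorem KoszulExact.lift_pow {A B ι : Type*} [CommRing A] [CommRing B] [Fintype ι] {x : ι → A}
    {ϖ : A} (hϖ : ∀ y, ϖ * y = 0 → y = 0) (θ : A →+* B) (hθ : Function.Surjective θ)
    (hker : RingHom.ker θ = Ideal.span {ϖ}) (hx : KoszulExact (fun i => θ (x i)) ⊥ 1) (q : ℕ) :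
    KoszulExact x (Ideal.span {ϖ ^ q}) 1 := by
  induction q with
  | zero => intro a _; exact ⟨0, by simp [Ideal.span_singleton_one]⟩
  | succ q ih =>
    intro a ha
    obtain ⟨e, he⟩ := Ideal.mem_span_singleton.1 ha
    obtain ⟨b, hb⟩ := hx (fun i => θ (a i)) (by
      have hz : θ ϖ = 0 := by rw [← RingHom.mem_ker, hker]; exact Ideal.mem_span_singleton_self _
      have := congrArg θ he
      simpa [hz] using this)
    choose b' hb' using fun i j => hθ (b i j)
    have h1 : ∀ i, ∃ d, a i - ∑ j, (b' i j - b' j i) * x j = ϖ * d := by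
      intro i
      apply Ideal.mem_span_singleton.1
      rw [← hker, RingHom.mem_ker]
      simpa [hb'] using hb i
    choose d hd using h1
    have h2 : ∑ i, x i * d i = ϖ ^ q * e := by
      rw [← sub_eq_zero]
      apply hϖ
      rw [mul_sub, ← mul_assoc, ← pow_succ', ← he, sub_eq_zero, Finset.mul_sum]
      have h1 : ∑ i, x i * (a i - ∑ j, (b' i j - b' j i) * x j) = ∑ i, x i * (ϖ * d i) :=
        Finset.sum_congr rfl fun i _ => by rw [hd]
      simp only [mul_sub, Finset.sum_sub_distrib, sum_koszul_eq_zero, sub_zero] at h1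
      rw [h1]
      exact Finset.sum_congr rfl fun i _ => by ring
    obtain ⟨b2, hb2⟩ := ih d (Ideal.mem_span_singleton.2 ⟨e, h2⟩)
    refine ⟨fun i j => b' i j + ϖ * b2 i j, fun i => ?_⟩
    obtain ⟨f, hf⟩ := Ideal.mem_span_singleton.1 (hb2 i)
    refine Ideal.mem_span_singleton.2 ⟨f, ?_⟩
    have h3 : ∑ j, ((b' i j + ϖ * b2 i j) - (b' j i + ϖ * b2 j i)) * x j
        = ∑ j, (b' i j - b' j i) * x j + ϖ * ∑ j, (b2 i j - b2 j i) * x j := by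
      rw [Finset.mul_sum, ← Finset.sum_add_distrib]
      exact Finset.sum_congr rfl fun j _ => by ring
    rw [h3, pow_succ', mul_assoc, ← hf, one_mul, one_mul, mul_sub, ← hd i]
    ring

end DirectSummand

namespace DirectSummand
open MvPowerSeries

theorem mvPowerSeries_mem_span_iff {σ A : Type*} [Finite σ] [CommRing A] (M : ℕ) (s : Finset σ)
    (f : MvPowerSeries σ A) :
    f ∈ Ideal.span ((fun i => (X i : MvPowerSeries σ A) ^ M) '' s) ↔
      ∀ e : σ →₀ ℕ, (∀ i ∈ s, e i < M) → coeff e f = 0 := by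
  classical
  constructor
  · intro hf e he
    obtain ⟨c, rfl⟩ := (mem_span_image_iff_sum _ s f).1 hf
    rw [map_sum]
    exact Finset.sum_eq_zero fun i hi => X_pow_dvd_iff.1 (Dvd.intro_left (c i) rfl) e (he i hi)
  · induction s using Finset.induction_on generalizing f with
    | empty =>
      intro h
      have : f = 0 := by ext e; simpa using h e (by simp)
      simp [this]
    | insert k s hk ih =>
      intro h
      let f1 : MvPowerSeries σ A := fun e => if e k < M then coeff e f else 0
      have hf1 : ∀ e, coeff e f1 = if e k < M then coeff e f else 0 := fun e => rfl
      have h1 : f1 ∈ Ideal.span ((fun i => (X i : MvPowerSeries σ A) ^ M) '' s) := by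
        refine ih f1 fun e he => ?_
        rw [hf1]
        split_ifs with hek
        · exact h e (by simpa [hek] using he)
        · rfl
      obtain ⟨g, hg⟩ : (X k : MvPowerSeries σ A) ^ M ∣ f - f1 := by
        rw [X_pow_dvd_iff]
        intro e he
        simp [hf1, he]
      rw [← sub_add_cancel f f1, hg]
      refine add_mem (Ideal.mul_mem_right _ _ (Ideal.subset_span ⟨k, by simp, rfl⟩)) ?_
      exact Ideal.span_mono (Set.image_mono (by simp)) h1

theorem mvPowerSeries_koszulExact {σ A : Type*} [Fintype σ] [CommRing A] (M : ℕ) :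
    KoszulExact (fun i => (X i : MvPowerSeries σ A) ^ M) ⊥ 1 := by
  classical
  refine KoszulExact.of_regular _ fun s i hi c hc => ?_
  rw [mvPowerSeries_mem_span_iff] at hc ⊢
  intro e he
  have := hc (Finsupp.single i M + e) fun j hj => by
    have : i ≠ j := fun h => hi (h ▸ hj)
    simpa [Finsupp.single_apply, this] using he j hj
  rwa [X_pow_eq, coeff_add_monomial_mul, one_mul] at this

theorem pow_mul_prod_X_pow_notMem {σ A : Type*} [Fintype σ] [CommRing A] [IsReduced A] (p : ℕ)
    [Fact p.Prime] [CharP A p] (c : MvPowerSeries σ A) (e : σ →₀ ℕ) (he : coeff e c ≠ 0)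
    (j m N : ℕ) (hj : ∀ i, e i < j) :
    c ^ p ^ m * (∏ i, X i) ^ (N * (p ^ m * j)) ∉
      Ideal.span (Set.range fun i => (X i : MvPowerSeries σ A) ^ ((N + 1) * (p ^ m * j))) := by
  classical
  intro h
  have hp : p ^ m ≠ 0 := (pow_pos (Fact.out : p.Prime).pos m).ne'
  rw [← Set.image_univ, ← Finset.coe_univ, mvPowerSeries_mem_span_iff] at h
  have hX : ((∏ i, X i : MvPowerSeries σ A)) ^ (N * (p ^ m * j))
      = monomial (Finsupp.equivFunOnFinite.symm fun _ => N * (p ^ m * j)) 1 := by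
    rw [← Finset.prod_pow]
    simp_rw [X_pow_eq]
    rw [prod_monomial]
    congr 1
    · congr 1
      ext i
      simp [Finsupp.single_apply, Finsupp.finsetSum_apply]
    · simp
  have h2 := h (p ^ m • e + Finsupp.equivFunOnFinite.symm fun _ => N * (p ^ m * j)) (by
    intro i _
    have : p ^ m * e i < p ^ m * j := Nat.mul_lt_mul_of_pos_left (hj i) (Nat.pos_of_ne_zero hp)
    simp
    linarith)
  rw [hX, coeff_add_mul_monomial, mul_one,
    ← map_iterateFrobenius_expand p (Fact.out : p.Prime).ne_zero, coeff_map, coeff_expand_smul,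
    iterateFrobenius_def] at h2
  exact he (pow_eq_zero_iff hp |>.1 h2)

end DirectSummand

namespace DirectSummand

theorem charP_of_ringHom {A B : Type*} [CommRing A] [CommRing B] [Nontrivial B] (p : ℕ)
    [Fact p.Prime] [CharP A p] (f : A →+* B) : CharP B p := by
  refine (CharP.charP_iff_prime_eq_zero Fact.out).2 ?_
  rw [← map_natCast f, CharP.cast_eq_zero, map_zero]

/-- Truncated equality of Witt vectors. -/
def WittEq {p : ℕ} {A : Type*} (n : ℕ) (x y : WittVector p A) : Prop :=
  ∀ i < n, x.coeff i = y.coeff i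

theorem WittEq.refl {p : ℕ} {A : Type*} (n : ℕ) (x : WittVector p A) : WittEq n x x :=
  fun _ _ => rfl

theorem coeff_init {p : ℕ} {A : Type*} [CommRing A] (n : ℕ) (x : WittVector p A) (i : ℕ) :
    (WittVector.init n x).coeff i = if i < n then x.coeff i else 0 := by
  simp [WittVector.init, WittVector.select]

theorem coeff_tail {p : ℕ} {A : Type*} [CommRing A] (n : ℕ) (x : WittVector p A) (i : ℕ) :
    (WittVector.tail n x).coeff i = if n ≤ i then x.coeff i else 0 := by
  simp [WittVector.tail, WittVector.select]

section Witt
variable {p : ℕ} [Fact p.Prime] {A : Type*} [CommRing A]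
open WittVector

theorem wittEq_iff_init {n : ℕ} {x y : WittVector p A} :
    WittEq n x y ↔ init n x = init n y := by
  constructor
  · intro h
    ext i
    simp only [coeff_init]
    split_ifs with hi
    · exact h i hi
    · rfl
  · intro h i hi
    have := congrArg (fun z : WittVector p A => z.coeff i) h
    simpa [coeff_init, hi] using this

theorem WittEq.add {n : ℕ} {x y x' y' : WittVector p A} (h : WittEq n x y) (h' : WittEq n x' y') :
    WittEq n (x + x') (y + y') := by
  rw [wittEq_iff_init] at *
  rw [init_add, h, h', ← init_add]

theorem WittEq.mul {n : ℕ} {x y x' y' : WittVector p A} (h : WittEq n x y) (h' : WittEq n x' y') :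
    WittEq n (x * x') (y * y') := by
  rw [wittEq_iff_init] at *
  rw [init_mul, h, h', ← init_mul]

theorem coeff_add_of_low {n : ℕ} (w t : WittVector p A) (ht : ∀ i < n, t.coeff i = 0) :
    (w + t).coeff n = w.coeff n + t.coeff n := by
  have h1 : ∀ i < n, (tail n w).coeff i = 0 := fun i hi => by
    simp [coeff_tail, hi]
  have h2 : tail n w + t = verschiebung^[n] ((tail n w).shift n + t.shift n) := by
    rw [iterate_map_add, ← eq_iterate_verschiebung h1, ← eq_iterate_verschiebung ht]
  conv_lhs => rw [← init_add_tail w n, add_assoc, h2]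
  rw [coeff_add_of_disjoint]
  · have h3 := iterate_verschiebung_coeff ((tail n w).shift n + t.shift n) n 0
    rw [zero_add] at h3
    rw [h3, add_coeff_zero, shift_coeff, shift_coeff, coeff_init, coeff_tail]
    simp
  · intro i
    by_cases hi : i < n
    · right
      exact iterate_verschiebung_coeff_eq_zero _ hi
    · left
      simp [coeff_init, hi]

theorem coeff_add_sub_of_wittEq {n : ℕ} (x : WittVector p A) {y y' : WittVector p A}
    (h : WittEq n y y') :
    (x + y).coeff n = (x + y').coeff n + (y.coeff n - y'.coeff n) := by
  have e1 : x + y = (x + init n y) + tail n y := by rw [add_assoc, init_add_tail]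
  have e2 : x + y' = (x + init n y') + tail n y' := by rw [add_assoc, init_add_tail]
  have h1 : ∀ z : WittVector p A, ∀ i < n, (tail n z).coeff i = 0 := fun z i hi => by
    simp [coeff_tail, hi]
  rw [e1, e2, wittEq_iff_init.1 h, coeff_add_of_low _ _ (h1 y), coeff_add_of_low _ _ (h1 y'),
    coeff_tail, coeff_tail]
  simp

end Witt
end DirectSummand

namespace DirectSummand
open WittVector

section Dwork
variable {R : Type*} [CommRing R] (p : ℕ)

/-- The Witt coordinates of the vector with ghost components `φⁿ r`. -/
noncomputable def dworkCoeff (φ : R →+* R) (r : R) : ℕ → R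
  | n => Classical.epsilon fun c =>
      (p : R) ^ n * c + ∑ i : Fin n, (p : R) ^ (i : ℕ) * dworkCoeff φ r i ^ p ^ (n - i) = φ^[n] r
decreasing_by exact i.2

theorem dworkCoeff_spec [Fact p.Prime] (φ : R →+* R) (hφ : ∀ r, (p : R) ∣ φ r - r ^ p) (r : R)
    (n : ℕ) : ∑ i ∈ Finset.range (n + 1), (p : R) ^ i * dworkCoeff p φ r i ^ p ^ (n - i)
      = φ^[n] r := by
  have key : ∀ n, (∃ c, (p : R) ^ n * c +
      ∑ i : Fin n, (p : R) ^ (i : ℕ) * dworkCoeff p φ r i ^ p ^ (n - i) = φ^[n] r) →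
      ∑ i ∈ Finset.range (n + 1), (p : R) ^ i * dworkCoeff p φ r i ^ p ^ (n - i) = φ^[n] r := by
    intro n h
    have := Classical.epsilon_spec h
    rw [Finset.sum_range_succ, ← Fin.sum_univ_eq_sum_range
      (fun i => (p : R) ^ i * dworkCoeff p φ r i ^ p ^ (n - i)), add_comm, Nat.sub_self, pow_zero,
      pow_one]
    conv_lhs => enter [1, 2]; rw [dworkCoeff]
    exact this
  induction n with
  | zero => exact key 0 ⟨r, by simp⟩
  | succ n ih =>
    apply key
    rw [Function.iterate_succ_apply', ← ih, map_sum, Fin.sum_univ_eq_sum_range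
      (fun i => (p : R) ^ i * dworkCoeff p φ r i ^ p ^ (n + 1 - i))]
    suffices h : (p : R) ^ (n + 1) ∣
        ∑ i ∈ Finset.range (n + 1), φ ((p : R) ^ i * dworkCoeff p φ r i ^ p ^ (n - i))
        - ∑ i ∈ Finset.range (n + 1), (p : R) ^ i * dworkCoeff p φ r i ^ p ^ (n + 1 - i) by
      obtain ⟨c, hc⟩ := h
      exact ⟨c, by rw [← hc]; ring⟩
    rw [← Finset.sum_sub_distrib]
    refine Finset.dvd_sum fun i hi => ?_
    have hi' : i ≤ n := Nat.lt_succ_iff.1 (Finset.mem_range.1 hi)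
    have h1 := dvd_sub_pow_of_dvd_sub (hφ (dworkCoeff p φ r i)) (n - i)
    rw [map_mul, map_pow, map_pow, map_natCast, ← mul_sub]
    have h2 : p ^ (n + 1 - i) = p * p ^ (n - i) := by
      rw [Nat.sub_add_comm hi', pow_succ']
    have h3 : (p : R) ^ (n + 1) = p ^ i * p ^ (n - i + 1) := by
      rw [← pow_add]; congr 1; omega
    rw [h2, pow_mul, h3]
    exact mul_dvd_mul_left _ h1

theorem ghostComponent_eq_sum [Fact p.Prime] (n : ℕ) (x : WittVector p R) :
    ghostComponent n x = ∑ i ∈ Finset.range (n + 1), (p : R) ^ i * x.coeff i ^ p ^ (n - i) := by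
  rw [ghostComponent_apply, wittPolynomial_eq_sum_C_mul_X_pow]
  simp

theorem ext_of_ghostComponent [Fact p.Prime] (hp : ∀ y : R, (p : R) * y = 0 → y = 0)
    {x y : WittVector p R} (h : ∀ n, ghostComponent n x = ghostComponent n y) : x = y := by
  have hp' : ∀ (n : ℕ) (y : R), (p : R) ^ n * y = 0 → y = 0 := by
    intro n
    induction n with
    | zero => simp
    | succ n ih => intro y hy; exact ih y (hp _ (by rw [← mul_assoc, ← pow_succ', hy]))
  ext n
  induction n using Nat.strong_induction_on with
  | _ n ih =>
    have h1 := h n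
    rw [ghostComponent_eq_sum, ghostComponent_eq_sum, Finset.sum_range_succ,
      Finset.sum_range_succ, Finset.sum_congr rfl fun i hi => by
        rw [ih i (Finset.mem_range.1 hi)]] at h1
    have h2 := add_left_cancel h1
    simp only [Nat.sub_self, pow_zero, pow_one] at h2
    exact sub_eq_zero.1 (hp' n _ (by rw [mul_sub, h2, sub_self]))

theorem exists_ringHom_wittVector [Fact p.Prime] (hp : ∀ y : R, (p : R) * y = 0 → y = 0)
    (φ : R →+* R) (hφ : ∀ r, (p : R) ∣ φ r - r ^ p) :
    ∃ s : R →+* WittVector p R, ∀ r, (s r).coeff 0 = r := by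
  let s : R → WittVector p R := fun r => WittVector.mk p (dworkCoeff p φ r)
  have hs : ∀ n r, ghostComponent n (s r) = φ^[n] r := fun n r => by
    rw [ghostComponent_eq_sum, ← dworkCoeff_spec p φ hφ]
    simp only [s, WittVector.coeff_mk]
  refine ⟨{ toFun := s, map_one' := ?_, map_mul' := ?_, map_zero' := ?_, map_add' := ?_ }, ?_⟩
  · exact ext_of_ghostComponent p hp fun n => by simp [hs]
  · intro x y
    exact ext_of_ghostComponent p hp fun n => by simp [hs, iterate_map_mul]
  · exact ext_of_ghostComponent p hp fun n => by simp [hs]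
  · intro x y
    exact ext_of_ghostComponent p hp fun n => by simp [hs, iterate_map_add]
  · intro r
    have := hs 0 r
    rw [ghostComponent_eq_sum] at this
    simpa using this
end Dwork

section PowerSeries
variable (p : ℕ) [Fact p.Prime] (k : Type*) [Field k] [CharP k p] [PerfectRing k p] (σ : Type*)

theorem exists_mvPowerSeries_coeff {σ A : Type*} [Semiring A] (c : (σ →₀ ℕ) → A) :
    ∃ f : MvPowerSeries σ A, ∀ e, MvPowerSeries.coeff e f = c e := ⟨c, fun _ => rfl⟩

/-- Reduction modulo `p` on power series over the Witt vectors. -/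
noncomputable def psReduction : MvPowerSeries σ (WittVector p k) →+* MvPowerSeries σ k :=
  MvPowerSeries.map WittVector.constantCoeff

variable {p k σ}

theorem psReduction_eq_zero_iff (f : MvPowerSeries σ (WittVector p k)) :
    psReduction p k σ f = 0 ↔ (p : MvPowerSeries σ (WittVector p k)) ∣ f := by
  constructor
  · intro h
    have h1 : ∀ e, ∃ c, MvPowerSeries.coeff e f = p * c := by
      intro e
      have h2 := congrArg (MvPowerSeries.coeff e) h
      rw [psReduction, MvPowerSeries.coeff_map] at h2
      exact Ideal.mem_span_singleton.1 (mem_span_p_iff_coeff_zero_eq_zero _ |>.2 h2)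
    choose c hc using h1
    obtain ⟨g, hg⟩ := exists_mvPowerSeries_coeff c
    refine ⟨g, ?_⟩
    ext1 e
    rw [hc, ← map_natCast (MvPowerSeries.C (σ := σ) (R := WittVector p k)),
      MvPowerSeries.coeff_C_mul, hg]
  · rintro ⟨c, rfl⟩
    rw [map_mul, map_natCast]
    have : (p : MvPowerSeries σ k) = 0 := by
      rw [← map_natCast (MvPowerSeries.C (σ := σ) (R := k)), CharP.cast_eq_zero, map_zero]
    rw [this, zero_mul]

theorem exists_ringHom_wittVector_mvPowerSeries [Finite σ] :
    ∃ f : MvPowerSeries σ (WittVector p k) →+* WittVector p (MvPowerSeries σ k),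
      ∀ r, (f r).coeff 0 = psReduction p k σ r := by
  let φ : MvPowerSeries σ (WittVector p k) →+* MvPowerSeries σ (WittVector p k) :=
    ((MvPowerSeries.expand (σ := σ) (R := WittVector p k) p
      (Fact.out : p.Prime).ne_zero) : _ →+* _).comp (MvPowerSeries.map WittVector.frobenius)
  obtain ⟨s, hs⟩ := exists_ringHom_wittVector (R := MvPowerSeries σ (WittVector p k)) p
    (fun y hy => by
      ext1 e
      have h2 := congrArg (MvPowerSeries.coeff e) hy
      rw [← map_natCast (MvPowerSeries.C (σ := σ) (R := WittVector p k)),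
        MvPowerSeries.coeff_C_mul] at h2
      exact (mul_eq_zero.1 (h2.trans (map_zero _))).resolve_left (WittVector.p_nonzero p k)) φ
    (fun r => by
      rw [← psReduction_eq_zero_iff, map_sub, sub_eq_zero, map_pow,
        ← MvPowerSeries.map_frobenius_expand p (Fact.out : p.Prime).ne_zero,
        MvPowerSeries.map_expand]
      simp only [φ, RingHom.comp_apply, psReduction, RingHom.coe_coe, MvPowerSeries.map_expand]
      congr 1
      ext e
      simp [coeff_frobenius_charP, frobenius_def])
  exact ⟨(WittVector.map (psReduction p k σ)).comp s, fun r => by simp [map_coeff, hs]⟩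

end PowerSeries
end DirectSummand

namespace DirectSummand
open WittVector

theorem teichmuller_mul_coeff_aux {R : Type*} [CommRing R] (p : ℕ) [Fact p.Prime]
    (hp : ∀ y : R, (p : R) * y = 0 → y = 0) (a : R) (z : WittVector p R) (n : ℕ) :
    (teichmuller p a * z).coeff n = a ^ p ^ n * z.coeff n := by
  have : teichmuller p a * z = WittVector.mk p fun n => a ^ p ^ n * z.coeff n := by
    refine ext_of_ghostComponent p hp fun n => ?_
    rw [map_mul, ghostComponent_teichmuller, ghostComponent_eq_sum, ghostComponent_eq_sum,
      Finset.mul_sum]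
    refine Finset.sum_congr rfl fun i hi => ?_
    have hi' : i ≤ n := Nat.lt_succ_iff.1 (Finset.mem_range.1 hi)
    rw [WittVector.coeff_mk, mul_pow, ← pow_mul, ← pow_add, Nat.add_sub_cancel' hi']
    ring
  rw [this, WittVector.coeff_mk]

theorem teichmuller_mul_coeff {R : Type*} [CommRing R] (p : ℕ) [Fact p.Prime]
    (a : R) (z : WittVector p R) (n : ℕ) :
    (teichmuller p a * z).coeff n = a ^ p ^ n * z.coeff n := by
  let f : MvPolynomial R ℤ →+* R := MvPolynomial.eval₂Hom (Int.castRingHom R) id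
  have hf : Function.Surjective f := fun r => ⟨MvPolynomial.X r, by simp [f]⟩
  obtain ⟨a, rfl⟩ := hf a
  obtain ⟨z, rfl⟩ := WittVector.map_surjective (p := p) f hf z
  rw [← map_teichmuller, ← map_mul, map_coeff, map_coeff, teichmuller_mul_coeff_aux, map_mul,
    map_pow]
  intro y hy
  exact (mul_eq_zero.1 hy).resolve_left (Nat.cast_ne_zero.2 (Fact.out : p.Prime).ne_zero)

theorem wittVector_map_map {R S T : Type*} [CommRing R] [CommRing S] [CommRing T] {p : ℕ}
    [Fact p.Prime] (f : R →+* S) (g : S →+* T) (z : WittVector p R) :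
    WittVector.map g (WittVector.map f z) = WittVector.map (g.comp f) z := by
  ext; simp [map_coeff]

theorem WittEq.map {R S : Type*} [CommRing R] [CommRing S] {p : ℕ}
    [Fact p.Prime] (f : R →+* S) {n : ℕ} {x y : WittVector p R} (h : WittEq n x y) :
    WittEq n (WittVector.map f x) (WittVector.map f y) := by
  intro i hi
  rw [map_coeff, map_coeff, h i hi]

end DirectSummand

namespace DirectSummand
open Polynomial
universe u

/-- `θ : A → B` is the quotient by the nonzerodivisor `π`. -/
structure IsSpecialization {A B : Type*} [CommRing A] [CommRing B] (π : A) (θ : A →+* B) :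
    Prop where
  eq_zero_of_mul : ∀ y, π * y = 0 → y = 0
  surjective : Function.Surjective θ
  ker : RingHom.ker θ = Ideal.span {π}

theorem IsSpecialization.eq_zero_iff {A B : Type*} [CommRing A] [CommRing B] {π : A} {θ : A →+* B}
    (h : IsSpecialization π θ) (y : A) : θ y = 0 ↔ ∃ z, y = π * z := by
  rw [← RingHom.mem_ker, h.ker, Ideal.mem_span_singleton]; rfl

theorem IsSpecialization.map_eq_zero {A B : Type*} [CommRing A] [CommRing B] {π : A} {θ : A →+* B}
    (h : IsSpecialization π θ) : θ π = 0 := (h.eq_zero_iff π).2 ⟨1, by simp⟩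

theorem IsSpecialization.mapRingHom {A B : Type*} [CommRing A] [CommRing B] {π : A} {θ : A →+* B}
    (h : IsSpecialization π θ) : IsSpecialization (C π : A[X]) (Polynomial.mapRingHom θ) where
  eq_zero_of_mul y hy := by
    ext i
    have := congrArg (fun f : A[X] => f.coeff i) hy
    simp only [coeff_C_mul, coeff_zero] at this
    simpa using h.eq_zero_of_mul _ this
  surjective := Polynomial.map_surjective θ h.surjective
  ker := by rw [Polynomial.ker_mapRingHom, h.ker, Ideal.map_span, Set.image_singleton]

/-- The ring `A[Z]/(πᶜ Z - s)`, with its specialization at `π = 0`. -/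
theorem IsSpecialization.exists_divide {P Q : Type u} [CommRing P] [CommRing Q] {π : P}
    {θ : P →+* Q[X]} (h : IsSpecialization π θ) [Nontrivial Q] (s : P) (hs : (θ s).Monic)
    (hdeg : (θ s).natDegree ≠ 0) (c : ℕ) (hc : c ≠ 0) :
    ∃ (P' Q' : Type u) (_ : CommRing P') (_ : CommRing Q') (_ : Nontrivial Q')
      (ι : P →+* P') (θ' : P' →+* Q'[X]) (σ : Q[X] →+* Q') (v : P'),
      IsSpecialization (ι π) θ' ∧ (σ.comp C).FaithfullyFlat ∧ θ'.comp ι = C.comp (σ.comp θ) ∧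
      ι π ^ c * v = ι s ∧ θ' v = X := by
  have hfree : Module.Free Q (AdjoinRoot (θ s)) := hs.free_adjoinRoot
  have hnt : Nontrivial (AdjoinRoot (θ s)) := by
    refine Ideal.Quotient.nontrivial_iff.2 fun h1 => hdeg ?_
    rw [Ideal.span_singleton_eq_top] at h1
    rw [hs.isUnit_iff.1 h1, natDegree_one]
  let f : P[X] := C (π ^ c) * X - C s
  let g : P →+* AdjoinRoot (θ s) := (AdjoinRoot.mk (θ s)).comp θ
  have hθπ := h.map_eq_zero
  have hg : (Polynomial.mapRingHom g) f = 0 := by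
    simp [f, g, hθπ, hc]
  have hker : RingHom.ker g = Ideal.span {s} ⊔ Ideal.span {π} := by
    have : RingHom.ker g = Ideal.comap θ (Ideal.map θ (Ideal.span {s})) := by
      rw [Ideal.map_span, Set.image_singleton]
      ext y
      simp [g, RingHom.mem_ker, Ideal.mem_comap, AdjoinRoot.mk_eq_zero, Ideal.mem_span_singleton]
    rw [this, Ideal.comap_map_of_surjective θ h.surjective, ← h.ker]; rfl
  refine ⟨P[X] ⧸ Ideal.span {f}, AdjoinRoot (θ s), inferInstance, inferInstance, hnt,
    (Ideal.Quotient.mk _).comp C,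
    Ideal.Quotient.lift _ (Polynomial.mapRingHom g) (fun y hy => by
      obtain ⟨z, rfl⟩ := Ideal.mem_span_singleton.1 hy
      rw [map_mul, hg, zero_mul]), AdjoinRoot.mk (θ s), Ideal.Quotient.mk _ X,
    ⟨?_, ?_, ?_⟩, ?_, ?_, ?_, ?_⟩
  · intro y hy
    obtain ⟨y, rfl⟩ := Ideal.Quotient.mk_surjective y
    rw [RingHom.comp_apply, ← map_mul, Ideal.Quotient.eq_zero_iff_mem,
      Ideal.mem_span_singleton] at hy
    obtain ⟨w, hw⟩ := hy
    have h1 := h.mapRingHom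
    obtain ⟨w', rfl⟩ := (h1.eq_zero_iff w).1 (by
      have h2 := congrArg (Polynomial.mapRingHom θ) hw
      rw [map_mul, map_mul, h1.map_eq_zero, zero_mul] at h2
      have h3 : (Polynomial.mapRingHom θ) f = - C (θ s) := by simp [f, hθπ, hc]
      rw [h3] at h2
      replace h2 : C (θ s) * (Polynomial.mapRingHom θ) w = 0 := by linear_combination h2
      ext1 i
      have := congrArg (fun f : Q[X][X] => f.coeff i) h2
      simp only [coeff_C_mul, coeff_zero] at this
      simpa using hs.mul_right_eq_zero_iff.1 this)
    rw [Ideal.Quotient.eq_zero_iff_mem, Ideal.mem_span_singleton]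
    refine ⟨w', ?_⟩
    rw [← sub_eq_zero]
    apply h1.eq_zero_of_mul
    rw [mul_sub, hw]; ring
  · refine Ideal.Quotient.lift_surjective_of_surjective _ _ ?_
    exact Polynomial.map_surjective g (AdjoinRoot.mk_surjective.comp h.surjective)
  · ext y
    obtain ⟨y, rfl⟩ := Ideal.Quotient.mk_surjective y
    rw [RingHom.mem_ker, Ideal.Quotient.lift_mk, ← RingHom.mem_ker, Polynomial.ker_mapRingHom,
      hker, Ideal.map_sup, Ideal.map_span, Ideal.map_span, Set.image_singleton,
      Set.image_singleton, RingHom.comp_apply]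
    constructor
    · intro hy
      obtain ⟨a, ha, b, hb, rfl⟩ := Submodule.mem_sup.1 hy
      obtain ⟨a, rfl⟩ := Ideal.mem_span_singleton.1 ha
      obtain ⟨b, rfl⟩ := Ideal.mem_span_singleton.1 hb
      have h4 : (Ideal.Quotient.mk (Ideal.span {f})) (C s) =
          Ideal.Quotient.mk (Ideal.span {f}) (C π) * Ideal.Quotient.mk _ (C π ^ (c - 1) * X) := by
        rw [← map_mul, eq_comm, Ideal.Quotient.eq, Ideal.mem_span_singleton, ← mul_assoc,
          mul_pow_sub_one hc, ← C_pow]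
      rw [map_add, map_mul, map_mul, h4, Ideal.mem_span_singleton]
      exact ⟨Ideal.Quotient.mk _ (C π ^ (c - 1) * X) * Ideal.Quotient.mk _ a +
        Ideal.Quotient.mk _ b, by ring⟩
    · intro hy
      obtain ⟨w, hw⟩ := Ideal.mem_span_singleton.1 hy
      obtain ⟨w, rfl⟩ := Ideal.Quotient.mk_surjective w
      rw [← map_mul, Ideal.Quotient.eq, Ideal.mem_span_singleton] at hw
      obtain ⟨t, ht⟩ := hw
      have : y = C s * (-t) + C π * (w + C π ^ (c - 1) * X * t) := by
        rw [← sub_add_cancel y (C π * w), ht]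
        simp only [f, C_pow, ← mul_pow_sub_one hc (C π : P[X])]
        ring
      rw [this]
      exact Submodule.add_mem_sup (Ideal.mem_span_singleton.2 (dvd_mul_right _ _))
        (Ideal.mem_span_singleton.2 (dvd_mul_right _ _))
  · have : (AdjoinRoot.mk (θ s)).comp C = algebraMap Q (AdjoinRoot (θ s)) := rfl
    rw [this, RingHom.faithfullyFlat_algebraMap_iff]
    infer_instance
  · ext y
    simp [g]
  · rw [RingHom.comp_apply, RingHom.comp_apply, ← map_pow, ← map_mul, Ideal.Quotient.eq,
      Ideal.mem_span_singleton, ← C_pow]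
  · simp

end DirectSummand

namespace DirectSummand
open Polynomial WittVector
universe u

/-- The value of `F` at the Teichmüller representative of `x`. -/
noncomputable def evalTeich {D P : Type*} [CommRing D] [CommRing P] {p : ℕ} [Fact p.Prime]
    (F : (WittVector p D)[X]) (ι : D →+* P) (x : P) : WittVector p P :=
  F.eval₂ (WittVector.map ι) (teichmuller p x)

theorem map_evalTeich {D P P' : Type*} [CommRing D] [CommRing P] [CommRing P'] {p : ℕ}
    [Fact p.Prime] (F : (WittVector p D)[X]) (ι : D →+* P) (x : P) (j : P →+* P') :
    WittVector.map j (evalTeich F ι x) = evalTeich F (j.comp ι) (j x) := by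
  rw [evalTeich, evalTeich, hom_eval₂, map_teichmuller]
  congr 1

theorem exists_root_stage {D Q : Type u} [CommRing D] [CommRing Q] [Nontrivial Q] (p : ℕ)
    [Fact p.Prime] [CharP D p] {π : D} {θ : D →+* Q} (h : IsSpecialization π θ)
    (F : (WittVector p D)[X]) (hF : F.Monic) (hdeg : F.natDegree ≠ 0) (l : ℕ) :
    ∃ (P Q' : Type u) (_ : CommRing P) (_ : CommRing Q') (_ : Nontrivial Q')
      (ι : D →+* P) (θ' : P →+* Q'[X]) (σ : Q →+* Q') (x : P) (z : WittVector p P)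
      (a : WittVector p Q'),
      IsSpecialization (ι π) θ' ∧ σ.FaithfullyFlat ∧ θ'.comp ι = C.comp (σ.comp θ) ∧
      WittVector.map θ' (evalTeich F ι x) = WittVector.map C a ∧
      WittEq (l + 1) (-evalTeich F ι x + teichmuller p (ι π) * z) (z * p) ∧
      θ' (z.coeff l) = X := by
  have hp : p ≠ 0 := (Fact.out : p.Prime).ne_zero
  have hDn : Nontrivial D := θ.domain_nontrivial
  induction l with
  | zero =>
    have h1 := h.mapRingHom
    have hWn : Nontrivial (WittVector p D) := inferInstance
    have hm : (Polynomial.mapRingHom θ (F.map WittVector.constantCoeff)).Monic :=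
      (hF.map _).map _
    obtain ⟨P, Q', _, _, _, ι, θ', σ, v, hsp, hσ, hcomp, hv, hvX⟩ :=
      h1.exists_divide (F.map WittVector.constantCoeff) hm (by
        simpa [(hF.map _).natDegree_map, hF.natDegree_map] using hdeg) 1 one_ne_zero
    have hPn : Nontrivial P := θ'.domain_nontrivial
    have : CharP P p := charP_of_ringHom p (ι.comp C)
    refine ⟨P, Q', inferInstance, inferInstance, inferInstance, ι.comp C, θ', σ.comp C, ι X,
      teichmuller p v, WittVector.map (σ.comp (Polynomial.mapRingHom θ))
        (evalTeich F C X), hsp, hσ, ?_, ?_, ?_, ?_⟩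
    · rw [← RingHom.comp_assoc, hcomp]; ext; simp
    · rw [← map_evalTeich, wittVector_map_map, wittVector_map_map, hcomp]
    · intro i hi
      obtain rfl : i = 0 := by omega
      have h2 : ∀ z : WittVector p P, z.coeff 0 = constantCoeff z := fun _ => rfl
      rw [mul_charP_coeff_zero, h2, map_add, map_neg, map_mul, ← h2, ← h2, ← h2,
        teichmuller_coeff_zero, teichmuller_coeff_zero]
      have h3 : (evalTeich F (ι.comp C) (ι X)).coeff 0 = ι (F.map WittVector.constantCoeff) := by
        rw [h2, evalTeich, hom_eval₂, ← h2, teichmuller_coeff_zero]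
        conv_rhs => rw [← eval₂_C_X (p := F.map WittVector.constantCoeff)]
        rw [hom_eval₂, eval₂_map]
        rfl
      rw [h3, ← hv]
      simp
    · simpa using hvX
  | succ l ih =>
    obtain ⟨P, Q', _, _, _, ι, θ', σ, x, z, a, hsp, hσ, hcomp, hx, hz, hzX⟩ := ih
    have hPn : Nontrivial P := θ'.domain_nontrivial
    have : CharP P p := charP_of_ringHom p ι
    set A := -evalTeich F ι x with hA
    let w := init (l + 1) z
    have hwz : WittEq (l + 1) w z := fun i hi => by simp [w, coeff_init, hi]
    set s := (z.coeff l) ^ p - (A + teichmuller p (ι π) * w).coeff (l + 1) with hs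
    have hθs : θ' s = X ^ p - C ((-a).coeff (l + 1)) := by
      rw [hs, map_sub, map_pow, hzX, ← map_coeff, map_add, map_mul, map_teichmuller,
        hsp.map_eq_zero, teichmuller_zero, zero_mul, add_zero, hA, map_neg, hx, ← map_neg,
        map_coeff]
    have hmon : (θ' s).Monic := by rw [hθs]; exact monic_X_pow_sub_C _ hp
    obtain ⟨P₂, Q₂, _, _, _, ι₂, θ₂, σ₂, v, hsp₂, hσ₂, hcomp₂, hv, hvX⟩ :=
      hsp.exists_divide s hmon (by rw [hθs, natDegree_X_pow_sub_C]; exact hp)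
        (p ^ (l + 1)) (pow_ne_zero _ hp)
    have hP₂n : Nontrivial P₂ := θ₂.domain_nontrivial
    have : CharP P₂ p := charP_of_ringHom p ι₂
    let z' : WittVector p P₂ := WittVector.mk p fun i =>
      if i = l + 1 then v else ι₂ (w.coeff i)
    have hz'w : WittEq (l + 1) z' (WittVector.map ι₂ w) := fun i hi => by
      simp [z', map_coeff, hi.ne]
    have hz'z : WittEq (l + 1) z' (WittVector.map ι₂ z) := fun i hi => by
      rw [hz'w i hi, map_coeff, map_coeff, hwz i hi]
    have hz'v : z'.coeff (l + 1) = v := by simp [z']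
    have hAA : -evalTeich F (ι₂.comp ι) (ι₂ x) = WittVector.map ι₂ A := by
      rw [hA, map_neg, map_evalTeich]
    refine ⟨P₂, Q₂, inferInstance, inferInstance, inferInstance, ι₂.comp ι, θ₂,
      (σ₂.comp C).comp σ, ι₂ x, z', WittVector.map (σ₂.comp θ') (evalTeich F ι x), hsp₂,
      RingHom.FaithfullyFlat.stableUnderComposition _ _ hσ hσ₂, ?_, ?_, ?_, ?_⟩
    · rw [← RingHom.comp_assoc, hcomp₂, RingHom.comp_assoc, RingHom.comp_assoc, hcomp]; rfl
    · rw [← map_evalTeich, wittVector_map_map, wittVector_map_map, hcomp₂]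
    · rw [hAA, RingHom.comp_apply, ← map_teichmuller]
      intro i hi
      rcases Nat.lt_succ_iff_lt_or_eq.1 hi with hi | rfl
      · have e1 := ((WittEq.refl (l + 1) (WittVector.map ι₂ A)).add
          ((WittEq.refl (l + 1) (WittVector.map ι₂ (teichmuller p (ι π)))).mul hz'z)) i hi
        have e2 := (hz'z.mul (WittEq.refl (l + 1) (p : WittVector p P₂))) i hi
        rw [e1, e2, ← map_natCast (WittVector.map ι₂), ← map_mul, ← map_mul, ← map_add]
        exact hz.map ι₂ i hi
      · rw [coeff_add_sub_of_wittEq _ ((WittEq.refl (l + 1) (WittVector.map ι₂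
          (teichmuller p (ι π)))).mul hz'w), map_teichmuller, teichmuller_mul_coeff,
          teichmuller_mul_coeff, hz'v, hv, mul_charP_coeff_succ, hz'z l (Nat.lt_succ_self l),
          ← map_teichmuller, ← map_mul, ← map_add, map_coeff, map_coeff, map_coeff, hs]
        simp [w, coeff_init]
    · rw [hz'v, hvX]

theorem exists_root_tower {D Q : Type u} [CommRing D] [CommRing Q] [Nontrivial Q] (p : ℕ)
    [Fact p.Prime] [CharP D p] {π : D} {θ : D →+* Q} (h : IsSpecialization π θ)
    (F : (WittVector p D)[X]) (hF : F.Monic) (hdeg : F.natDegree ≠ 0) (l : ℕ) :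
    ∃ (P Q' : Type u) (_ : CommRing P) (_ : CommRing Q') (_ : Nontrivial Q')
      (ι : D →+* P) (θ' : P →+* Q') (σ : Q →+* Q') (x : P) (z : WittVector p P),
      IsSpecialization (ι π) θ' ∧ σ.FaithfullyFlat ∧ θ'.comp ι = σ.comp θ ∧
      WittEq l (-evalTeich F ι x + teichmuller p (ι π) * z) (z * p) := by
  obtain ⟨P, Q', _, _, _, ι, θ', σ, x, z, a, hsp, hσ, hcomp, -, hz, -⟩ :=
    exists_root_stage p h F hF hdeg l
  refine ⟨P, Q'[X], inferInstance, inferInstance, inferInstance, ι, θ', C.comp σ, x, z, hsp,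
    RingHom.FaithfullyFlat.stableUnderComposition _ _ hσ ?_, by rw [hcomp]; rfl,
    fun i hi => hz i (by omega)⟩
  exact (RingHom.faithfullyFlat_algebraMap_iff (R := Q') (S := Q'[X])).2 inferInstance

end DirectSummand

namespace DirectSummand
open Polynomial WittVector
universe u

theorem isSpecialization_X (Q : Type*) [CommRing Q] :
    IsSpecialization (X : Q[X]) (Polynomial.evalRingHom (0 : Q)) where
  eq_zero_of_mul y hy := by
    ext i
    have := congrArg (fun f : Q[X] => f.coeff (i + 1)) hy
    simpa [coeff_X_mul] using this
  surjective q := ⟨C q, by simp⟩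
  ker := by
    ext y
    rw [RingHom.mem_ker, Ideal.mem_span_singleton, X_dvd_iff, coeff_zero_eq_eval_zero]; rfl

theorem exists_perfectoid_approximation {R Λ : Type u} [CommRing R] [CommRing Λ] [Nontrivial Λ]
    (p : ℕ) [Fact p.Prime] [CharP Λ p] (f₀ : R →+* WittVector p Λ) (F : R[X]) (hF : F.Monic)
    (hdeg : F.natDegree ≠ 0) (g : R) (l : ℕ) :
    ∃ (E Q : Type u) (_ : CommRing E) (_ : CommRing Q) (_ : CharP E p) (_ : Nontrivial Q)
      (f : R →+* WittVector p E) (π x t : E) (θ : E →+* Q) (σ : Λ →+* Q)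
      (z₁ z₂ : WittVector p E),
      IsSpecialization π θ ∧ σ.FaithfullyFlat ∧ (∀ r, θ ((f r).coeff 0) = σ ((f₀ r).coeff 0)) ∧
      WittEq l (-F.eval₂ f (teichmuller p x) + teichmuller p π * z₁) (z₁ * p) ∧
      WittEq l (-(teichmuller p t - f g) + teichmuller p π * z₂) (z₂ * p) := by
  have hΛ : CharP Λ[X] p := charP_of_ringHom p (C : Λ →+* Λ[X])
  have hR : Nontrivial R := f₀.domain_nontrivial
  let f₁ : R →+* WittVector p Λ[X] := (WittVector.map C).comp f₀
  have hW₁ : Nontrivial (WittVector p Λ[X]) := inferInstance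
  obtain ⟨P₁, Q₁, _, _, _, ι₁, θ₁, σ₁, x, z₁, hsp₁, hσ₁, hcomp₁, hz₁⟩ :=
    exists_root_tower p (isSpecialization_X Λ) (F.map f₁) (hF.map f₁)
      (by rwa [hF.natDegree_map]) l
  have : Nontrivial P₁ := θ₁.domain_nontrivial
  have : CharP P₁ p := charP_of_ringHom p ι₁
  let f₂ : R →+* WittVector p P₁ := (WittVector.map ι₁).comp f₁
  obtain ⟨P₂, Q₂, _, _, _, ι₂, θ₂, σ₂, t, z₂, hsp₂, hσ₂, hcomp₂, hz₂⟩ :=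
    exists_root_tower p hsp₁ (X - C (f₂ g)) (monic_X_sub_C _)
      (by rw [natDegree_X_sub_C]; exact one_ne_zero) l
  have : Nontrivial P₂ := θ₂.domain_nontrivial
  have : CharP P₂ p := charP_of_ringHom p ι₂
  let f : R →+* WittVector p P₂ := (WittVector.map ι₂).comp f₂
  refine ⟨P₂, Q₂, inferInstance, inferInstance, inferInstance, inferInstance, f, ι₂ (ι₁ X),
    ι₂ x, t, θ₂, σ₂.comp σ₁, WittVector.map ι₂ z₁, z₂, hsp₂,
    RingHom.FaithfullyFlat.stableUnderComposition _ _ hσ₁ hσ₂, ?_, ?_, ?_⟩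
  · intro r
    have h1 := fun a => RingHom.congr_fun hcomp₁ a
    have h2 := fun a => RingHom.congr_fun hcomp₂ a
    simp only [RingHom.comp_apply] at h1 h2
    simp only [f, f₂, f₁, RingHom.comp_apply, map_coeff, h2, h1]
    simp
  · have := hz₁.map ι₂
    have e : F.eval₂ f (teichmuller p (ι₂ x)) = WittVector.map ι₂ (evalTeich (F.map f₁) ι₁ x) := by
      rw [evalTeich, hom_eval₂, eval₂_map, map_teichmuller]; rfl
    rw [e]
    simpa only [map_add, map_neg, map_mul, map_natCast, map_teichmuller] using this
  · have e : evalTeich (X - C (f₂ g)) ι₂ t = teichmuller p t - f g := by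
      rw [evalTeich, eval₂_sub, eval₂_X, eval₂_C]; rfl
    rw [← e]; exact hz₂

end DirectSummand

namespace DirectSummand
universe u

theorem IsSpecialization.mem_of_pow_mul {E Q : Type*} [CommRing E] [CommRing Q] {π : E}
    {θ : E →+* Q} (h : IsSpecialization π θ) {t : E} (ht : ∀ y, θ t * y = 0 → y = 0) (b q : ℕ)
    {e : E} (he : π ^ q ∣ t ^ b * e) : π ^ q ∣ e := by
  induction q generalizing e with
  | zero => simp
  | succ q ih =>
    obtain ⟨w, hw⟩ := he
    have h1 : θ t ^ b * θ e = 0 := by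
      rw [← map_pow, ← map_mul, hw, map_mul, map_pow, h.map_eq_zero]; simp
    have h2 : θ e = 0 := by
      clear hw ih
      induction b with
      | zero => simpa using h1
      | succ b ihb => exact ihb (ht _ (by linear_combination h1))
    obtain ⟨e₁, rfl⟩ := (h.eq_zero_iff e).1 h2
    rw [pow_succ']
    refine mul_dvd_mul_left _ (ih ⟨w, ?_⟩)
    rw [← sub_eq_zero]
    exact h.eq_zero_of_mul _ (by rw [mul_sub]; linear_combination hw)

/-- The ring `E[πʲ/t]`. -/
theorem IsSpecialization.exists_adjoin_div {E Q : Type u} [CommRing E] [CommRing Q] {π : E}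
    {θ : E →+* Q} (h : IsSpecialization π θ) {t : E} (ht : ∀ y, θ t * y = 0 → y = 0) (j : ℕ) :
    ∃ (B : Type u) (_ : CommRing B) (ι : E →+* B) (u : B),
      (∀ y, ι π * y = 0 → y = 0) ∧ ι t * u = ι π ^ j ∧
      (∀ (w : B) (b : ℕ), ∃ e w', ι t ^ b * w = ι e + ι π ^ (j * b) * w') ∧
      ∀ e q, ι π ^ q ∣ ι e → π ^ q ∣ e := by
  let L := Localization.Away t
  let u : L := algebraMap E L π ^ j * IsLocalization.Away.invSelf t
  have hu : algebraMap E L t * u = algebraMap E L π ^ j := by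
    have : algebraMap E L t * IsLocalization.Away.invSelf t = 1 := IsLocalization.Away.mul_invSelf t
    linear_combination algebraMap E L π ^ j * this
  have hL : ∀ w : L, ∃ b e, algebraMap E L t ^ b * w = algebraMap E L e := fun w => by
    obtain ⟨b, e, he⟩ := IsLocalization.Away.surj t w
    exact ⟨b, e, by rw [← he, mul_comm]⟩
  have hL0 : ∀ e, algebraMap E L e = 0 → ∃ b, t ^ b * e = 0 := fun e he => by
    obtain ⟨⟨_, b, rfl⟩, hb⟩ := (IsLocalization.map_eq_zero_iff (Submonoid.powers t) L e).1 he
    exact ⟨b, hb⟩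
  have hπL : ∀ y : L, algebraMap E L π * y = 0 → y = 0 := fun y hy => by
    obtain ⟨b, e, he⟩ := hL y
    obtain ⟨b', hb'⟩ := hL0 (π * e) (by
      rw [map_mul, ← he]; linear_combination algebraMap E L t ^ b * hy)
    have h1 : t ^ b' * e = 0 := h.eq_zero_of_mul _ (by rw [← hb']; ring)
    have h2 : algebraMap E L t ^ b' * (algebraMap E L t ^ b * y) = 0 := by
      rw [he, ← map_pow, ← map_mul, h1, map_zero]
    have hunit : IsUnit (algebraMap E L t) := IsLocalization.Away.algebraMap_isUnit t
    exact (hunit.pow b).mul_right_eq_zero.1 ((hunit.pow b').mul_right_eq_zero.1 h2)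
  let B := Algebra.adjoin E {u}
  refine ⟨B, inferInstance, algebraMap E B, ⟨u, Algebra.self_mem_adjoin_singleton E u⟩,
    ?_, ?_, ?_, ?_⟩
  · intro y hy
    ext
    exact hπL _ (congrArg Subtype.val hy)
  · ext
    exact hu
  · rintro ⟨w, hw⟩ b
    have hw' := hw
    change w ∈ Algebra.adjoin E {u} at hw'
    rw [Algebra.adjoin_singleton_eq_range_aeval] at hw'
    obtain ⟨P, rfl⟩ := hw'
    suffices h : ∃ e, ∃ w' ∈ B, algebraMap E L t ^ b * Polynomial.aeval u P =
        algebraMap E L e + algebraMap E L π ^ (j * b) * w' by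
      obtain ⟨e, w', hw', h⟩ := h
      exact ⟨e, ⟨w', hw'⟩, Subtype.ext h⟩
    clear hw
    induction P using Polynomial.induction_on' with
    | add P P' hP hP' =>
      obtain ⟨e, w, hw, h⟩ := hP
      obtain ⟨e', w', hw', h'⟩ := hP'
      refine ⟨e + e', w + w', B.add_mem hw hw', ?_⟩
      rw [map_add, map_add]
      linear_combination h + h'
    | monomial m a =>
      have hB : ∀ i, algebraMap E L a * u ^ i ∈ B := fun i =>
        B.mul_mem (B.algebraMap_mem a) (B.pow_mem (Algebra.self_mem_adjoin_singleton E u) i)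
      rw [Polynomial.aeval_monomial]
      rcases le_total m b with hm | hm
      · obtain ⟨c, rfl⟩ := Nat.exists_eq_add_of_le hm
        refine ⟨t ^ c * a * π ^ (j * m), 0, B.zero_mem, ?_⟩
        simp only [map_mul, map_pow]
        rw [pow_mul, ← hu]; ring
      · obtain ⟨c, rfl⟩ := Nat.exists_eq_add_of_le hm
        refine ⟨0, algebraMap E L a * u ^ c, hB c, ?_⟩
        rw [pow_mul, ← hu, map_zero]; ring
  · rintro e q ⟨⟨w, hw⟩, h1⟩
    replace h1 : algebraMap E L e = algebraMap E L π ^ q * w := congrArg Subtype.val h1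
    obtain ⟨b, e', he'⟩ := hL w
    obtain ⟨b', hb'⟩ := hL0 (t ^ b * e - π ^ q * e') (by
      simp only [map_sub, map_mul, map_pow, h1, ← he']; ring)
    refine h.mem_of_pow_mul ht (b' + b) q ⟨t ^ b' * e', ?_⟩
    linear_combination hb'

/-- The perfection of `E[πʲ/t]` and its relation to `E`. -/
theorem IsSpecialization.exists_perfect_model {E Q : Type u} [CommRing E] [CommRing Q]
    [Nontrivial Q] (p : ℕ) [Fact p.Prime] [CharP E p] {π : E}
    {θ : E →+* Q} (h : IsSpecialization π θ) {t : E} (ht : ∀ y, θ t * y = 0 → y = 0) (f : ℕ) :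
    ∃ (D : Type u) (_ : CommRing D) (_ : CharP D p) (_ : PerfectRing D p) (δ : E →+* D) (u : D),
      (∀ y, δ π * y = 0 → y = 0) ∧ δ t * u = δ π ^ p ^ f ∧
      (∀ d : D, ∃ m₀, ∀ m ≥ m₀, ∃ e d', δ t ^ p ^ m * d ^ p ^ (m + f) =
        δ e + δ π ^ p ^ (m + f) * d') ∧
      ∀ e q, δ π ^ q ∣ δ e → ∃ s₀, ∀ s ≥ s₀, π ^ (q * p ^ s) ∣ e ^ p ^ s := by
  obtain ⟨B, _, ι, u, hπ, hu, hB, hE⟩ := h.exists_adjoin_div ht (p ^ f)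
  have hBn : Nontrivial B := by
    by_contra hn
    rw [not_nontrivial_iff_subsingleton] at hn
    have : π ∣ 1 := by simpa using hE 1 1 ⟨0, Subsingleton.elim _ _⟩
    obtain ⟨y, hy⟩ := this
    have h1 : θ 1 = 0 := by rw [hy, map_mul, h.map_eq_zero, zero_mul]
    simp at h1
  have : CharP B p := charP_of_ringHom p ι
  have hroot : ∀ d : PerfectClosure B p, ∃ m b, d ^ p ^ m = PerfectClosure.of B p b := fun d => by
    obtain ⟨⟨m, b⟩, rfl⟩ := PerfectClosure.mk_surjective B p d
    refine ⟨m, b, ?_⟩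
    rw [← iterate_frobenius, PerfectClosure.iterate_frobenius_mk]
  have hof : ∀ b b', PerfectClosure.of B p b = PerfectClosure.of B p b' →
      ∃ m, b ^ p ^ m = b' ^ p ^ m := fun b b' hb => by
    rw [PerfectClosure.of_apply, PerfectClosure.of_apply, PerfectClosure.mk_eq_iff] at hb
    obtain ⟨m, hm⟩ := hb
    refine ⟨m, by simpa [iterate_frobenius] using hm⟩
  have hpow : ∀ (y : B) n, ι π ^ n * y = 0 → y = 0 := fun y n => by
    induction n with
    | zero => intro hy; simpa using hy
    | succ n ih => intro hy; exact ih (hπ _ (by rw [← hy]; ring))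
  refine ⟨PerfectClosure B p, inferInstance, inferInstance, inferInstance,
    (PerfectClosure.of B p).comp ι, PerfectClosure.of B p u, ?_, ?_, ?_, ?_⟩
  · intro y hy
    obtain ⟨m, b, hb⟩ := hroot y
    obtain ⟨m', hm'⟩ := hof (ι π ^ p ^ m * b) 0 (by
      rw [map_mul, ← hb, map_zero, map_pow, ← mul_pow]
      have : PerfectClosure.of B p (ι π) * y = 0 := hy
      rw [this, zero_pow (pow_pos (Fact.out : p.Prime).pos m).ne'])
    rw [mul_pow, zero_pow (pow_pos (Fact.out : p.Prime).pos m').ne', ← pow_mul] at hm'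
    have h1 := hpow _ _ hm'
    have h2 : y ^ p ^ (m + m') = 0 := by rw [pow_add, pow_mul, hb, ← map_pow, h1, map_zero]
    exact eq_zero_of_pow_eq_zero h2
  · rw [RingHom.comp_apply, RingHom.comp_apply, ← map_mul, hu, map_pow]
  · intro d
    obtain ⟨m₀, b, hb⟩ := hroot d
    refine ⟨m₀, fun m hm => ?_⟩
    obtain ⟨c, rfl⟩ := Nat.exists_eq_add_of_le hm
    obtain ⟨e, w, hw⟩ := hB (b ^ p ^ (c + f)) (p ^ (m₀ + c))
    refine ⟨e, PerfectClosure.of B p w, ?_⟩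
    have h1 : d ^ p ^ (m₀ + c + f) = PerfectClosure.of B p (b ^ p ^ (c + f)) := by
      rw [add_assoc, pow_add, pow_mul, hb, map_pow]
    rw [h1, RingHom.comp_apply, RingHom.comp_apply, RingHom.comp_apply, ← map_pow, ← map_mul, hw,
      map_add, map_mul, map_pow]
    ring_nf
  · rintro e q ⟨d, hd⟩
    obtain ⟨m, b, hb⟩ := hroot d
    obtain ⟨m', hm'⟩ := hof (ι e ^ p ^ m) (ι π ^ (q * p ^ m) * b) (by
      rw [map_pow, map_mul, ← hb, map_pow, pow_mul, ← mul_pow]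
      exact congrArg (· ^ p ^ m) hd)
    have h1 : π ^ (q * p ^ (m + m')) ∣ e ^ p ^ (m + m') := by
      apply hE
      refine ⟨b ^ p ^ m', ?_⟩
      rw [map_pow, pow_add, pow_mul, hm']; ring
    refine ⟨m + m', fun s hs => ?_⟩
    obtain ⟨c, rfl⟩ := Nat.exists_eq_add_of_le hs
    have := pow_dvd_pow_of_dvd h1 (p ^ c)
    rw [← pow_mul, ← pow_mul, mul_assoc, ← pow_add] at this
    exact this

end DirectSummand

namespace DirectSummand
universe u

/-- The relation between `E` and the perfection `D` of `E[πʲ/t]`, for `j = pᶠ`. -/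
structure IsPerfectModel {E D : Type*} [CommRing E] [CommRing D] (p f : ℕ) (π t : E)
    (δ : E →+* D) : Prop where
  exists_descent : ∀ d : D, ∃ m₀, ∀ m ≥ m₀, ∃ e d', δ t ^ p ^ m * d ^ p ^ (m + f) =
    δ e + δ π ^ p ^ (m + f) * d'
  pow_dvd : ∀ e q, δ π ^ q ∣ δ e → ∃ s₀, ∀ s ≥ s₀, π ^ (q * p ^ s) ∣ e ^ p ^ s

theorem IsPerfectModel.exists_descent_family {E D ι : Type*} [CommRing E] [CommRing D] [Fintype ι]
    {p f : ℕ} {π t : E} {δ : E →+* D} (h : IsPerfectModel p f π t δ) (d : ι → D) :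
    ∃ m₀, ∀ m ≥ m₀, ∃ (e : ι → E) (d' : ι → D), ∀ i, δ t ^ p ^ m * d i ^ p ^ (m + f) =
      δ (e i) + δ π ^ p ^ (m + f) * d' i := by
  choose m₀ hm₀ using fun i => h.exists_descent (d i)
  refine ⟨∑ i, m₀ i, fun m hm => ?_⟩
  choose e d' h using fun i => hm₀ i m
    ((Finset.single_le_sum (fun _ _ => Nat.zero_le _) (Finset.mem_univ i)).trans hm)
  exact ⟨e, d', h⟩

theorem IsPerfectModel.descend_mem {E D ι : Type*} [CommRing E] [CommRing D] [Fintype ι]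
    {p f : ℕ} [Fact p.Prime] [CharP E p] [CharP D p] {π t : E} {δ : E →+* D}
    (h : IsPerfectModel p f π t δ) (x : ι → E) (y : E) (y' : D) (e : ℕ)
    (hy : y' ^ p ^ (e + f) = δ y)
    (hmem : ∃ (w : D) (b : ι → D), y' = δ π * w + ∑ i, b i * δ (x i)) :
    ∃ s, ∃ (w : E) (b : ι → E), t ^ p ^ (s + e) * y ^ p ^ s =
      π ^ p ^ (s + e + f) * w + ∑ i, b i * x i ^ p ^ (s + e + f) := by
  obtain ⟨w, b, hwb⟩ := hmem
  obtain ⟨m₀, hm₀⟩ := h.exists_descent_family b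
  obtain ⟨a, b', hb⟩ := hm₀ (m₀ + e) (Nat.le_add_right _ _)
  set q := p ^ (m₀ + e + f) with hq
  have h1 : δ π ^ q ∣ δ (t ^ p ^ (m₀ + e) * y ^ p ^ m₀ - ∑ i, a i * x i ^ q) := by
    have e1 : y' ^ q = δ (y ^ p ^ m₀) := by
      rw [map_pow, ← hy, ← pow_mul, ← pow_add, hq]; congr 2; ring
    have e2 : y' ^ q = δ π ^ q * w ^ q + ∑ i, b i ^ q * δ (x i) ^ q := by
      rw [hwb, hq, add_pow_char_pow, sum_pow_char_pow, mul_pow]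
      simp only [mul_pow]
    refine ⟨δ t ^ p ^ (m₀ + e) * w ^ q + ∑ i, b' i * δ (x i) ^ q, ?_⟩
    have e3 : ∑ i, δ t ^ p ^ (m₀ + e) * (b i ^ q * δ (x i) ^ q) =
        ∑ i, δ (a i) * δ (x i) ^ q + δ π ^ q * ∑ i, b' i * δ (x i) ^ q := by
      rw [Finset.mul_sum, ← Finset.sum_add_distrib]
      refine Finset.sum_congr rfl fun i _ => ?_
      linear_combination δ (x i) ^ q * hb i
    rw [map_sub, map_mul, ← e1, e2, map_sum, map_pow, mul_add, Finset.mul_sum, e3]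
    simp only [map_mul, map_pow]
    ring
  obtain ⟨s₀, hs₀⟩ := h.pow_dvd _ _ h1
  obtain ⟨w', hw'⟩ := hs₀ s₀ le_rfl
  rw [sub_pow_char_pow, sum_pow_char_pow] at hw'
  refine ⟨m₀ + s₀, w', fun i => a i ^ p ^ s₀, ?_⟩
  have e4 : p ^ (m₀ + s₀ + e + f) = q * p ^ s₀ := by
    rw [hq, ← pow_add]; congr 1; ring
  have e5 : p ^ (m₀ + s₀ + e) = p ^ (m₀ + e) * p ^ s₀ := by
    rw [← pow_add]; congr 1; ring
  rw [e4, e5, pow_add p m₀ s₀, pow_mul, pow_mul, ← mul_pow, ← hw']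
  simp only [mul_pow, ← pow_mul]
  ring

theorem IsPerfectModel.koszulExact {E D ι : Type*} [CommRing E] [CommRing D] [Fintype ι]
    {p f : ℕ} [Fact p.Prime] [CharP E p] [CharP D p] [PerfectRing D p] {π t : E} {δ : E →+* D}
    (h : IsPerfectModel p f π t δ) (x : ι → E) (τ : D) (hτ : τ ^ p ^ f = δ t)
    (hx : ∀ q M, KoszulExact (fun i => x i ^ M) (Ideal.span {π ^ q}) 1) :
    KoszulExact (fun i => δ (x i)) (Ideal.span {δ π}) τ := by
  intro a ha
  obtain ⟨w, hw⟩ := Ideal.mem_span_singleton.1 ha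
  obtain ⟨m, hm⟩ := h.exists_descent_family a
  obtain ⟨e, d, hed⟩ := hm m le_rfl
  set q := p ^ (m + f) with hq
  have h1 : δ π ^ q ∣ δ (∑ i, x i ^ q * e i) := by
    refine ⟨δ t ^ p ^ m * w ^ q - ∑ i, δ (x i) ^ q * d i, ?_⟩
    have e2 : ∑ i, δ (x i) ^ q * a i ^ q = δ π ^ q * w ^ q := by
      rw [← mul_pow, ← hw, hq, sum_pow_char_pow]
      simp only [mul_pow]
    have e3 : δ t ^ p ^ m * ∑ i, δ (x i) ^ q * a i ^ q =
        ∑ i, δ (x i) ^ q * δ (e i) + δ π ^ q * ∑ i, δ (x i) ^ q * d i := by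
      rw [Finset.mul_sum, Finset.mul_sum, ← Finset.sum_add_distrib]
      refine Finset.sum_congr rfl fun i _ => ?_
      linear_combination δ (x i) ^ q * hed i
    rw [map_sum]
    simp only [map_mul, map_pow]
    linear_combination -e3 + δ t ^ p ^ m * e2
  obtain ⟨s, hs⟩ := h.pow_dvd _ _ h1
  have hs := hs s le_rfl
  rw [sum_pow_char_pow] at hs
  obtain ⟨b, hb⟩ := hx (q * p ^ s) (q * p ^ s) (fun i => e i ^ p ^ s) (by
    rw [Ideal.mem_span_singleton]
    simpa only [mul_pow, ← pow_mul] using hs)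
  have hN : q * p ^ s = p ^ (m + f + s) := by rw [hq, ← pow_add]
  have hroot : ∀ y : D, ∃ z, z ^ p ^ (m + f + s) = y := fun y => by
    obtain ⟨z, hz⟩ := (bijective_iterateFrobenius (R := D) (p := p) (n := m + f + s)).2 y
    exact ⟨z, by rw [← hz, iterateFrobenius_def]⟩
  choose r hr using hroot
  refine ⟨fun i k => r (δ (b i k)), fun i => ?_⟩
  obtain ⟨v, hv⟩ := Ideal.mem_span_singleton.1 (hb i)
  rw [one_mul] at hv
  rw [Ideal.mem_span_singleton]
  refine ⟨r (δ v) + r (d i ^ p ^ s), ?_⟩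
  apply (bijective_iterateFrobenius (R := D) (p := p) (n := m + f + s)).1
  rw [iterateFrobenius_def, iterateFrobenius_def, mul_pow, add_pow_char_pow, hr, hr,
    sub_pow_char_pow, sum_pow_char_pow, mul_pow]
  have e4 : ∑ k, ((r (δ (b i k)) - r (δ (b k i))) * δ (x k)) ^ p ^ (m + f + s) =
      δ (∑ k, (b i k - b k i) * x k ^ (q * p ^ s)) := by
    rw [map_sum]
    refine Finset.sum_congr rfl fun k _ => ?_
    rw [mul_pow, sub_pow_char_pow, hr, hr, map_mul, map_sub, map_pow, hN]
  have e5 : τ ^ p ^ (m + f + s) * a i ^ p ^ (m + f + s) =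
      δ (e i ^ p ^ s) + δ π ^ (q * p ^ s) * d i ^ p ^ s := by
    have e6 : τ ^ p ^ (m + f + s) = (δ t ^ p ^ m) ^ p ^ s := by
      rw [← hτ, ← pow_mul, ← pow_mul, ← pow_add, ← pow_add]; congr 2; ring
    rw [e6, ← hN, pow_mul, ← mul_pow, hed, add_pow_char_pow, map_pow, mul_pow, pow_mul]
  have hv' := congrArg δ hv
  rw [map_sub, map_mul, map_pow δ π] at hv'
  rw [e4, e5, ← hN]
  linear_combination hv'

end DirectSummand

namespace DirectSummand
open WittVector
universe u

/-- `lam` presents `A` as the quotient of `W(D)` by `p - [π]`. -/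
structure IsUntilt {D A : Type*} [CommRing D] [CommRing A] (p : ℕ) [Fact p.Prime] (π : D)
    (lam : WittVector p D →+* A) : Prop where
  surjective : Function.Surjective lam
  map_teichmuller : lam (teichmuller p π) = p
  eq_zero_of_mul : ∀ y : A, (p : A) * y = 0 → y = 0
  dvd_iff : ∀ w, (p : A) ∣ lam w ↔ π ∣ w.coeff 0

theorem p_dvd_iff_coeff_zero {D : Type*} [CommRing D] (p : ℕ) [Fact p.Prime] [CharP D p]
    [PerfectRing D p] (w : WittVector p D) : (p : WittVector p D) ∣ w ↔ w.coeff 0 = 0 := by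
  rw [← Ideal.mem_span_singleton, WittVector.mem_span_p_iff_coeff_zero_eq_zero]

theorem teichmuller_mul_coeff_zero {D : Type*} [CommRing D] (p : ℕ) [Fact p.Prime] (a : D)
    (w : WittVector p D) : (teichmuller p a * w).coeff 0 = a * w.coeff 0 := by
  rw [teichmuller_mul_coeff, pow_zero, pow_one]

theorem exists_isUntilt {D : Type u} [CommRing D] (p : ℕ) [Fact p.Prime] [CharP D p]
    [PerfectRing D p] (π : D) (hπ : ∀ y, π * y = 0 → y = 0) :
    ∃ (A : Type u) (_ : CommRing A) (lam : WittVector p D →+* A), IsUntilt p π lam := by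
  let ξ : WittVector p D := p - teichmuller p π
  have hp : ∀ w : WittVector p D, (p : WittVector p D) * w = 0 → w = 0 := fun w hw => by
    ext n
    have := congrArg (fun z : WittVector p D => z.coeff (n + 1)) hw
    simp only [mul_comm (p : WittVector p D), mul_charP_coeff_succ, zero_coeff] at this
    rw [zero_coeff]
    apply (bijective_frobenius (R := D) (p := p)).1
    rw [map_zero]; exact this
  let lam := Ideal.Quotient.mk (Ideal.span {ξ})
  have hlam : lam (teichmuller p π) = p := by
    rw [← map_natCast lam, eq_comm, Ideal.Quotient.eq]
    exact Ideal.mem_span_singleton_self _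
  refine ⟨WittVector p D ⧸ Ideal.span {ξ}, inferInstance, lam, Ideal.Quotient.mk_surjective,
    hlam, ?_, ?_⟩
  · intro y hy
    obtain ⟨w, rfl⟩ := Ideal.Quotient.mk_surjective y
    rw [← map_natCast lam, ← map_mul, Ideal.Quotient.eq_zero_iff_mem,
      Ideal.mem_span_singleton] at hy
    obtain ⟨v, hv⟩ := hy
    have h1 : (teichmuller p π * v).coeff 0 = 0 := by
      rw [← p_dvd_iff_coeff_zero]
      exact ⟨v - w, by simp only [ξ] at hv; linear_combination hv⟩
    rw [teichmuller_mul_coeff_zero] at h1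
    obtain ⟨v', rfl⟩ := (p_dvd_iff_coeff_zero p v).2 (hπ _ h1)
    rw [Ideal.Quotient.eq_zero_iff_mem, Ideal.mem_span_singleton]
    refine ⟨v', ?_⟩
    rw [← sub_eq_zero]
    apply hp
    linear_combination hv
  · intro w
    constructor
    · rintro ⟨y, hy⟩
      obtain ⟨w', rfl⟩ := Ideal.Quotient.mk_surjective y
      rw [← map_natCast lam, ← map_mul, Ideal.Quotient.eq, Ideal.mem_span_singleton] at hy
      obtain ⟨v, hv⟩ := hy
      refine ⟨-v.coeff 0, ?_⟩
      have h1 : (w + teichmuller p π * v).coeff 0 = 0 := by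
        rw [← p_dvd_iff_coeff_zero]
        exact ⟨w' + v, by simp only [ξ] at hv; linear_combination hv⟩
      have h2 : ∀ z : WittVector p D, z.coeff 0 = constantCoeff z := fun _ => rfl
      rw [h2, map_add, ← h2, ← h2, teichmuller_mul_coeff_zero] at h1
      linear_combination h1
    · rintro ⟨d, hd⟩
      have h1 : (w - teichmuller p π * teichmuller p d).coeff 0 = 0 := by
        have h2 : ∀ z : WittVector p D, z.coeff 0 = constantCoeff z := fun _ => rfl
        rw [h2, map_sub, ← h2, ← h2, teichmuller_mul_coeff_zero, teichmuller_coeff_zero, hd,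
          sub_self]
      obtain ⟨v, hv⟩ := (p_dvd_iff_coeff_zero p _).2 h1
      refine ⟨lam (teichmuller p d) + lam v, ?_⟩
      have : w = teichmuller p π * teichmuller p d + p * v := by linear_combination hv
      rw [this, map_add, map_mul, map_mul, hlam, map_natCast]
      ring

theorem IsUntilt.pow_dvd_of_pow_dvd_pow {D A : Type*} [CommRing D] [CommRing A] {p : ℕ}
    [Fact p.Prime] [CharP D p] [PerfectRing D p] {π : D}
    {lam : WittVector p D →+* A} (h : IsUntilt p π lam) (J e : ℕ) (w : A) (hw : (p : A) ^ (J * p ^ e) ∣ w ^ p ^ e) :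
    (p : A) ^ J ∣ w := by
  have hp : p ≠ 0 := (Fact.out : p.Prime).ne_zero
  obtain ⟨ϖ, hϖ⟩ := (bijective_frobenius (R := D) (p := p)).2 π
  rw [frobenius_def] at hϖ
  have h1 : lam (teichmuller p ϖ) ^ p = p := by rw [← map_pow, ← map_pow, hϖ, h.map_teichmuller]
  have key : ∀ a : A, (p : A) ∣ a ^ p → lam (teichmuller p ϖ) ∣ a := fun a ha => by
    obtain ⟨w, rfl⟩ := h.surjective a
    rw [← map_pow, h.dvd_iff] at ha
    have h2 : ∀ z : WittVector p D, z.coeff 0 = constantCoeff z := fun _ => rfl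
    rw [h2, map_pow, ← h2] at ha
    obtain ⟨d, hd⟩ := ha
    obtain ⟨d, rfl⟩ := (bijective_frobenius (R := D) (p := p)).2 d
    have h3 : w.coeff 0 = ϖ * d := by
      apply (bijective_frobenius (R := D) (p := p)).1
      rw [map_mul, frobenius_def, hd, frobenius_def (p := p) ϖ, hϖ]
    have h4 : (w - teichmuller p ϖ * teichmuller p d).coeff 0 = 0 := by
      rw [h2, map_sub, ← h2, ← h2, teichmuller_mul_coeff_zero, teichmuller_coeff_zero, h3,
        sub_self]
    obtain ⟨v, hv⟩ := (p_dvd_iff_coeff_zero p _).2 h4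
    have h5 : w = teichmuller p ϖ * teichmuller p d + p * v := by linear_combination hv
    rw [h5, map_add, map_mul, map_mul, map_natCast, ← h1]
    exact dvd_add (dvd_mul_right _ _) ((dvd_pow_self _ hp).mul_right _)
  have key2 : ∀ n (a : A), (p : A) ^ n ∣ a ^ p → lam (teichmuller p ϖ) ^ n ∣ a := by
    intro n
    induction n with
    | zero => intro a _; simp
    | succ n ih =>
      intro a ha
      obtain ⟨b, rfl⟩ := key a (dvd_trans (dvd_pow_self _ n.succ_ne_zero) ha)
      rw [pow_succ']
      refine mul_dvd_mul_left _ (ih b ?_)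
      obtain ⟨c, hc⟩ := ha
      refine ⟨c, ?_⟩
      rw [← sub_eq_zero]
      apply h.eq_zero_of_mul
      rw [mul_pow, h1] at hc
      linear_combination hc
  induction e with
  | zero => simpa using hw
  | succ e ih =>
    apply ih
    have := key2 (J * p ^ e * p) (w ^ p ^ e) (by rwa [← pow_mul, mul_assoc, ← pow_succ])
    rwa [mul_comm (J * p ^ e), pow_mul, h1] at this

theorem IsUntilt.koszulExact {D A ι : Type*} [CommRing D] [CommRing A] [Fintype ι] {p : ℕ}
    [Fact p.Prime] {π : D} {lam : WittVector p D →+* A} (h : IsUntilt p π lam)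
    (x : ι → WittVector p D) (τ : WittVector p D)
    (hx : KoszulExact (fun i => (x i).coeff 0) (Ideal.span {π}) (τ.coeff 0)) :
    KoszulExact (fun i => lam (x i)) (Ideal.span {(p : A)}) (lam τ) := by
  have h2 : ∀ z : WittVector p D, z.coeff 0 = constantCoeff z := fun _ => rfl
  intro a ha
  choose w hw using fun i => h.surjective (a i)
  obtain rfl : (fun i => lam (w i)) = a := funext hw
  simp only [← map_mul] at ha
  rw [← map_sum, Ideal.mem_span_singleton, h.dvd_iff, h2, map_sum] at ha
  simp only [map_mul] at ha
  simp only [← h2] at ha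
  obtain ⟨b, hb⟩ := hx _ (Ideal.mem_span_singleton.2 ha)
  refine ⟨fun i j => lam (teichmuller p (b i j)), fun i => ?_⟩
  simp only [← map_mul, ← map_sub]
  rw [← map_sum, ← map_sub, Ideal.mem_span_singleton, h.dvd_iff, h2, map_sub, map_sum]
  simp only [map_mul, map_sub]
  simp only [← h2, teichmuller_coeff_zero]
  exact Ideal.mem_span_singleton.1 (hb i)

end DirectSummand

namespace DirectSummand
open WittVector Polynomial
universe u

theorem pow_dvd_mul_pow_of_integral {A : Type*} [CommRing A] (P v b : A) (c : ℕ → A)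
    (d J l : ℕ) (hd : d ≠ 0) (hl : J * d ≤ l)
    (h : v ^ d + ∑ k ∈ Finset.range d, c k * P ^ (J * (d - k)) * v ^ k = P ^ l * b) (m : ℕ) :
    P ^ (J * m) ∣ P ^ (J * d) * v ^ m := by
  induction m using Nat.strong_induction_on with
  | _ m ih =>
    rcases le_total m d with hm | hm
    · exact (pow_dvd_pow _ (Nat.mul_le_mul_left _ hm)).mul_right _
    · obtain ⟨s, rfl⟩ := Nat.exists_eq_add_of_le hm
      have h1 : P ^ (J * d) * v ^ (d + s) = P ^ l * b * (P ^ (J * d) * v ^ s) -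
          ∑ k ∈ Finset.range d, c k * (P ^ (J * (d - k)) * (P ^ (J * d) * v ^ (k + s))) := by
        have h2 : ∑ k ∈ Finset.range d, c k * (P ^ (J * (d - k)) * (P ^ (J * d) * v ^ (k + s))) =
            (P ^ (J * d) * v ^ s) * ∑ k ∈ Finset.range d, c k * P ^ (J * (d - k)) * v ^ k := by
          rw [Finset.mul_sum]
          exact Finset.sum_congr rfl fun k _ => by ring
        rw [h2]
        linear_combination (P ^ (J * d) * v ^ s) * h
      rw [h1]
      refine dvd_sub ?_ (Finset.dvd_sum fun k hk => ?_)
      · rw [mul_add, pow_add]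
        exact mul_dvd_mul ((pow_dvd_pow _ hl).mul_right _) (ih s (by omega))
      · have hk' := Finset.mem_range.1 hk
        have e : J * (d + s) = J * (d - k) + J * (k + s) := by
          rw [← mul_add]; congr 1; omega
        rw [e, pow_add]
        exact (mul_dvd_mul_left _ (ih (k + s) (by omega))).mul_left _

theorem pow_dvd_mul_eval {R A : Type*} [CommRing R] [CommRing A] (p : ℕ) (P : A)
    (hroot : ∀ (J e : ℕ) (w : A), P ^ (J * p ^ e) ∣ w ^ p ^ e → P ^ J ∣ w)
    (ρ : R →+* A) (y : A) (F G : R[X]) (h : R) (U ε κ b : A) (d d₀ J l e : ℕ)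
    (hF : F.eval₂ ρ y = P ^ l * b) (hU : ρ h * U = P ^ J * ε) (hκ : κ ^ p ^ e = P ^ (J * d₀))
    (hd : d ≠ 0) (hd₀ : d ≤ d₀) (hl : J * d₀ ≤ l) (c : ℕ → R)
    (hG : F ∣ G ^ d + ∑ k ∈ Finset.range d, C (c k * h ^ (d - k)) * G ^ k) :
    P ^ J ∣ κ * (U * G.eval₂ ρ y) := by
  set v := U * G.eval₂ ρ y with hv
  obtain ⟨H, hH⟩ := hG
  have h1 := congrArg (fun f : R[X] => U ^ d * f.eval₂ ρ y) hH
  simp only [eval₂_add, eval₂_mul, eval₂_pow, eval₂_finsetSum, eval₂_C, hF, mul_add,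
    Finset.mul_sum, ← mul_pow, ← hv, map_mul, map_pow] at h1
  have h2 : v ^ d + ∑ k ∈ Finset.range d, (ρ (c k) * ε ^ (d - k)) * P ^ (J * (d - k)) * v ^ k =
      P ^ l * (U ^ d * b * H.eval₂ ρ y) := by
    rw [← sub_eq_zero, ← sub_eq_zero.2 h1]
    have : ∑ k ∈ Finset.range d, (ρ (c k) * ε ^ (d - k)) * P ^ (J * (d - k)) * v ^ k =
        ∑ k ∈ Finset.range d, U ^ d * (ρ (c k) * ρ h ^ (d - k) * G.eval₂ ρ y ^ k) := by
      refine Finset.sum_congr rfl fun k hk => ?_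
      have e1 : d = (d - k) + k := (Nat.sub_add_cancel (Finset.mem_range.1 hk).le).symm
      have e2 : U ^ d = U ^ (d - k) * U ^ k := by rw [← pow_add, ← e1]
      have e3 : (ρ h * U) ^ (d - k) = P ^ (J * (d - k)) * ε ^ (d - k) := by
        rw [hU, mul_pow, pow_mul]
      rw [e2, hv, mul_pow]
      rw [mul_pow] at e3
      linear_combination -(ρ (c k) * U ^ k * G.eval₂ ρ y ^ k) * e3
    rw [this]; ring
  apply hroot J e
  rw [mul_pow, hκ]
  refine (pow_dvd_mul_pow_of_integral P v _ _ d J l hd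
    ((Nat.mul_le_mul_left _ hd₀).trans hl) h2 (p ^ e)).trans ?_
  exact mul_dvd_mul_right (pow_dvd_pow _ (Nat.mul_le_mul_left _ hd₀)) _

end DirectSummand

namespace DirectSummand
open WittVector Polynomial
universe u

/-- `G / h` satisfies a monic equation of degree at most `d₀` modulo `F`. -/
def IsIntegralMod {R : Type*} [CommRing R] (F : R[X]) (h : R) (d₀ : ℕ) (G : R[X]) : Prop :=
  ∃ d ≠ 0, d ≤ d₀ ∧ ∃ c : ℕ → R,
    F ∣ G ^ d + ∑ k ∈ Finset.range d, C (c k * h ^ (d - k)) * G ^ k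

theorem exists_almost_relation {R A ι : Type*} [CommRing R] [CommRing A] [Fintype ι] (p : ℕ)
    (hP : ∀ y : A, (p : A) * y = 0 → y = 0)
    (hroot : ∀ (J e : ℕ) (w : A), (p : A) ^ (J * p ^ e) ∣ w ^ p ^ e → (p : A) ^ J ∣ w)
    (ρ : R →+* A) (y : A) (F G₀ : R[X]) (G : ι → R[X]) (h X : R) (T : ι → R) (U ε κ b : A)
    (d₀ J l e N : ℕ)
    (hF : F.eval₂ ρ y = (p : A) ^ l * b) (hU : ρ h * U = (p : A) ^ J * (1 + p * ε))
    (hκ : κ ^ p ^ e = (p : A) ^ (J * d₀)) (hl : J * d₀ ≤ l) (hl' : J + N + 1 ≤ l)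
    (hG₀ : IsIntegralMod F h d₀ G₀) (hG : ∀ i, IsIntegralMod F h d₀ (G i))
    (hrel : F ∣ C (h * p ^ N * X ^ N) - (C ((p : R) ^ (N + 1)) * G₀ +
      ∑ i, C (T i ^ (N + 1)) * G i)) :
    ∃ (a₀ : A) (a : ι → A), κ * p ^ N * ρ X ^ N = p ^ (N + 1) * a₀ +
      ∑ i, a i * ρ (T i) ^ (N + 1) := by
  have hPow : ∀ n (y : A), (p : A) ^ n * y = 0 → y = 0 := fun n => by
    induction n with
    | zero => intro y hy; simpa using hy
    | succ n ih => intro y hy; exact ih _ (hP _ (by rw [← hy]; ring))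
  have hdiv : ∀ G, IsIntegralMod F h d₀ G → (p : A) ^ J ∣ κ * (U * G.eval₂ ρ y) := by
    rintro G ⟨d, hd, hd₀, c, hc⟩
    exact pow_dvd_mul_eval p (p : A) hroot ρ y F G h U (1 + p * ε) κ b d d₀ J l e hF hU hκ hd hd₀
      hl c hc
  obtain ⟨v₀, hv₀⟩ := hdiv G₀ hG₀
  choose v hv using fun i => hdiv (G i) (hG i)
  obtain ⟨H, hH⟩ := hrel
  have h1 := congrArg (fun f : R[X] => κ * U * f.eval₂ ρ y) hH
  simp only [eval₂_sub, eval₂_add, eval₂_mul, eval₂_finsetSum, eval₂_C, eval₂_pow, eval₂_natCast, hF,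
    map_mul, map_pow,
    map_natCast] at h1
  obtain ⟨l, rfl⟩ := Nat.exists_eq_add_of_le hl'
  have h2 : κ * U * ∑ i, ρ (T i) ^ (N + 1) * (G i).eval₂ ρ y =
      (p : A) ^ J * ∑ i, v i * ρ (T i) ^ (N + 1) := by
    rw [Finset.mul_sum, Finset.mul_sum]
    refine Finset.sum_congr rfl fun i _ => ?_
    linear_combination ρ (T i) ^ (N + 1) * hv i
  refine ⟨v₀ + p ^ l * b * κ * U * H.eval₂ ρ y - ε * κ * ρ X ^ N, v, ?_⟩
  rw [← sub_eq_zero]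
  apply hPow J
  rw [mul_sub] at h1
  simp only [mul_add (κ * U)] at h1
  rw [h2] at h1
  linear_combination h1 - κ * p ^ N * ρ X ^ N * hU + (p : A) ^ (N + 1) * hv₀

theorem exists_relation_specialization {E Q D A ι : Type*} [CommRing E] [CommRing Q] [CommRing D]
    [CommRing A] [Fintype ι] {p f : ℕ} [Fact p.Prime] [CharP E p] [CharP D p] [PerfectRing D p]
    {π t : E} {θ : E →+* Q} {δ : E →+* D} (hθ : IsSpecialization π θ)
    (hδ : IsPerfectModel p f π t δ) {lam : WittVector p D →+* A} (hlam : IsUntilt p (δ π) lam)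
    (τ : D) (hτ : τ ^ p ^ f = δ t) (x : ι → E)
    (hx : ∀ M, KoszulExact (fun i => θ (x i) ^ M) ⊥ 1)
    (T : ι → WittVector p D) (hT : ∀ i, (T i).coeff 0 = δ (x i))
    (κ : D) (c e N : ℕ) (hc : c < p ^ e) (hκ : κ ^ p ^ e = δ π ^ c)
    (a₀ : A) (a : ι → A)
    (hrel : lam (teichmuller p κ) * p ^ N * (∏ i, lam (T i)) ^ N =
      p ^ (N + 1) * a₀ + ∑ i, a i * lam (T i) ^ (N + 1)) :
    ∃ m, θ t ^ ((N + 1) * p ^ m) * (∏ i, θ (x i)) ^ (N * (p ^ m * p ^ f)) ∈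
      Ideal.span (Set.range fun i => θ (x i) ^ ((N + 1) * (p ^ m * p ^ f))) := by
  have hcc : ∀ z : WittVector p D, z.coeff 0 = constantCoeff z := fun _ => rfl
  have hp : p ≠ 0 := (Fact.out : p.Prime).ne_zero
  have hKE : ∀ q M, KoszulExact (fun i => x i ^ M) (Ideal.span {π ^ q}) 1 := fun q M =>
    KoszulExact.lift_pow hθ.eq_zero_of_mul θ hθ.surjective hθ.ker (by simpa using hx M) q
  have hKD : KoszulExact (fun i => δ (x i ^ (N + 1))) (Ideal.span {δ π}) τ :=
    hδ.koszulExact (fun i => x i ^ (N + 1)) τ hτ fun q M => by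
      simpa only [← pow_mul] using hKE q ((N + 1) * M)
  have hKA : KoszulExact (fun i => lam (T i ^ (N + 1))) (Ideal.span {(p : A)})
      (lam (teichmuller p τ)) := by
    refine hlam.koszulExact _ _ ?_
    have : (fun i => (T i ^ (N + 1)).coeff 0) = fun i => δ (x i ^ (N + 1)) := by
      ext i; rw [hcc, map_pow, ← hcc, hT, map_pow]
    rw [this, teichmuller_coeff_zero]
    exact hKD
  have h1 : lam (teichmuller p τ) ^ N * (lam (teichmuller p κ) * (∏ i, lam (T i)) ^ N - p * a₀) ∈
      Ideal.span (Set.range fun i => lam (T i ^ (N + 1))) := by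
    refine hKA.mem_of_pow_mul_mem hlam.eq_zero_of_mul N ((mem_span_range_iff_sum _ _).2 ⟨a, ?_⟩)
    simp only [map_pow]
    linear_combination hrel
  obtain ⟨b, hb⟩ := (mem_span_range_iff_sum _ _).1 h1
  obtain ⟨w₀, rfl⟩ := hlam.surjective a₀
  choose w hw using fun i => hlam.surjective (b i)
  have h2 : (p : A) ∣ lam (teichmuller p τ ^ N * (teichmuller p κ * (∏ i, T i) ^ N) -
      ∑ i, w i * T i ^ (N + 1)) := by
    refine ⟨lam (teichmuller p τ) ^ N * lam w₀, ?_⟩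
    simp only [map_sub, map_mul, map_pow, map_prod, map_sum, hw]
    simp only [map_pow] at hb
    linear_combination hb
  rw [hlam.dvd_iff, hcc] at h2
  simp only [map_sub, map_mul, map_pow, map_prod, map_sum] at h2
  simp only [← hcc, teichmuller_coeff_zero, hT] at h2
  obtain ⟨z, hz⟩ := h2
  obtain ⟨s, w', b', hs⟩ := hδ.descend_mem (fun i => x i ^ (N + 1))
    (t ^ (N * p ^ e) * π ^ (c * p ^ f) * (∏ i, x i) ^ (N * p ^ (e + f)))
    (τ ^ N * (κ * (∏ i, δ (x i)) ^ N)) e (by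
      have e1 : τ ^ (N * p ^ (e + f)) = δ t ^ (N * p ^ e) := by
        rw [← hτ, ← pow_mul, pow_add]; congr 1; ring
      have e2 : κ ^ p ^ (e + f) = δ π ^ (c * p ^ f) := by
        rw [pow_add, pow_mul, hκ, ← pow_mul]
      rw [mul_pow, mul_pow, ← pow_mul, ← pow_mul, e1, e2]
      simp only [map_mul, map_pow, map_prod]
      ring)
    ⟨z, fun i => (w i).coeff 0, by simp only [map_pow]; linear_combination hz⟩
  set m := s + e with hm
  set q := p ^ (s + e + f) with hq
  have hqf : p ^ m * p ^ f = q := by rw [hq, hm, ← pow_add]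
  set c' := c * p ^ f * p ^ s with hc'
  have hcq : c' ≤ q := by
    have e0 : q = p ^ e * p ^ f * p ^ s := by rw [hq, ← pow_add, ← pow_add]; congr 1; ring
    rw [hc', e0]
    exact Nat.mul_le_mul_right _ (Nat.mul_le_mul_right _ hc.le)
  have hcq' : c' < q := by
    have e0 : q = p ^ e * p ^ f * p ^ s := by rw [hq, ← pow_add, ← pow_add]; congr 1; ring
    rw [hc', e0]
    exact Nat.mul_lt_mul_of_pos_right (Nat.mul_lt_mul_of_pos_right hc
      (pow_pos (Nat.pos_of_ne_zero hp) _)) (pow_pos (Nat.pos_of_ne_zero hp) _)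
  obtain ⟨r, hr⟩ := Nat.exists_eq_add_of_lt hcq'
  have e3 : (t ^ (N * p ^ e) * π ^ (c * p ^ f) * (∏ i, x i) ^ (N * p ^ (e + f))) ^ p ^ s =
      t ^ (N * p ^ m) * π ^ c' * (∏ i, x i) ^ (N * q) := by
    rw [mul_pow, mul_pow, ← pow_mul, ← pow_mul, ← pow_mul, hc', hq, hm]
    congr 2
    · congr 1; rw [mul_assoc, ← pow_add, add_comm s]
    · rw [mul_assoc, ← pow_add]; congr 2; ring
  have h3 : π ^ c' * (t ^ ((N + 1) * p ^ m) * (∏ i, x i) ^ (N * q) - π ^ (r + 1) * w') ∈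
      Ideal.span (Set.range fun i => x i ^ ((N + 1) * q)) := by
    rw [mem_span_range_iff_sum]
    refine ⟨b', ?_⟩
    rw [e3] at hs
    simp only [← pow_mul] at hs
    have e4 : π ^ q = π ^ c' * π ^ (r + 1) := by rw [← pow_add, hr, add_assoc]
    rw [e4] at hs
    linear_combination hs
  have h4 := KoszulExact.mem_of_pow_mul_mem hθ.eq_zero_of_mul
    (by simpa only [pow_one] using hKE 1 ((N + 1) * q)) c' h3
  rw [one_pow, one_mul] at h4
  obtain ⟨a', ha'⟩ := (mem_span_range_iff_sum _ _).1 h4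
  refine ⟨m, ?_⟩
  rw [hqf, mem_span_range_iff_sum]
  refine ⟨fun i => θ (a' i), ?_⟩
  have h5 := congrArg θ ha'
  simp only [map_sub, map_mul, map_pow, map_sum, map_prod, hθ.map_eq_zero] at h5
  rw [zero_pow (Nat.succ_ne_zero r), zero_mul, sub_zero] at h5
  exact h5

end DirectSummand

namespace DirectSummand
open WittVector Polynomial
universe u

theorem WittEq.exists_sub_eq {D : Type*} [CommRing D] {p : ℕ} [Fact p.Prime] [CharP D p]
    [PerfectRing D p] {l : ℕ} {x y : WittVector p D} (h : WittEq l x y) :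
    ∃ c, x - y = p ^ l * c := by
  have h1 := (mem_span_p_pow_iff_le_coeff_eq_zero (x - y) l).2
    (le_coeff_eq_iff_le_sub_coeff_eq_zero.1 h)
  exact Ideal.mem_span_singleton.1 h1

theorem exists_pow_eq {D : Type*} [CommRing D] (p : ℕ) [Fact p.Prime] [CharP D p]
    [PerfectRing D p] (y : D) (n : ℕ) : ∃ z, z ^ p ^ n = y := by
  obtain ⟨z, hz⟩ := (bijective_iterateFrobenius (R := D) (p := p) (n := n)).2 y
  exact ⟨z, by rw [← hz, iterateFrobenius_def]⟩

theorem koszulExact_map_of_faithfullyFlat {A B ι : Type*} [CommRing A] [CommRing B] [Fintype ι]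
    {σ : A →+* B} (hσ : σ.FaithfullyFlat) {x : ι → A} (hx : KoszulExact x ⊥ 1) :
    KoszulExact (fun i => σ (x i)) ⊥ 1 := by
  let _ := σ.toAlgebra
  have : Module.FaithfullyFlat A B := hσ
  exact hx.of_flat

theorem mul_eq_zero_of_faithfullyFlat {A B : Type*} [CommRing A] [CommRing B]
    {σ : A →+* B} (hσ : σ.FaithfullyFlat) {g : A} (hg : ∀ y, g * y = 0 → y = 0) (y : B)
    (hy : σ g * y = 0) : y = 0 := by
  have h1 : KoszulExact (fun _ : Unit => g) ⊥ 1 := fun a ha =>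
    ⟨0, fun i => by simpa using hg (a i) (by simpa using ha)⟩
  obtain ⟨b, hb⟩ := koszulExact_map_of_faithfullyFlat hσ h1 (fun _ => y) (by simpa using hy)
  simpa using hb ()

theorem not_exists_relation {p : ℕ} [Fact p.Prime] {R k : Type u} {σ : Type} [CommRing R] [CommRing k]
    [IsDomain k] [CharP k p] [Fintype σ] (f₀ : R →+* WittVector p (MvPowerSeries σ k)) (T : σ → R)
    (hT : ∀ i, (f₀ (T i)).coeff 0 = MvPowerSeries.X i) (F : R[X]) (hF : F.Monic)
    (hdeg : F.natDegree ≠ 0) (a : ℕ) (g h : R) (hh : h = (p : R) ^ a * g)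
    (hg : (f₀ g).coeff 0 ≠ 0) (N d₀ : ℕ) (G₀ : R[X]) (G : σ → R[X])
    (hG₀ : IsIntegralMod F h d₀ G₀) (hG : ∀ i, IsIntegralMod F h d₀ (G i))
    (hrel : F ∣ C (h * p ^ N * (∏ i, T i) ^ N) - (C ((p : R) ^ (N + 1)) * G₀ +
      ∑ i, C (T i ^ (N + 1)) * G i)) : False := by
  have : CharP (MvPowerSeries σ k) p :=
    charP_of_ringHom p (MvPowerSeries.C : k →+* MvPowerSeries σ k)
  set g₀ := (f₀ g).coeff 0 with hg₀
  obtain ⟨e₀, he₀⟩ : ∃ e, MvPowerSeries.coeff e (g₀ ^ (N + 1)) ≠ 0 := by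
    by_contra! h
    exact pow_ne_zero (N + 1) hg (MvPowerSeries.ext fun e => by rw [h e]; rfl)
  have hp1 : 1 < p := (Fact.out : p.Prime).one_lt
  obtain ⟨f, hf⟩ : ∃ f, ∀ i, e₀ i < p ^ f := ⟨∑ i, e₀ i, fun i =>
    (Finset.single_le_sum (fun _ _ => Nat.zero_le _) (Finset.mem_univ i)).trans_lt
      (Nat.lt_pow_self hp1)⟩
  set J := a + p ^ f with hJ
  set l := p ^ f + 1 + (J * d₀ + (J + N + 1)) with hl
  obtain ⟨E, Q, _, _, _, _, fE, π, x, t, θ, s, z₁, z₂, hθ, hs, hcomp, hz₁, hz₂⟩ :=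
    exists_perfectoid_approximation p f₀ F hF hdeg g l
  have hcc : ∀ {B : Type u} [CommRing B] (z : WittVector p B), z.coeff 0 = constantCoeff z :=
    fun _ => rfl
  have hθt : θ t = s g₀ := by
    have h1 := hz₂ 0 (by omega)
    rw [mul_charP_coeff_zero, hcc, map_add, map_neg, map_sub, map_mul, ← hcc, ← hcc, ← hcc,
      ← hcc, teichmuller_coeff_zero, teichmuller_coeff_zero] at h1
    have h2 := congrArg θ h1
    rw [map_add, map_neg, map_sub, map_mul, hθ.map_eq_zero, hcomp, map_zero] at h2
    linear_combination -h2
  have ht : ∀ y, θ t * y = 0 → y = 0 := fun y hy =>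
    mul_eq_zero_of_faithfullyFlat hs
      (fun y hy => (mul_eq_zero.1 hy).resolve_left hg) y (hθt ▸ hy)
  obtain ⟨D, _, _, _, δ, u, hπ, hu, hdesc, hdvd⟩ := hθ.exists_perfect_model p ht f
  obtain ⟨A, _, lam, hlam⟩ := exists_isUntilt p (δ π) hπ
  let ρ : R →+* A := lam.comp ((WittVector.map δ).comp fE)
  obtain ⟨b₁, hb₁⟩ := (hz₁.map δ).exists_sub_eq
  obtain ⟨b₂, hb₂⟩ := (hz₂.map δ).exists_sub_eq
  obtain ⟨τ, hτ⟩ := exists_pow_eq p (δ t) f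
  obtain ⟨κ, hκ⟩ := exists_pow_eq p (δ π ^ (J * d₀)) (J * d₀)
  have hFy : F.eval₂ ρ (lam (teichmuller p (δ x))) = (p : A) ^ l * (-lam b₁) := by
    have h1 := congrArg lam hb₁
    simp only [map_add, map_sub, map_mul, map_neg, map_pow, map_natCast, map_teichmuller,
      hlam.map_teichmuller, hom_eval₂] at h1
    have h2 : F.eval₂ ρ (lam (teichmuller p (δ x))) =
        F.eval₂ (lam.comp ((WittVector.map δ).comp fE)) (lam (teichmuller p (δ x))) := rfl
    rw [h2]
    linear_combination -h1
  have hρg : lam (teichmuller p (δ t)) - ρ g = (p : A) ^ l * (-lam b₂) := by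
    have h1 := congrArg lam hb₂
    simp only [map_add, map_sub, map_mul, map_neg, map_pow, map_natCast, map_teichmuller,
      hlam.map_teichmuller] at h1
    have h2 : ρ g = lam (WittVector.map δ (fE g)) := rfl
    rw [h2]
    linear_combination -h1
  have hU : ρ h * lam (teichmuller p u) = (p : A) ^ J *
      (1 + p * (p ^ (J * d₀ + (J + N + 1)) * lam b₂ * lam (teichmuller p u))) := by
    have h1 : lam (teichmuller p (δ t)) * lam (teichmuller p u) = (p : A) ^ p ^ f := by
      rw [← map_mul, ← map_mul, hu, map_pow, map_pow, hlam.map_teichmuller]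
    rw [hh, map_mul, map_pow, map_natCast, hJ, pow_add]
    rw [hl, pow_add, pow_add, pow_one] at hρg
    linear_combination (p : A) ^ a * h1 - (p : A) ^ a * lam (teichmuller p u) * hρg
  obtain ⟨a₀, c, hac⟩ := exists_almost_relation p hlam.eq_zero_of_mul
    hlam.pow_dvd_of_pow_dvd_pow ρ (lam (teichmuller p (δ x))) F G₀ G h
    (∏ i, T i) T (lam (teichmuller p u)) _
    (lam (teichmuller p κ)) _ d₀ J l (J * d₀) N hFy hU
    (by rw [← map_pow, ← map_pow, hκ, map_pow, map_pow, hlam.map_teichmuller])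
    (by omega) (by omega) hG₀ hG hrel
  have hθx : ∀ i, θ ((fE (T i)).coeff 0) = s (MvPowerSeries.X i) := fun i => by
    rw [hcomp, hT]
  obtain ⟨m, hm⟩ := exists_relation_specialization hθ ⟨hdesc, hdvd⟩ hlam τ hτ
    (fun i => (fE (T i)).coeff 0) (fun M => by
      simp only [hθx, ← map_pow]
      exact koszulExact_map_of_faithfullyFlat hs (mvPowerSeries_koszulExact M))
    (fun i => WittVector.map δ (fE (T i))) (fun i => by rw [map_coeff])
    κ (J * d₀) (J * d₀) N (Nat.lt_pow_self hp1) hκ a₀ c (by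
      rw [map_prod] at hac; exact hac)
  simp only [hθx, hθt, ← map_pow, ← map_prod, ← map_mul] at hm
  refine pow_mul_prod_X_pow_notMem p (g₀ ^ (N + 1)) e₀ he₀ (p ^ f) m N hf ?_
  let _ := s.toAlgebra
  have : Module.FaithfullyFlat (MvPowerSeries σ k) Q := hs
  rw [← pow_mul, ← Ideal.comap_map_eq_self_of_faithfullyFlat (B := Q) (Ideal.span _),
    Ideal.mem_comap, Ideal.map_span, ← Set.range_comp]
  exact hm

end DirectSummand

namespace DirectSummand
open Polynomial IntermediateField

/-- An integral primitive element: every element of a finite separable extension of the fraction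
field of `R` becomes, up to denominators, a polynomial over `R` in a root of a monic polynomial. -/
theorem exists_monic_generator (R K L : Type*) [CommRing R] [IsDomain R] [Field K] [Field L]
    [Algebra R K] [IsFractionRing R K] [Algebra K L] [Algebra R L] [IsScalarTower R K L]
    [FiniteDimensional K L] [Algebra.IsSeparable K L] :
    ∃ (F : R[X]) (β : L), F.Monic ∧ F.natDegree ≠ 0 ∧ (∀ P : R[X], aeval β P = 0 → F ∣ P) ∧
      ∀ x : L, ∃ b : R, b ≠ 0 ∧ ∃ P : R[X], aeval β P = algebraMap R L b * x := by
  obtain ⟨α, hα⟩ := Field.exists_primitive_element K L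
  have hint : IsIntegral K α := IsIntegral.of_finite K α
  have hmon := minpoly.monic hint
  have hlift := IsLocalization.scaleRoots_commonDenom_mem_lifts (nonZeroDivisors R)
    (minpoly K α) (by rw [hmon.leadingCoeff]; exact one_mem _)
  set b := IsLocalization.commonDenom (nonZeroDivisors R) (minpoly K α).support (minpoly K α).coeff
  have hb : algebraMap R K b ≠ 0 := by
    simp
  obtain ⟨F, hF, hFd, hFm⟩ := lifts_and_natDegree_eq_and_monic hlift
    ((monic_scaleRoots_iff _).2 hmon)
  set β := algebraMap K L (algebraMap R K b) * α
  have hβ : K⟮β⟯ = ⊤ := by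
    rw [eq_top_iff, ← hα, adjoin_simple_le_iff]
    have : α = (algebraMap R K b)⁻¹ • β := by
      simp only [β, ← Algebra.smul_def, smul_smul, inv_mul_cancel₀ hb, one_smul]
    rw [this]
    exact IntermediateField.smul_mem _ (mem_adjoin_simple_self K β)
  have hroot : aeval β (F.map (algebraMap R K)) = 0 := by
    rw [hF]; exact scaleRoots_aeval_eq_zero (minpoly.aeval K α)
  have hmin : minpoly K β = F.map (algebraMap R K) := by
    symm
    refine eq_of_monic_of_dvd_of_natDegree_le (minpoly.monic (IsIntegral.of_finite K β))
      (hFm.map _) (minpoly.dvd K β hroot) ?_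
    rw [hF, natDegree_scaleRoots, (Field.primitive_element_iff_minpoly_natDegree_eq K α).1 hα,
      (Field.primitive_element_iff_minpoly_natDegree_eq K β).1 hβ]
  refine ⟨F, β, hFm, ?_, fun P hP => ?_, fun x => ?_⟩
  · rw [hFd, natDegree_scaleRoots]
    exact (minpoly.natDegree_pos hint).ne'
  · rw [← map_dvd_map _ (IsFractionRing.injective R K) hFm, ← hmin]
    exact minpoly.dvd K β (by rwa [aeval_map_algebraMap])
  · have hx : x ∈ Algebra.adjoin K {β} := by
      rw [← IntermediateField.adjoin_simple_toSubalgebra_of_isAlgebraic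
        (IsIntegral.of_finite K β).isAlgebraic, hβ]
      trivial
    rw [Algebra.adjoin_singleton_eq_range_aeval] at hx
    obtain ⟨q, rfl⟩ := hx
    obtain ⟨c, hc, hq⟩ := IsLocalization.integerNormalization_spec (nonZeroDivisors R) q
    refine ⟨c, nonZeroDivisors.ne_zero hc,
      IsLocalization.integerNormalization (nonZeroDivisors R) q, ?_⟩
    rw [← aeval_map_algebraMap K, hq, ← IsScalarTower.algebraMap_smul K c q, map_smul,
      Algebra.smul_def, IsScalarTower.algebraMap_apply R K L]
    rfl

theorem isIntegralMod_of_isIntegral {R L : Type*} [CommRing R] [CommRing L] [Nontrivial R]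
    [Algebra R L] (F : R[X])
    (β : L) (hF : ∀ P : R[X], aeval β P = 0 → F ∣ P) (h : R) (x : L) (m : R[X]) (hm : m.Monic)
    (hmd : m.natDegree ≠ 0)
    (hx : aeval x m = 0) (G : R[X]) (hG : aeval β G = algebraMap R L h * x) :
    IsIntegralMod F h m.natDegree G := by
  refine ⟨m.natDegree, hmd, le_rfl, m.coeff, hF _ ?_⟩
  rw [aeval_eq_sum_range, Finset.sum_range_succ, hm.coeff_natDegree, one_smul] at hx
  have h1 := congrArg (algebraMap R L h ^ m.natDegree * ·) hx
  simp only [mul_zero, mul_add, Finset.mul_sum] at h1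
  rw [← h1]
  simp only [map_add, map_pow, map_sum, map_mul, aeval_C, hG]
  rw [add_comm]
  congr 1
  · refine Finset.sum_congr rfl fun k hk => ?_
    have : algebraMap R L h ^ m.natDegree =
        algebraMap R L h ^ (m.natDegree - k) * algebraMap R L h ^ k := by
      rw [← pow_add, Nat.sub_add_cancel (Finset.mem_range.1 hk).le]
    rw [this, Algebra.smul_def]
    ring
  · ring

theorem IsIntegralMod.mono {R : Type*} [CommRing R] {F : R[X]} {h : R} {d e : ℕ} {G : R[X]}
    (H : IsIntegralMod F h d G) (hde : d ≤ e) : IsIntegralMod F h e G := by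
  obtain ⟨d', h0, h1, c, hc⟩ := H
  exact ⟨d', h0, h1.trans hde, c, hc⟩

theorem exists_isIntegralMod (R S : Type*) {ι : Type*} [CommRing R] [IsDomain R] [CharZero R]
    [CommRing S] [IsDomain S] [Algebra R S] [Module.Finite R S]
    (hinj : Function.Injective (algebraMap R S)) [Fintype ι] (s : ι → S) :
    ∃ (F : R[X]) (h : R) (G : ι → R[X]) (d₀ : ℕ), F.Monic ∧ F.natDegree ≠ 0 ∧ h ≠ 0 ∧
      (∀ i, IsIntegralMod F h d₀ (G i)) ∧ ∀ (r : R) (c : ι → R),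
        algebraMap R S r = ∑ i, algebraMap R S (c i) * s i → F ∣ C (h * r) - ∑ i, C (c i) * G i := by
  classical
  have : FaithfulSMul R S := (faithfulSMul_iff_algebraMap_injective R S).2 hinj
  let _ : Algebra (FractionRing R) (FractionRing S) := FractionRing.liftAlgebra R _
  have : IsScalarTower R (FractionRing R) (FractionRing S) :=
    FractionRing.isScalarTower_liftAlgebra R _
  have : FiniteDimensional (FractionRing R) (FractionRing S) :=
    .of_isLocalization R S (nonZeroDivisors R)
  have : CharZero (FractionRing R) :=
    charZero_of_injective_algebraMap (IsFractionRing.injective R (FractionRing R))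
  obtain ⟨F, β, hFm, hFd, hF, hgen⟩ := exists_monic_generator R (FractionRing R) (FractionRing S)
  choose b hb P hP using fun i => hgen (algebraMap S (FractionRing S) (s i))
  have hint (i : ι) : IsIntegral R (s i) := Algebra.IsIntegral.isIntegral (s i)
  have hG (i : ι) : aeval β (C (∏ j ∈ Finset.univ.erase i, b j) * P i) =
      algebraMap R (FractionRing S) (∏ j, b j) * algebraMap S (FractionRing S) (s i) := by
    rw [map_mul, aeval_C, hP, ← Finset.mul_prod_erase _ b (Finset.mem_univ i), map_mul]
    ring
  refine ⟨F, ∏ i, b i, fun i => C (∏ j ∈ Finset.univ.erase i, b j) * P i,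
    ∑ i, (minpoly R (s i)).natDegree, hFm, hFd, Finset.prod_ne_zero_iff.2 fun i _ => hb i,
    fun i => ?_, fun r c hrc => hF _ ?_⟩
  · refine (isIntegralMod_of_isIntegral F β hF _ _ (minpoly R (s i)) (minpoly.monic (hint i))
      (minpoly.natDegree_pos (hint i)).ne' ?_ _ (hG i)).mono
      (Finset.single_le_sum (f := fun i => (minpoly R (s i)).natDegree)
        (fun _ _ => Nat.zero_le _) (Finset.mem_univ i))
    rw [aeval_algebraMap_apply, minpoly.aeval, map_zero]
  · have h1 := congrArg (algebraMap S (FractionRing S)) hrc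
    simp only [map_sum, map_mul, ← IsScalarTower.algebraMap_apply] at h1
    simp only [map_sub, map_sum, map_mul, aeval_C, h1] at hG ⊢
    rw [sub_eq_zero, Finset.mul_sum]
    refine Finset.sum_congr rfl fun i _ => ?_
    rw [hG]
    ring

end DirectSummand

namespace DirectSummand

/-- A linear system over a Noetherian local ring is solvable if it is solvable modulo all powers of
the maximal ideal. -/
theorem exists_solution_of_forall_pow {R M ι : Type*} [CommRing R] [IsNoetherianRing R]
    [IsLocalRing R] [AddCommGroup M] [Module R M] [Finite ι] (Φ : M →ₗ[R] (ι → R)) (t : ι → R)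
    (h : ∀ N : ℕ, ∃ v, ∀ i, Φ v i - t i ∈ IsLocalRing.maximalIdeal R ^ N) : ∃ v, Φ v = t := by
  classical
  cases nonempty_fintype ι
  have key : (LinearMap.range Φ).mkQ t = 0 := by
    rw [← Submodule.mem_bot R, ← Ideal.iInf_pow_smul_eq_bot_of_isLocalRing
      (M := (ι → R) ⧸ LinearMap.range Φ) _
      (IsLocalRing.maximalIdeal.isMaximal R).ne_top, Submodule.mem_iInf]
    intro N
    obtain ⟨v, hv⟩ := h N
    have h1 : t = Φ v - ∑ i, (Φ v i - t i) • Pi.single i (1 : R) := by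
      ext j
      simp [Finset.sum_apply, Pi.single_apply]
    have h2 : (LinearMap.range Φ).mkQ (Φ v) = 0 := by
      rw [Submodule.mkQ_apply, Submodule.Quotient.mk_eq_zero]
      exact ⟨v, rfl⟩
    rw [h1, map_sub, h2, zero_sub, map_sum]
    refine neg_mem (sum_mem fun i _ => ?_)
    rw [map_smul]
    exact Submodule.smul_mem_smul (hv i) trivial
  rw [Submodule.mkQ_apply, Submodule.Quotient.mk_eq_zero] at key
  exact key

theorem exists_linearMap_of_forall_pow {R S : Type*} [CommRing R] [IsNoetherianRing R]
    [IsLocalRing R] [AddCommGroup S] [Module R S] [Module.Finite R S] (x : S)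
    (h : ∀ N : ℕ, ∃ J ≤ IsLocalRing.maximalIdeal R ^ N, ∃ φ : S →ₗ[R] R ⧸ J, φ x = 1) :
    ∃ f : S →ₗ[R] R, f x = 1 := by
  obtain ⟨n, π, hπ⟩ := Module.Finite.exists_fin' R S
  obtain ⟨r, k, hk⟩ := Submodule.fg_iff_exists_fin_generating_family.1
    (IsNoetherian.noetherian (LinearMap.ker π))
  obtain ⟨e, he⟩ := hπ x
  let w : Option (Fin r) → (Fin n → R) := fun o => o.elim e k
  let t : Option (Fin r) → R := fun o => o.elim 1 0
  let Φ : ((Fin n → R) →ₗ[R] R) →ₗ[R] (Option (Fin r) → R) :=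
    LinearMap.pi fun o => LinearMap.applyₗ (w o)
  have hk' : ∀ j, π (k j) = 0 := fun j => by
    rw [← LinearMap.mem_ker, ← hk]
    exact Submodule.subset_span ⟨j, rfl⟩
  obtain ⟨v, hv⟩ := exists_solution_of_forall_pow Φ t fun N => by
    obtain ⟨J, hJ, φ, hφ⟩ := h N
    choose c hc using fun i => Ideal.Quotient.mk_surjective (φ (π (Pi.single i 1)))
    refine ⟨Fintype.linearCombination R c, ?_⟩
    have hc' : ∀ u, Ideal.Quotient.mk J (Fintype.linearCombination R c u) = φ (π u) := by
      intro u
      rw [Fintype.linearCombination_apply, map_sum]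
      conv_rhs => rw [pi_eq_sum_univ' u, map_sum, map_sum]
      refine Finset.sum_congr rfl fun i _ => ?_
      rw [smul_eq_mul, map_mul, π.map_smul, φ.map_smul, ← hc]
      rfl
    intro o
    apply hJ
    rw [← Ideal.Quotient.eq_zero_iff_mem, map_sub, sub_eq_zero]
    change Ideal.Quotient.mk J (Fintype.linearCombination R c (w o)) = _
    rw [hc']
    cases o with
    | none => simp [w, t, he, hφ]
    | some j => simp [w, t, hk']
  have hker : LinearMap.ker π ≤ LinearMap.ker v := by
    rw [← hk, Submodule.span_le]
    rintro _ ⟨j, rfl⟩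
    exact congrFun hv (some j)
  refine ⟨(LinearMap.ker π).liftQ v hker ∘ₗ (π.quotKerEquivOfSurjective hπ).symm, ?_⟩
  have : (π.quotKerEquivOfSurjective hπ).symm x = (LinearMap.ker π).mkQ e := by
    rw [LinearEquiv.symm_apply_eq, ← he]
    rfl
  rw [LinearMap.comp_apply, LinearEquiv.coe_coe, this, Submodule.mkQ_apply, Submodule.liftQ_apply]
  exact congrFun hv none

theorem baer_quotient_span {A : Type*} [CommRing A] [IsDomain A] [IsPrincipalIdealRing A] (q : A)
    (hq : q ≠ 0) : Module.Baer (A ⧸ Ideal.span {q}) (A ⧸ Ideal.span {q}) := by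
  intro I g
  let mk := Ideal.Quotient.mk (Ideal.span {q})
  obtain ⟨a, ha⟩ := (IsPrincipalIdealRing.principal (I.comap mk)).principal
  have ha' : mk a ∈ I := by
    rw [← Ideal.mem_comap, ha]; exact Submodule.mem_span_singleton_self a
  have hqa : q ∈ I.comap mk := by
    have : mk q = 0 := Ideal.Quotient.eq_zero_iff_mem.2 (Ideal.mem_span_singleton_self q)
    rw [Ideal.mem_comap, this]; exact zero_mem _
  rw [ha] at hqa
  obtain ⟨c, hc⟩ := Ideal.mem_span_singleton.1 hqa
  obtain ⟨y, hy⟩ := Ideal.Quotient.mk_surjective (g ⟨mk a, ha'⟩)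
  have h0 : mk c • (⟨mk a, ha'⟩ : I) = 0 := by
    ext1
    change mk c * mk a = 0
    rw [← map_mul, mul_comm c a, ← hc]
    exact Ideal.Quotient.eq_zero_iff_mem.2 (Ideal.mem_span_singleton_self _)
  have h1 : mk (c * y) = 0 := by
    have := congrArg g h0
    rwa [map_smul, map_zero, ← hy, smul_eq_mul, ← map_mul] at this
  obtain ⟨z, hz⟩ := Ideal.mem_span_singleton.1 (Ideal.Quotient.eq_zero_iff_mem.1 h1)
  have hyz : y = a * z := mul_left_cancel₀ (right_ne_zero_of_mul (hc ▸ hq)) (by rw [hz, hc]; ring)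
  refine ⟨LinearMap.mulRight _ (mk z), fun x hx => ?_⟩
  obtain ⟨x, rfl⟩ := Ideal.Quotient.mk_surjective x
  have hxa : x ∈ I.comap mk := hx
  rw [ha] at hxa
  obtain ⟨b, rfl⟩ := Ideal.mem_span_singleton.1 hxa
  have h2 : (⟨_, hx⟩ : I) = mk b • ⟨mk a, ha'⟩ := by
    ext1
    change mk (a * b) = mk b * mk a
    rw [← map_mul, mul_comm b a]
  rw [h2, map_smul, ← hy, hyz]
  change mk (a * b) * mk z = mk b * mk (a * z)
  simp only [map_mul]
  ring

/-- Extending a functional from a free cyclic submodule. -/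
theorem exists_addMonoidHom_quotient {A S : Type*} [CommRing A] [IsDomain A]
    [IsPrincipalIdealRing A] [CommRing S] (j : A →+* S) (J : Ideal S) (q : A) (hq : q ≠ 0)
    (hqJ : j q ∈ J) (x : S) (hx : ∀ a, j a * x ∈ J → q ∣ a) :
    ∃ ψ : S →+ A ⧸ Ideal.span {q},
      (∀ a s, ψ (j a * s) = Ideal.Quotient.mk (Ideal.span {q}) a * ψ s) ∧
        (∀ s ∈ J, ψ s = 0) ∧ ψ x = 1 := by
  let θ : A ⧸ Ideal.span {q} →+* S ⧸ J :=
    Ideal.Quotient.lift (Ideal.span {q}) ((Ideal.Quotient.mk J).comp j) fun a ha => by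
      obtain ⟨b, rfl⟩ := Ideal.mem_span_singleton.1 ha
      rw [RingHom.comp_apply, Ideal.Quotient.eq_zero_iff_mem, map_mul]
      exact Ideal.mul_mem_right _ _ hqJ
  let _ : Module (A ⧸ Ideal.span {q}) (S ⧸ J) := Module.compHom (S ⧸ J) θ
  have hsmul (b : A ⧸ Ideal.span {q}) (m : S ⧸ J) : b • m = θ b * m := rfl
  obtain ⟨ψ, hψ⟩ := (baer_quotient_span q hq).extension_property
    (LinearMap.toSpanSingleton (A ⧸ Ideal.span {q}) (S ⧸ J) (Ideal.Quotient.mk J x))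
    ((injective_iff_map_eq_zero _).2 fun b hb => by
      obtain ⟨a, rfl⟩ := Ideal.Quotient.mk_surjective b
      rw [Ideal.Quotient.eq_zero_iff_mem, Ideal.mem_span_singleton]
      apply hx
      rw [LinearMap.toSpanSingleton_apply, hsmul] at hb
      rw [← Ideal.Quotient.eq_zero_iff_mem, map_mul]
      exact hb) LinearMap.id
  refine ⟨ψ.toAddMonoidHom.comp (Ideal.Quotient.mk J).toAddMonoidHom, fun a s => ?_, fun s hs => ?_,
    ?_⟩
  · change ψ (Ideal.Quotient.mk J (j a * s)) = _ * ψ (Ideal.Quotient.mk J s)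
    have := ψ.map_smul (Ideal.Quotient.mk _ a) (Ideal.Quotient.mk J s)
    rw [hsmul] at this
    rw [map_mul]
    exact this
  · change ψ (Ideal.Quotient.mk J s) = 0
    rw [Ideal.Quotient.eq_zero_iff_mem.2 hs, map_zero]
  · have := LinearMap.congr_fun hψ 1
    rw [LinearMap.comp_apply, LinearMap.toSpanSingleton_apply, one_smul] at this
    exact this

end DirectSummand

namespace DirectSummand
open MvPowerSeries

theorem mvPowerSeries_mem_sup_of_dvd_coeff {σ A : Type*} [Finite σ] [CommRing A] (q : A) (M : ℕ)
    (f : MvPowerSeries σ A) (h : ∀ e : σ →₀ ℕ, (∀ i, e i < M) → q ∣ coeff e f) :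
    f ∈ Ideal.span {C q} ⊔ Ideal.span (Set.range fun i => (X i : MvPowerSeries σ A) ^ M) := by
  classical
  cases nonempty_fintype σ
  choose! c hc using h
  obtain ⟨g, hg⟩ := exists_mvPowerSeries_coeff c
  have h1 : f = g * C q + (f - C q * g) := by ring
  rw [h1]
  refine Submodule.add_mem_sup (Ideal.mem_span_singleton'.2 ⟨g, rfl⟩) ?_
  rw [← Set.image_univ, ← Finset.coe_univ, mvPowerSeries_mem_span_iff]
  intro e he
  rw [map_sub, coeff_C_mul, hg, hc e fun i => he i (Finset.mem_univ i), sub_self]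

theorem monomial_mul_sub_sum_mem {σ A : Type*} [Finite σ] [DecidableEq σ] [CommRing A]
    (ν e : σ →₀ ℕ) (M : ℕ) (he : e ≤ ν) (hM : ∀ i, M = ν i + 1)
    (r : MvPowerSeries σ A) :
    monomial (ν - e) 1 * r - ∑ x ∈ Finset.HasAntidiagonal.antidiagonal e, C (coeff x.1 r) * monomial (ν - x.2) 1 ∈
      Ideal.span (Set.range fun i => (X i : MvPowerSeries σ A) ^ M) := by
  cases nonempty_fintype σ
  rw [← Set.image_univ, ← Finset.coe_univ, mvPowerSeries_mem_span_iff]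
  intro d hd
  have hdν : d ≤ ν := fun i => by have := hd i (Finset.mem_univ i); have := hM i; omega
  rw [map_sub, coeff_monomial_mul, map_sum, sub_eq_zero, one_mul]
  simp only [coeff_C_mul, coeff_monomial, mul_ite, mul_one, mul_zero]
  split_ifs with h
  · rw [Finset.sum_eq_single (d - (ν - e), ν - d)]
    · rw [if_pos]
      ext i
      have := hdν i
      simp only [Finsupp.tsub_apply]; omega
    · rintro ⟨a, b⟩ hab hne
      rw [Finset.HasAntidiagonal.mem_antidiagonal] at hab
      rw [if_neg]
      rintro rfl
      apply hne
      ext i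
      · have h1 := he i
        have h2 := DFunLike.congr_fun hab i
        simp only [Finsupp.tsub_apply, Finsupp.add_apply] at h2 ⊢; omega
      · have h1 := he i
        have h2 := DFunLike.congr_fun hab i
        simp only [Finsupp.tsub_apply, Finsupp.add_apply] at h2 ⊢; omega
    · intro hab
      refine absurd ?_ hab
      rw [Finset.HasAntidiagonal.mem_antidiagonal]
      ext i
      have h1 := he i
      have h2 := hdν i
      have h3 := h i
      simp only [Finsupp.tsub_apply, Finsupp.add_apply] at h3 ⊢; omega
  · symm
    refine Finset.sum_eq_zero ?_
    rintro ⟨a, b⟩ hab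
    rw [Finset.HasAntidiagonal.mem_antidiagonal] at hab
    rw [if_neg]
    rintro rfl
    refine h fun i => ?_
    have h2 := DFunLike.congr_fun hab i
    simp only [Finsupp.tsub_apply, Finsupp.add_apply] at h2 ⊢; omega

/-- A functional on `S` that does not kill the top monomial produces a retraction modulo
`(q, X₁ ^ (N + 1), …)`. -/
theorem exists_linearMap_quotient {σ A S : Type*} [Finite σ] [CommRing A] [IsLocalRing A]
    [CommRing S] [Algebra (MvPowerSeries σ A) S] (q : A) (hq : q ∈ IsLocalRing.maximalIdeal A)
    (N : ℕ) (ν : σ →₀ ℕ) (hν : ∀ i, ν i = N) (J : Ideal (MvPowerSeries σ A))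
    (hJ : J = Ideal.span {C q} ⊔ Ideal.span (Set.range fun i => (X i) ^ (N + 1)))
    (ψ : S →+ A ⧸ Ideal.span {q})
    (hψ : ∀ a s, ψ (algebraMap (MvPowerSeries σ A) S (C a) * s) =
      Ideal.Quotient.mk (Ideal.span {q}) a * ψ s)
    (hψJ : ∀ s ∈ J.map (algebraMap (MvPowerSeries σ A) S), ψ s = 0)
    (hψ1 : ψ (algebraMap (MvPowerSeries σ A) S (monomial ν 1)) = 1) :
    ∃ φ : S →ₗ[MvPowerSeries σ A] MvPowerSeries σ A ⧸ J, φ 1 = 1 := by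
  classical
  let mk := Ideal.Quotient.mk (Ideal.span {q})
  choose l hl using Ideal.Quotient.mk_surjective (I := Ideal.span {q})
  let m : (σ →₀ ℕ) → S := fun e => algebraMap (MvPowerSeries σ A) S (monomial (ν - e) 1)
  choose f hf using fun s : S => exists_mvPowerSeries_coeff fun e => l (ψ (m e * s))
  have hmem : ∀ g : MvPowerSeries σ A, (∀ e ≤ ν, mk (coeff e g) = 0) → g ∈ J := by
    intro g hg
    rw [hJ]
    refine mvPowerSeries_mem_sup_of_dvd_coeff q (N + 1) g fun e he => ?_
    have := hg e fun i => by have := hν i; have := he i; omega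
    rwa [Ideal.Quotient.eq_zero_iff_mem, Ideal.mem_span_singleton] at this
  let φ : S →ₗ[MvPowerSeries σ A] MvPowerSeries σ A ⧸ J :=
    { toFun := fun s => Ideal.Quotient.mk J (f s)
      map_add' := fun s t => by
        rw [← map_add, ← sub_eq_zero, ← map_sub, Ideal.Quotient.eq_zero_iff_mem]
        refine hmem _ fun e _ => ?_
        simp only [mk, map_sub, map_add, hf, hl, mul_add, sub_self]
      map_smul' := fun r s => by
        rw [RingHom.id_apply, Algebra.smul_def r (Ideal.Quotient.mk J (f s)),
          Ideal.Quotient.algebraMap_eq, ← map_mul, ← sub_eq_zero, ← map_sub,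
          Ideal.Quotient.eq_zero_iff_mem]
        refine hmem _ fun e he => ?_
        have h1 := monomial_mul_sub_sum_mem ν e (N + 1) he
          (fun i => by rw [hν]) r
        have h2 := hψJ _ (Ideal.mul_mem_right s _ (Ideal.mem_map_of_mem
          (algebraMap (MvPowerSeries σ A) S) ((hJ ▸ le_sup_right : _ ≤ J) h1)))
        simp only [map_sub, sub_mul, map_sum, Finset.sum_mul, map_mul, mul_assoc, hψ] at h2
        simp only [mk, map_sub, hf, hl, coeff_mul, map_sum, map_mul, Algebra.smul_def, m]
        exact h2 }
  have h1 : mk (constantCoeff (f 1)) = 1 := by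
    rw [← coeff_zero_eq_constantCoeff_apply, hf]
    simp only [mk, hl, m, mul_one, tsub_zero, hψ1]
  have h2 : IsUnit (f 1) := by
    rw [MvPowerSeries.isUnit_iff_constantCoeff]
    rw [← map_one mk, Ideal.Quotient.eq, Ideal.mem_span_singleton] at h1
    obtain ⟨z, hz⟩ := h1
    by_contra hu
    have h3 := (IsLocalRing.maximalIdeal A).sub_mem ((IsLocalRing.mem_maximalIdeal _).2 hu)
      (Ideal.mul_mem_right z _ hq)
    rw [← hz, sub_sub_cancel] at h3
    exact (IsLocalRing.mem_maximalIdeal _).1 h3 isUnit_one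
  obtain ⟨u, hu⟩ := h2
  refine ⟨(↑u⁻¹ : MvPowerSeries σ A) • φ, ?_⟩
  rw [LinearMap.smul_apply]
  change (↑u⁻¹ : MvPowerSeries σ A) • Ideal.Quotient.mk J (f 1) = 1
  rw [← hu]
  change Ideal.Quotient.mk J ((↑u⁻¹ : MvPowerSeries σ A) * u) = 1
  rw [Units.inv_mul, map_one]

end DirectSummand

namespace DirectSummand
open MvPowerSeries

theorem natCast_mem_maximalIdeal (p : ℕ) [Fact p.Prime] (k : Type*) [Field k] [CharP k p]
    [PerfectRing k p] :
    (p : WittVector p k) ∈ IsLocalRing.maximalIdeal _ :=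
  (IsLocalRing.mem_maximalIdeal _).2 (WittVector.irreducible p).not_isUnit

theorem charZero_wittVector (p : ℕ) [Fact p.Prime] (k : Type*) [Field k] [CharP k p] :
    CharZero (WittVector p k) := by
  obtain ⟨q, hq⟩ := CharP.exists (WittVector p k)
  rcases CharP.char_is_prime_or_zero (WittVector p k) q with hq' | rfl
  · have h1 : ((q : ℕ) : k) = 0 := by
      rw [← map_natCast (WittVector.constantCoeff (p := p) (R := k)), CharP.cast_eq_zero, map_zero]
    rw [CharP.cast_eq_zero_iff k p, Nat.prime_dvd_prime_iff_eq Fact.out hq'] at h1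
    subst h1
    exact absurd (CharP.cast_eq_zero (WittVector p k) p) (WittVector.p_nonzero p k)
  · exact CharP.charP_to_charZero _

/-- The ideal generated by `p ^ (N + 1)` and the `Tᵢ ^ (N + 1)`. -/
noncomputable def paramIdeal (p : ℕ) [Fact p.Prime] (k : Type*) [Field k] (σ : Type*) (N : ℕ) :
    Ideal (MvPowerSeries σ (WittVector p k)) :=
  Ideal.span {C ((p : WittVector p k) ^ (N + 1))} ⊔ Ideal.span (Set.range fun i => X i ^ (N + 1))

theorem paramIdeal_le (p : ℕ) [Fact p.Prime] (k : Type*) [Field k] [CharP k p] [PerfectRing k p]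
    (σ : Type*) (N : ℕ) :
    paramIdeal p k σ N ≤ IsLocalRing.maximalIdeal (MvPowerSeries σ (WittVector p k)) ^ N := by
  have hp := natCast_mem_maximalIdeal p k
  refine sup_le ?_ ?_ <;> rw [Ideal.span_le]
  · rintro _ rfl
    refine Ideal.pow_le_pow_right N.le_succ ?_
    rw [map_pow]
    refine Ideal.pow_mem_pow ?_ _
    rw [IsLocalRing.mem_maximalIdeal, mem_nonunits_iff, isUnit_iff_constantCoeff, constantCoeff_C]
    exact (IsLocalRing.mem_maximalIdeal _).1 hp
  · rintro _ ⟨i, rfl⟩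
    refine Ideal.pow_le_pow_right N.le_succ (Ideal.pow_mem_pow ?_ _)
    rw [IsLocalRing.mem_maximalIdeal, mem_nonunits_iff, isUnit_iff_constantCoeff, constantCoeff_X]
    exact not_isUnit_zero

/-- If no power of `p ∏ Tᵢ` satisfies a monomial relation in `S`, then `S` retracts onto `R`. -/
theorem exists_linearMap_of_forall_notMem (p : ℕ) [Fact p.Prime] (k : Type*) [Field k] [CharP k p] [PerfectRing k p]
    {σ S : Type*} [Fintype σ] [CommRing S]
    [Algebra (MvPowerSeries σ (WittVector p k)) S]
    [Module.Finite (MvPowerSeries σ (WittVector p k)) S]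
    (h : ∀ N, algebraMap (MvPowerSeries σ (WittVector p k)) S
      (p ^ N * (∏ i : σ, (X i : MvPowerSeries σ (WittVector p k))) ^ N) ∉
      (paramIdeal p k σ N).map (algebraMap _ S)) :
    ∃ f : S →ₗ[MvPowerSeries σ (WittVector p k)] MvPowerSeries σ (WittVector p k), f 1 = 1 := by
  classical
  refine exists_linearMap_of_forall_pow (1 : S) fun N =>
    ⟨paramIdeal p k σ N, paramIdeal_le p k σ N, ?_⟩
  have hp0 : (p : WittVector p k) ≠ 0 := WittVector.p_nonzero p k
  let ν : σ →₀ ℕ := Finsupp.equivFunOnFinite.symm fun _ => N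
  have hX : ((∏ i, X i : MvPowerSeries σ (WittVector p k))) ^ N = monomial ν 1 := by
    rw [← Finset.prod_pow]
    simp_rw [X_pow_eq]
    rw [MvPowerSeries.prod_monomial]
    simp only [Finset.prod_const_one]
    congr 1
    congr 1
    ext i
    simp [ν, Finsupp.single_apply]
  obtain ⟨ψ, hψ, hψJ, hψ1⟩ := exists_addMonoidHom_quotient
    ((algebraMap (MvPowerSeries σ (WittVector p k)) S).comp C)
    ((paramIdeal p k σ N).map (algebraMap _ S)) ((p : WittVector p k) ^ (N + 1))
    (pow_ne_zero _ hp0)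
    (Ideal.mem_map_of_mem _ ((le_sup_left : _ ≤ paramIdeal p k σ N)
      (Ideal.mem_span_singleton_self _)))
    (algebraMap (MvPowerSeries σ (WittVector p k)) S (monomial ν 1)) fun a ha => by
      rcases eq_or_ne a 0 with rfl | ha0
      · exact dvd_zero _
      obtain ⟨m, u, rfl⟩ := WittVector.exists_eq_pow_p_mul' a ha0
      rcases le_or_gt m N with hm | hm
      · refine absurd ?_ (h N)
        obtain ⟨l, rfl⟩ := Nat.exists_eq_add_of_le hm
        have h1 := Ideal.mul_mem_left _
          (algebraMap (MvPowerSeries σ (WittVector p k)) S (C (↑u⁻¹ * (p : WittVector p k) ^ l))) ha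
        rw [← hX, RingHom.comp_apply, ← mul_assoc, ← map_mul, ← map_mul, ← map_mul] at h1
        have h2 : (↑u⁻¹ * (p : WittVector p k) ^ l * (p ^ m * u)) = p ^ (m + l) := by
          rw [pow_add]
          calc _ = (↑u⁻¹ * ↑u) * ((p : WittVector p k) ^ m * p ^ l) := by ring
            _ = _ := by rw [Units.inv_mul, one_mul]
        rwa [h2, map_pow, map_natCast] at h1
      · exact (pow_dvd_pow _ hm).mul_right _
  exact exists_linearMap_quotient ((p : WittVector p k) ^ (N + 1))
    (Ideal.pow_mem_of_mem _ (natCast_mem_maximalIdeal p k) _ N.succ_pos) N ν (fun _ => rfl) _ rfl ψ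
    hψ hψJ hψ1

theorem notMem_map_paramIdeal (p : ℕ) [Fact p.Prime] (k : Type*) [Field k] [CharP k p] [PerfectRing k p]
    {n : ℕ} {S : Type*} [CommRing S]
    [Algebra (MvPowerSeries (Fin n) (WittVector p k)) S]
    [Module.Finite (MvPowerSeries (Fin n) (WittVector p k)) S]
    (hinj : Function.Injective (algebraMap (MvPowerSeries (Fin n) (WittVector p k)) S)) (N : ℕ) :
    algebraMap (MvPowerSeries (Fin n) (WittVector p k)) S
      (p ^ N * (∏ i : Fin n, (X i : MvPowerSeries (Fin n) (WittVector p k))) ^ N) ∉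
      (paramIdeal p k (Fin n) N).map (algebraMap _ S) := by
  intro hmem
  rw [paramIdeal, Ideal.map_sup, Ideal.map_span, Ideal.map_span, Set.image_singleton,
    ← Set.range_comp, Submodule.mem_sup] at hmem
  obtain ⟨_, hy, _, hz, hyz⟩ := hmem
  obtain ⟨s₀, rfl⟩ := Ideal.mem_span_singleton'.1 hy
  obtain ⟨s, rfl⟩ := (mem_span_range_iff_sum _ _).1 hz
  have := charZero_wittVector p k
  have : CharZero (MvPowerSeries (Fin n) (WittVector p k)) :=
    charZero_of_injective_ringHom (f := C) (MvPowerSeries.C_injective)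
  have : IsDomain (MvPowerSeries (Fin n) (WittVector p k)) := NoZeroDivisors.to_isDomain _
  obtain ⟨Q, -, hQ, hQ0⟩ := Ideal.exists_ideal_over_prime_of_isIntegral
    (⊥ : Ideal (MvPowerSeries (Fin n) (WittVector p k))) (⊥ : Ideal S)
    ((RingHom.injective_iff_ker_eq_bot _).1 hinj).le
  have hinj' : Function.Injective
      (algebraMap (MvPowerSeries (Fin n) (WittVector p k)) (S ⧸ Q)) := by
    rw [RingHom.injective_iff_ker_eq_bot, ← hQ0]
    ext r
    rw [RingHom.mem_ker, Ideal.mem_comap, IsScalarTower.algebraMap_apply _ S (S ⧸ Q),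
      Ideal.Quotient.algebraMap_eq, Ideal.Quotient.eq_zero_iff_mem]
  let mk := Ideal.Quotient.mk Q
  obtain ⟨F, h, G, d₀, hF, hFd, hh, hG, hrel⟩ := exists_isIntegralMod
    (MvPowerSeries (Fin n) (WittVector p k)) (S ⧸ Q) hinj'
    (fun o : Option (Fin n) => o.elim (mk s₀) fun i => mk (s i))
  have hdvd := hrel
    (p ^ N * (∏ i : Fin n, (X i : MvPowerSeries (Fin n) (WittVector p k))) ^ N)
    (fun o => o.elim ((p : MvPowerSeries (Fin n) (WittVector p k)) ^ (N + 1))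
      fun i => X i ^ (N + 1)) (by
    have h1 := congrArg mk hyz
    rw [Fintype.sum_option, IsScalarTower.algebraMap_apply _ S (S ⧸ Q),
      Ideal.Quotient.algebraMap_eq]
    refine h1.symm.trans ?_
    simp only [map_add, map_sum, map_mul, Option.elim, Function.comp_apply]
    congr 1
    · rw [mul_comm, map_pow C, map_natCast C, IsScalarTower.algebraMap_apply _ S (S ⧸ Q),
        Ideal.Quotient.algebraMap_eq]
    · refine Finset.sum_congr rfl fun i _ => ?_
      rw [mul_comm, IsScalarTower.algebraMap_apply _ S (S ⧸ Q), Ideal.Quotient.algebraMap_eq])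
  rw [Fintype.sum_option] at hdvd
  obtain ⟨f₀, hf₀⟩ := exists_ringHom_wittVector_mvPowerSeries (p := p) (k := k)
    (σ := Fin n)
  obtain ⟨a, g, hg, hag⟩ := WfDvdMonoid.max_power_factor' hh
    (x := (p : MvPowerSeries (Fin n) (WittVector p k))) fun hu => by
      have h1 := hu.map (psReduction p k (Fin n))
      rw [(psReduction_eq_zero_iff _).2 dvd_rfl] at h1
      exact not_isUnit_zero h1
  refine not_exists_relation f₀ X (fun i => ?_) F hF hFd a g h hag ?_ N d₀ (G none)
    (fun i => G (some i)) (hG none) (fun i => hG (some i)) ?_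
  · rw [hf₀, psReduction, MvPowerSeries.map_X]
  · rw [hf₀, Ne, psReduction_eq_zero_iff]
    exact hg
  · rw [← mul_assoc] at hdvd
    exact hdvd

end DirectSummand

/-- **The direct summand conjecture for unramified complete regular local rings**
(Theorem 0.2 of the paper). Let `p` be a prime, `k` a perfect field of characteristic
`p`, and `R = W(k)[[T₁, …, Tₙ]]` the ring of formal power series in `n` variables over
the ring of `p`-typical Witt vectors of `k`. Then every commutative `R`-algebra `S`
which is finite as an `R`-module and has injective structure map `R → S` admits an
`R`-linear retraction `S → R`. -/
theorem direct_summand_conjecture_wittVector_mvPowerSeries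
    (p : ℕ) [Fact p.Prime] (k : Type*) [Field k] [CharP k p] [PerfectRing k p] (n : ℕ)
    (S : Type*) [CommRing S]
    [Algebra (MvPowerSeries (Fin n) (WittVector p k)) S]
    [Module.Finite (MvPowerSeries (Fin n) (WittVector p k)) S]
    (hinj : Function.Injective
      (algebraMap (MvPowerSeries (Fin n) (WittVector p k)) S)) :
    ∃ f : S →ₗ[MvPowerSeries (Fin n) (WittVector p k)] MvPowerSeries (Fin n) (WittVector p k),
      ∀ r, f (algebraMap (MvPowerSeries (Fin n) (WittVector p k)) S r) = r := by
  obtain ⟨f, hf⟩ := DirectSummand.exists_linearMap_of_forall_notMem p k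
    (DirectSummand.notMem_map_paramIdeal p k hinj)
  refine ⟨f, fun r => ?_⟩
  rw [Algebra.algebraMap_eq_smul_one, map_smul, hf, smul_eq_mul, mul_one]
end

section
/- Let R be a commutative Noetherian ring, I an ideal of R, and S a flat R-algebra (not necessarily Noetherian). Then the I-adic (separated) completion Ŝ = lim_n S/IⁿS of S is flat as an R-module. -/
open TensorProduct

namespace AdicCompletion

section Map

variable {R : Type*} [CommRing R] (I : Ideal R)
  {M N P : Type*} [AddCommGroup M] [Module R M] [AddCommGroup N] [Module R N]
  [AddCommGroup P] [Module R P]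

theorem map_add_linearMap (f g : M →ₗ[R] N) (x : AdicCompletion I M) :
    map I (f + g) x = map I f x + map I g x := by
  induction x using AdicCompletion.induction_on with
  | _ a => ext n; simp

theorem map_smul_linearMap (r : R) (f : M →ₗ[R] N) (x : AdicCompletion I M) :
    map I (r • f) x = r • map I f x := by
  induction x using AdicCompletion.induction_on with
  | _ a => ext n; simp [val_smul_apply, -map_smul]

theorem map_sum_linearMap {ι : Type*} (s : Finset ι) (f : ι → M →ₗ[R] N)
    (x : AdicCompletion I M) :
    map I (∑ i ∈ s, f i) x = ∑ i ∈ s, map I (f i) x := by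
  classical
  induction s using Finset.induction_on with
  | empty => simp
  | insert i s hi ih => rw [Finset.sum_insert hi, Finset.sum_insert hi, map_add_linearMap, ih]

/-- Adic completion is exact at the middle of an exact sequence `M → N → P` whose maps both
satisfy the conclusion of the Artin-Rees lemma. -/
theorem map_exact_of_artinRees {f : M →ₗ[R] N} {g : N →ₗ[R] P} (hfg : Function.Exact f g)
    (hf : ∃ k, ∀ n x, f x ∈ (I ^ (n + k) • ⊤ : Submodule R N) →
      ∃ y ∈ (I ^ n • ⊤ : Submodule R M), f y = f x)
    (hg : ∃ k, ∀ n x, g x ∈ (I ^ (n + k) • ⊤ : Submodule R P) →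
      ∃ y ∈ (I ^ n • ⊤ : Submodule R N), g y = g x) :
    Function.Exact (map I f) (map I g) := by
  refine LinearMap.exact_of_comp_eq_zero_of_ker_le_range ?_ fun z ↦ ?_
  · rw [map_comp, hfg.linearMap_comp_eq_zero, AdicCompletion.map_zero]
  induction z using AdicCompletion.induction_on with | _ b
  intro hz
  have hb (n : ℕ) : g (b n) ∈ (I ^ n • ⊤ : Submodule R P) := by
    simpa using congrArg (fun x ↦ x.val n) hz
  obtain ⟨k, hk⟩ := hf
  obtain ⟨l, hl⟩ := hg
  have approx (n : ℕ) : ∃ y, f y - b (n + l) ∈ (I ^ n • ⊤ : Submodule R N) := by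
    obtain ⟨d, hd, hgd⟩ := hl n (b (n + l)) (hb _)
    obtain ⟨y, hy⟩ := (hfg (b (n + l) - d)).mp (by simp [hgd])
    exact ⟨y, by simpa [hy] using hd⟩
  choose y hy using approx
  have step (n : ℕ) : ∃ e ∈ (I ^ n • ⊤ : Submodule R M),
      f e = f (y (n + 1 + k) - y (n + k)) := by
    apply hk
    have h₁ := (Submodule.smul_mono_left (N := (⊤ : Submodule R N))
      (Ideal.pow_le_pow_right (show n + k ≤ n + 1 + k by lia))) (hy (n + 1 + k))
    have h₂ := hy (n + k)
    have h₃ : b (n + 1 + k + l) - b (n + k + l) ∈ (I ^ (n + k) • ⊤ : Submodule R N) := by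
      rw [← Submodule.Quotient.eq, b.mk_eq_mk (show n + k ≤ n + 1 + k + l by lia),
        b.mk_eq_mk (show n + k ≤ n + k + l by lia)]
    convert Submodule.add_mem _ (Submodule.sub_mem _ h₁ h₂) h₃ using 1
    rw [map_sub]
    abel
  choose e he hfe using step
  have hsum (n : ℕ) : f (y k + ∑ i ∈ Finset.range n, e i) = f (y (n + k)) := by
    induction n with
    | zero => simp
    | succ n ih => rw [Finset.sum_range_succ, ← add_assoc, map_add, ih, hfe, map_sub]; abel
  refine ⟨AdicCompletion.mk I M (AdicCauchySequence.mk I M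
    (fun n ↦ y k + ∑ i ∈ Finset.range n, e i) fun n ↦ ?_), ?_⟩
  · rw [SModEq.comm, SModEq.sub_mem, Finset.sum_range_succ]
    convert he n using 1
    abel
  · ext n
    suffices h : Submodule.Quotient.mk (p := (I ^ n • ⊤ : Submodule R N))
        (f (y k + ∑ i ∈ Finset.range n, e i)) = Submodule.Quotient.mk (b (n + k + l)) by
      rw [b.mk_eq_mk (show n ≤ n + k + l by lia)] at h
      simpa using h
    rw [hsum, Submodule.Quotient.eq]
    exact Submodule.smul_mono_left (Ideal.pow_le_pow_right (by lia)) (hy (n + k))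

end Map

section Flat

variable {R : Type*} [CommRing R] [IsNoetherianRing R] (I : Ideal R)
  (F : Type*) [AddCommGroup F] [Module R F] [Module.Flat R F]
  {A B C : Type*} [AddCommGroup A] [Module R A] [AddCommGroup B] [Module R B]
  [AddCommGroup C] [Module R C]

/-- The Artin-Rees lemma for the base change to a flat module of a linear map into a finite
module over a Noetherian ring. -/
theorem exists_lTensor_artinRees [Module.Finite R B] (φ : A →ₗ[R] B) :
    ∃ k, ∀ n x, φ.lTensor F x ∈ (I ^ (n + k) • ⊤ : Submodule R (F ⊗[R] B)) →
      ∃ y ∈ (I ^ n • ⊤ : Submodule R (F ⊗[R] A)), φ.lTensor F y = φ.lTensor F x := by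
  obtain ⟨k, hk⟩ := I.exists_pow_inf_eq_pow_smul (LinearMap.range φ)
  refine ⟨k, fun n x hx ↦ ?_⟩
  let q := (I ^ (n + k) • ⊤ : Submodule R B).mkQ
  have hq : (I ^ (n + k) • ⊤ : Submodule R (F ⊗[R] B)) ≤ LinearMap.ker (q.lTensor F) := by
    refine Submodule.smul_le.mpr fun r hr t _ ↦ ?_
    have hrq : r • q = 0 := by
      ext b
      simpa [q, ← Submodule.Quotient.mk_smul] using Submodule.smul_mem_smul hr Submodule.mem_top
    rw [LinearMap.mem_ker, map_smul, ← LinearMap.smul_apply, ← LinearMap.lTensor_smul, hrq]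
    simp
  have hqx : (q ∘ₗ φ).lTensor F x = 0 := by
    rw [LinearMap.lTensor_comp]
    exact hq hx
  obtain ⟨w, rfl⟩ := (Module.Flat.lTensor_exact F (q ∘ₗ φ).exact_subtype_ker_map x).mp hqx
  suffices h : ∀ w, φ.lTensor F ((LinearMap.ker (q ∘ₗ φ)).subtype.lTensor F w) ∈
      Submodule.map (φ.lTensor F) (I ^ n • ⊤) from h w
  intro w
  induction w with
  | zero => simp
  | add w₁ w₂ h₁ h₂ => simpa only [map_add] using Submodule.add_mem _ h₁ h₂
  | tmul u c =>
    have hc : φ c ∈ (I ^ (n + k) • ⊤ : Submodule R B) ⊓ LinearMap.range φ :=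
      ⟨(Submodule.Quotient.mk_eq_zero _).mp (LinearMap.mem_ker.mp c.2), LinearMap.mem_range_self φ c⟩
    rw [hk _ (by lia), Nat.add_sub_cancel] at hc
    have hc' := Submodule.smul_mono le_rfl inf_le_right hc
    rw [← Submodule.map_top, ← Submodule.map_smul''] at hc'
    obtain ⟨a, ha, hac⟩ := hc'
    refine ⟨u ⊗ₜ a, ?_, by simp [hac]⟩
    have hu := Submodule.mem_map_of_mem (f := TensorProduct.mk R F A u) ha
    rw [Submodule.map_smul''] at hu
    exact Submodule.smul_mono le_rfl le_top hu

/-- Over a Noetherian ring, tensoring finite modules with a flat module and then completing is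
exact. -/
theorem map_lTensor_exact [Module.Finite R B] [Module.Finite R C] {φ : A →ₗ[R] B}
    {ψ : B →ₗ[R] C} (h : Function.Exact φ ψ) :
    Function.Exact (map I (φ.lTensor F)) (map I (ψ.lTensor F)) :=
  map_exact_of_artinRees I (Module.Flat.lTensor_exact F h)
    (exists_lTensor_artinRees I F φ) (exists_lTensor_artinRees I F ψ)

/-- Over a Noetherian ring, the adic completion of a flat module is flat. -/
theorem flat_of_flat : Module.Flat R (AdicCompletion I F) := by
  classical
  refine Module.Flat.of_forall_isTrivialRelation fun {l f x} hfx ↦ ?_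
  let ψ : (Fin l → R) →ₗ[R] R := Fintype.linearCombination R f
  obtain ⟨m, p, hp⟩ := Module.Finite.exists_fin' R (LinearMap.ker ψ)
  let φ : (Fin m → R) →ₗ[R] (Fin l → R) := (LinearMap.ker ψ).subtype ∘ₗ p
  have hφψ : Function.Exact φ ψ := by
    rw [LinearMap.exact_iff, LinearMap.range_comp_of_range_eq_top _ (LinearMap.range_eq_top.mpr hp),
      Submodule.range_subtype]
  let incl (i : Fin l) : F →ₗ[R] F ⊗[R] (Fin l → R) := (TensorProduct.mk R F _).flip (Pi.single i 1)
  let coord (n : ℕ) (j : Fin n) : F ⊗[R] (Fin n → R) →ₗ[R] F :=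
    TensorProduct.rid R F ∘ₗ (LinearMap.proj j).lTensor F
  let X := ∑ i, map I (incl i) (x i)
  have hψincl (i : Fin l) : ψ.lTensor F ∘ₗ incl i = f i • (TensorProduct.mk R F R).flip 1 := by
    ext u
    simp [incl, ψ, ← TensorProduct.tmul_smul]
  have hX : map I (ψ.lTensor F) X = 0 := by
    simp only [X, map_sum, map_comp_apply, hψincl, map_smul_linearMap]
    simp only [← LinearMap.map_smul_of_tower, ← map_sum, hfx, _root_.map_zero]
  obtain ⟨Y, hY⟩ := (map_lTensor_exact I F hφψ X).mp hX
  refine ⟨m, fun i j ↦ φ (Pi.single j 1) i, fun j ↦ map I (coord m j) Y, fun i ↦ ?_, fun j ↦ ?_⟩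
  · have hcoord (i' : Fin l) : coord l i ∘ₗ incl i' = if i' = i then LinearMap.id else 0 := by
      ext u
      split_ifs with h <;> simp [coord, incl, h, Ne.symm]
    have hcoordφ : coord l i ∘ₗ φ.lTensor F = ∑ j, φ (Pi.single j 1) i • coord m j := by
      ext u j
      simp [coord, Pi.single_apply]
    have hxX : x i = map I (coord l i) X := by
      simp only [X, map_sum, map_comp_apply, hcoord]
      rw [Finset.sum_eq_single i] <;> simp +contextual
    rw [hxX, ← hY, map_comp_apply, hcoordφ, map_sum_linearMap]
    simp only [map_smul_linearMap]
  · have := hφψ.apply_apply_eq_zero (Pi.single j 1)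
    simpa [ψ, Fintype.linearCombination_apply, mul_comm] using this

end Flat

end AdicCompletion

/-- (Lemma 1.1 of the paper, first part.) Let `R` be a commutative Noetherian ring,
`I` an ideal of `R` and `S` a flat `R`-algebra (not necessarily Noetherian). Then the
`I`-adic (separated) completion `Ŝ = lim_n S/IⁿS` of `S` is flat as an `R`-module. -/
theorem adicCompletion_flat_of_flat
    (R : Type*) [CommRing R] [IsNoetherianRing R] (I : Ideal R)
    (S : Type*) [CommRing S] [Algebra R S] [Module.Flat R S] :
    Module.Flat R (AdicCompletion I S) := by
  exact AdicCompletion.flat_of_flat I S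
end

section
/- Let R be a commutative Noetherian ring, I an ideal of R contained in the Jacobson radical of R (for instance, R is I-adically complete), and S a faithfully flat R-algebra. Then the I-adic completion Ŝ = lim_n S/IⁿS of S is faithfully flat as an R-module. -/
open TensorProduct in
/-- The Artin–Rees lemma for a map of finite modules, after tensoring with a flat module:
an element whose image lies deep in the `I`-adic filtration can be moved deep into the filtration
without changing its image. -/
theorem Module.Flat.exists_mem_pow_smul_lTensor_eq {R M N P : Type*} [CommRing R]
    [IsNoetherianRing R] (I : Ideal R) [AddCommGroup M] [Module R M] [Module.Flat R M]
    [AddCommGroup N] [Module R N] [AddCommGroup P] [Module R P] [Module.Finite R P]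
    (g : N →ₗ[R] P) :
    ∃ c : ℕ, ∀ (n : ℕ) (z : M ⊗[R] N),
      g.lTensor M z ∈ (I ^ (n + c) • ⊤ : Submodule R (M ⊗[R] P)) →
      ∃ w ∈ (I ^ n • ⊤ : Submodule R (M ⊗[R] N)), g.lTensor M w = g.lTensor M z := by
  obtain ⟨c, hc⟩ := Ideal.exists_pow_inf_eq_pow_smul I (LinearMap.range g)
  refine ⟨c, fun n z hz ↦ ?_⟩
  let q : P →ₗ[R] P ⧸ (I ^ (n + c) • ⊤ : Submodule R P) := Submodule.mkQ _
  let h : N →ₗ[R] P ⧸ (I ^ (n + c) • ⊤ : Submodule R P) := q ∘ₗ g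
  have hq : ∀ y ∈ (I ^ (n + c) • ⊤ : Submodule R (M ⊗[R] P)), q.lTensor M y = 0 := by
    intro y hy
    refine Submodule.smul_induction_on hy (fun r hr y hy ↦ ?_) (fun x y hx hy ↦ ?_)
    · clear hy
      induction y with
      | zero => simp
      | tmul m p =>
        have : q (r • p) = 0 := by
          exact (Submodule.Quotient.mk_eq_zero _).mpr
            (Submodule.smul_mem_smul hr Submodule.mem_top)
        rw [← TensorProduct.tmul_smul, LinearMap.lTensor_tmul, this, TensorProduct.tmul_zero]
      | add x y hx hy => rw [smul_add, map_add, hx, hy, add_zero]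
    · rw [map_add, hx, hy, add_zero]
  have hz0 : h.lTensor M z = 0 := by
    rw [LinearMap.lTensor_comp_apply]
    exact hq _ hz
  have hex : Function.Exact ((LinearMap.ker h).subtype.lTensor M) (h.lTensor M) :=
    Module.Flat.lTensor_exact M (LinearMap.exact_subtype_ker_map h)
  obtain ⟨t, rfl⟩ := (hex z).mp hz0
  clear hz hz0
  induction t with
  | zero => exact ⟨0, Submodule.zero_mem _, by simp⟩
  | tmul m p =>
    obtain ⟨p, hp⟩ := p
    have hgp : g p ∈ (I ^ (n + c) • ⊤ : Submodule R P) := by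
      simpa [h, q] using hp
    have hgp' : g p ∈ (I ^ n • (⊤ : Submodule R N)).map g := by
      rw [Submodule.map_smul'', Submodule.map_top]
      have hmem := (hc (n + c) (by lia)).le ⟨hgp, LinearMap.mem_range_self g p⟩
      rw [Nat.add_sub_cancel] at hmem
      have hle : I ^ n • (I ^ c • ⊤ ⊓ LinearMap.range g) ≤ I ^ n • LinearMap.range g :=
        smul_mono_right _ inf_le_right
      exact hle hmem
    obtain ⟨u, hu, hup⟩ := hgp'
    refine ⟨m ⊗ₜ u, ?_, by simp [hup]⟩
    have hle : (I ^ n • (⊤ : Submodule R N)).map (TensorProduct.mk R M N m) ≤ I ^ n • ⊤ := by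
      rw [Submodule.map_smul'']
      exact smul_mono_right _ le_top
    exact hle ⟨u, hu, rfl⟩
  | add x y hx hy =>
    obtain ⟨u, hu, hux⟩ := hx
    obtain ⟨v, hv, hvy⟩ := hy
    exact ⟨u + v, Submodule.add_mem _ hu hv, by simp only [map_add, hux, hvy]⟩

namespace AdicCompletion

section Exact

variable {R A B C : Type*} [CommRing R] (I : Ideal R) [AddCommGroup A] [Module R A]
  [AddCommGroup B] [Module R B] [AddCommGroup C] [Module R C]

/-- Adic completion preserves exactness when both maps satisfy the conclusion of the
Artin–Rees lemma. -/
theorem map_exact_of_exists_mem_pow_smul {f : A →ₗ[R] B} {g : B →ₗ[R] C}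
    (hfg : Function.Exact f g)
    (hf : ∃ c : ℕ, ∀ (n : ℕ) (z : A), f z ∈ (I ^ (n + c) • ⊤ : Submodule R B) →
      ∃ w ∈ (I ^ n • ⊤ : Submodule R A), f w = f z)
    (hg : ∃ c : ℕ, ∀ (n : ℕ) (z : B), g z ∈ (I ^ (n + c) • ⊤ : Submodule R C) →
      ∃ w ∈ (I ^ n • ⊤ : Submodule R B), g w = g z) :
    Function.Exact (map I f) (map I g) := by
  refine LinearMap.exact_of_comp_eq_zero_of_ker_le_range ?_ (fun y ↦ ?_)
  · rw [map_comp, hfg.linearMap_comp_eq_zero, AdicCompletion.map_zero]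
  apply AdicCompletion.induction_on I B y (fun b ↦ ?_)
  intro hz
  obtain ⟨d, hf⟩ := hf
  obtain ⟨c, hg⟩ := hg
  have hb (n : ℕ) : g (b n) ∈ (I ^ n • ⊤ : Submodule R C) := by
    simpa using congrArg (fun x ↦ x.val n) hz
  have hbb {m n : ℕ} (hmn : m ≤ n) : b n - b m ∈ (I ^ m • ⊤ : Submodule R B) :=
    (Submodule.Quotient.eq _).mp (AdicCauchySequence.mk_eq_mk hmn b)
  have ha (n : ℕ) : ∃ a : A, f a - b n ∈ (I ^ n • ⊤ : Submodule R B) := by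
    obtain ⟨w, hw, hgw⟩ := hg n (b (n + c)) (hb _)
    obtain ⟨a, ha⟩ := (hfg (b (n + c) - w)).mp (by simp [hgw])
    refine ⟨a, ?_⟩
    rw [ha, sub_right_comm]
    exact Submodule.sub_mem _ (hbb (by lia)) hw
  choose a ha using ha
  have hv (n : ℕ) : ∃ v ∈ (I ^ n • ⊤ : Submodule R A), f v = f (a (n + 1 + d) - a (n + d)) := by
    refine hf n _ ?_
    have h1 : f (a (n + 1 + d)) - b (n + 1 + d) ∈ (I ^ (n + d) • ⊤ : Submodule R B) :=
      Submodule.smul_mono_left (Ideal.pow_le_pow_right (by lia)) (ha (n + 1 + d))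
    have h2 := hbb (show n + d ≤ n + 1 + d by lia)
    convert Submodule.sub_mem _ (Submodule.add_mem _ h1 h2) (ha (n + d)) using 1
    rw [map_sub]
    abel
  choose v hv hfv using hv
  let s (n : ℕ) : A := a d + ∑ i ∈ Finset.range n, v i
  have hfs (n : ℕ) : f (s n) = f (a (n + d)) := by
    induction n with
    | zero => simp [s]
    | succ n ih =>
      have : s (n + 1) = s n + v n := by simp [s, Finset.sum_range_succ, add_assoc]
      rw [this, map_add, ih, hfv, map_sub, add_sub_cancel]
  refine ⟨AdicCompletion.mk I A (AdicCauchySequence.mk I A s fun n ↦ SModEq.symm ?_), ?_⟩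
  · rw [SModEq.sub_mem]
    simpa [s, Finset.sum_range_succ] using hv n
  · ext n
    suffices h : f (s n) - b n ∈ (I ^ n • ⊤ : Submodule R B) by
      simpa using! (Submodule.Quotient.eq _).mpr h
    have h1 : f (a (n + d)) - b (n + d) ∈ (I ^ n • ⊤ : Submodule R B) :=
      Submodule.smul_mono_left (Ideal.pow_le_pow_right (by lia)) (ha (n + d))
    rw [hfs]
    simpa using Submodule.add_mem _ h1 (hbb (show n ≤ n + d by lia))

theorem map_sum_smul_apply {ι : Type*} (s : Finset ι) (r : ι → R) (f : ι → A →ₗ[R] B)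
    (x : AdicCompletion I A) :
    map I (∑ i ∈ s, r i • f i) x = ∑ i ∈ s, r i • map I (f i) x := by
  induction x using AdicCompletion.induction_on with | _ a
  ext n
  simp [val_sum_apply, val_smul_apply]

theorem map_smul_apply (r : R) (f : A →ₗ[R] B) (x : AdicCompletion I A) :
    map I (r • f) x = map I f (r • x) := by
  induction x using AdicCompletion.induction_on with | _ a
  ext n
  simp [val_smul_apply]

end Exact

open TensorProduct in
/-- Over a Noetherian ring, the adic completion of a flat module is flat. -/
theorem flat_of_flat_s5 {R : Type*} [CommRing R] [IsNoetherianRing R] (I : Ideal R)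
    (M : Type*) [AddCommGroup M] [Module R M] [Module.Flat R M] :
    Module.Flat R (AdicCompletion I M) := by
  refine Module.Flat.of_forall_isTrivialRelation fun {l f x} hfx ↦ ?_
  let φ : (Fin l → R) →ₗ[R] R := Fintype.linearCombination R f
  obtain ⟨k, p, hp⟩ := Module.Finite.exists_fin' R (LinearMap.ker φ)
  let g : (Fin k → R) →ₗ[R] (Fin l → R) := (LinearMap.ker φ).subtype ∘ₗ p
  have hgφ : Function.Exact g φ := by
    rw [LinearMap.exact_iff, LinearMap.range_comp, LinearMap.range_eq_top.mpr hp,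
      Submodule.map_top, Submodule.range_subtype]
  have hex := map_exact_of_exists_mem_pow_smul I (Module.Flat.lTensor_exact M hgφ)
    (Module.Flat.exists_mem_pow_smul_lTensor_eq I g)
    (Module.Flat.exists_mem_pow_smul_lTensor_eq I φ)
  let incl (i : Fin l) : M →ₗ[R] M ⊗[R] (Fin l → R) :=
    (TensorProduct.mk R M (Fin l → R)).flip (Pi.single i 1)
  let coord {m : ℕ} (i : Fin m) : M ⊗[R] (Fin m → R) →ₗ[R] M :=
    (TensorProduct.rid R M).toLinearMap ∘ₗ (LinearMap.proj i).lTensor M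
  let X : AdicCompletion I (M ⊗[R] (Fin l → R)) := ∑ i, map I (incl i) (x i)
  have hX : map I (φ.lTensor M) X = 0 := by
    have hφ (i : Fin l) : φ.lTensor M ∘ₗ incl i = f i • (TensorProduct.mk R M R).flip 1 := by
      ext m
      simp [incl, φ, ← TensorProduct.tmul_smul]
    simp only [X, map_sum, map_comp_apply, hφ, map_smul_apply]
    rw [← map_sum, hfx, _root_.map_zero]
  have hcoord (i : Fin l) : map I (coord i) X = x i := by
    have hc (j : Fin l) : coord i ∘ₗ incl j = if j = i then LinearMap.id else 0 := by
      ext m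
      by_cases h : j = i
      · subst h; simp [coord, incl]
      · simp [coord, incl, h, Ne.symm h]
    simp only [X, map_sum, map_comp_apply, hc]
    rw [Finset.sum_eq_single i (by intro j _ hj; simp [hj]) (by simp)]
    simp
  obtain ⟨Y, hY⟩ := (hex X).mp hX
  refine ⟨k, fun i j ↦ g (Pi.single j 1) i, fun j ↦ map I (coord j) Y, fun i ↦ ?_, fun j ↦ ?_⟩
  · rw [← hcoord, ← hY, map_comp_apply, ← map_sum_smul_apply]
    congr 2
    ext m j
    simp [coord, Pi.single_apply]
  · have := hgφ.apply_apply_eq_zero (Pi.single j 1)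
    simpa [φ, Fintype.linearCombination_apply, mul_comm] using this

end AdicCompletion

/-- (Lemma 1.1 of the paper, last part.) Let `R` be a commutative Noetherian ring,
`I` an ideal of `R` contained in the Jacobson radical of `R` (for instance, `R` is
`I`-adically complete), and `S` a faithfully flat `R`-algebra. Then the `I`-adic
completion `Ŝ = lim_n S/IⁿS` of `S` is faithfully flat as an `R`-module. -/
theorem adicCompletion_faithfullyFlat_of_faithfullyFlat
    (R : Type*) [CommRing R] [IsNoetherianRing R] (I : Ideal R)
    (hI : I ≤ (⊥ : Ideal R).jacobson)
    (S : Type*) [CommRing S] [Algebra R S] [Module.FaithfullyFlat R S] :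
    Module.FaithfullyFlat R (AdicCompletion I S) := by
  refine (Module.faithfullyFlat_iff R _).mpr ⟨AdicCompletion.flat_of_flat_s5 I S, fun m hm htop ↦ ?_⟩
  have hIm : I ≤ m := hI.trans (Ideal.jacobson_bot.le.trans (Ring.jacobson_le_of_isMaximal m))
  refine Module.FaithfullyFlat.submodule_ne_top (M := S) hm ?_
  have hmap := congrArg (Submodule.map (AdicCompletion.eval I S 1)) htop
  rw [Submodule.map_smul'', Submodule.map_top, AdicCompletion.range_eval,
    ← Submodule.range_mkQ, ← Submodule.map_top, ← Submodule.map_smul''] at hmap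
  have hcomap := congrArg (Submodule.comap (Submodule.mkQ (I ^ 1 • ⊤ : Submodule R S))) hmap
  rw [Submodule.comap_map_mkQ, Submodule.comap_map_mkQ, pow_one, sup_top_eq] at hcomap
  rwa [sup_eq_right.mpr (Submodule.smul_mono_left hIm)] at hcomap
end

section
/- Let R be a commutative Noetherian ring, J an ideal of R, S an R-algebra whose structure map R → S is pure (for instance, S faithfully flat over R), and K an idempotent ideal of S (K·K = K) with K ⊆ J·S. Then for every s ∈ R whose image in S lies in K, there exists r ∈ J such that (1−r)·s = 0 in R. -/
open TensorProduct

universe u v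

/-- An `R`-algebra `S` is pure (the structure map `R → S` is universally injective) if
for every `R`-module `P` the map `P → P ⊗[R] S`, `p ↦ p ⊗ 1`, is injective. -/
def Algebra.IsPure (R : Type u) (S : Type v) [CommRing R] [CommRing S] [Algebra R S] : Prop :=
  ∀ (P : Type u) [AddCommGroup P] [Module R P],
    Function.Injective (fun p : P => (p ⊗ₜ[R] (1 : S) : P ⊗[R] S))

/-- A pure ring extension contracts each extended ideal to the original ideal. -/
theorem Algebra.IsPure.comap_map_le {R : Type u} {S : Type v} [CommRing R] [CommRing S]
    [Algebra R S] (h : Algebra.IsPure R S) (I : Ideal R) :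
    (I.map (algebraMap R S)).comap (algebraMap R S) ≤ I := by
  intro x hx
  have key : ∀ y ∈ I.map (algebraMap R S), ∀ c : S,
      ((1 : R ⧸ I) ⊗ₜ[R] (c * y) : (R ⧸ I) ⊗[R] S) = 0 := by
    intro y hy
    refine Submodule.span_induction ?_ ?_ ?_ ?_ hy
    · rintro _ ⟨a, ha, rfl⟩ c
      rw [mul_comm, ← Algebra.smul_def, ← TensorProduct.smul_tmul, Algebra.smul_def, mul_one,
        Ideal.Quotient.algebraMap_eq, Ideal.Quotient.eq_zero_iff_mem.mpr ha,
        TensorProduct.zero_tmul]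
    · simp
    · intro y z _ _ hy hz c
      rw [mul_add, TensorProduct.tmul_add, hy, hz, add_zero]
    · intro a y _ hy c
      rw [smul_eq_mul, ← mul_assoc, hy]
  refine Ideal.Quotient.eq_zero_iff_mem.mp (h (R ⧸ I) ?_)
  have hx1 := key _ hx 1
  rw [one_mul, Algebra.algebraMap_eq_smul_one, ← TensorProduct.smul_tmul, Algebra.smul_def,
    mul_one, Ideal.Quotient.algebraMap_eq] at hx1
  simpa using hx1

/-- (Lemma 1.2 of the paper.) Let `R` be a commutative Noetherian ring, `J` an ideal
of `R`, `S` a pure `R`-algebra (for instance a faithfully flat one), and `K` an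
idempotent ideal of `S` contained in `J·S`. Then for every `s ∈ R` whose image in `S`
lies in `K`, there exists `r ∈ J` with `(1 - r) * s = 0` in `R`. -/
theorem exists_one_sub_mem_mul_eq_zero_of_idempotent_ideal
    (R : Type u) (S : Type v) [CommRing R] [IsNoetherianRing R] [CommRing S] [Algebra R S]
    (J : Ideal R) (hpure : Algebra.IsPure R S)
    (K : Ideal S) (hK : K * K = K) (hKJ : K ≤ Ideal.map (algebraMap R S) J)
    (s : R) (hs : algebraMap R S s ∈ K) :
    ∃ r ∈ J, (1 - r) * s = 0 := by
  have hpow : ∀ n : ℕ, K ≤ Ideal.map (algebraMap R S) J ^ n := by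
    intro n
    induction n with
    | zero => simp
    | succ n ih =>
      rw [pow_succ, ← hK]
      exact Ideal.mul_mono ih hKJ
  have hmem : s ∈ (⨅ i : ℕ, J ^ i • ⊤ : Submodule R R) := by
    refine (Submodule.mem_iInf _).mpr fun n => ?_
    rw [smul_eq_mul, Ideal.mul_top]
    refine hpure.comap_map_le (J ^ n) ?_
    rw [Ideal.mem_comap, Ideal.map_pow]
    exact hpow n hs
  obtain ⟨r, hr⟩ := (J.mem_iInf_smul_pow_eq_bot_iff s).mp hmem
  refine ⟨r, r.2, ?_⟩
  rw [sub_mul, one_mul, ← smul_eq_mul, hr, sub_self]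
end

section
/- Let R be a commutative Noetherian local ring, J an ideal of R, S an R-algebra whose structure map R → S is pure (for instance, S faithfully flat over R), and K an idempotent ideal of S with K ⊆ J·S. If there exists a nonzero s ∈ R whose image in S lies in K, then J = R. -/
open TensorProduct

universe u v

/-- Ideals are contracted along a pure ring homomorphism. -/
theorem Algebra.IsPure.comap_map_eq {R : Type u} {S : Type v} [CommRing R] [CommRing S]
    [Algebra R S] (hpure : Algebra.IsPure R S) (I : Ideal R) :
    (I.map (algebraMap R S)).comap (algebraMap R S) = I := by
  refine le_antisymm (fun r hr => ?_) Ideal.le_comap_map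
  have tmul_eq_zero : ∀ x ∈ I.map (algebraMap R S),
      ((1 : R ⧸ I) ⊗ₜ[R] x : (R ⧸ I) ⊗[R] S) = 0 := by
    intro x hx
    induction hx using Submodule.span_induction with
    | mem x hx =>
      obtain ⟨a, ha, rfl⟩ := hx
      have ha0 : a • (1 : R ⧸ I) = 0 := by
        rw [Algebra.smul_def, mul_one]
        exact Ideal.Quotient.eq_zero_iff_mem.mpr ha
      rw [Algebra.algebraMap_eq_smul_one, ← TensorProduct.smul_tmul, ha0,
        TensorProduct.zero_tmul]
    | zero => exact TensorProduct.tmul_zero _ _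
    | add x y _ _ hx hy => rw [TensorProduct.tmul_add, hx, hy, add_zero]
    | smul a x _ hx =>
      simpa using congrArg ((LinearMap.mulLeft R a).lTensor (R ⧸ I)) hx
  refine Ideal.Quotient.eq_zero_iff_mem.mp (hpure (R ⧸ I) ?_)
  have h := tmul_eq_zero _ hr
  rw [Algebra.algebraMap_eq_smul_one, ← TensorProduct.smul_tmul, Algebra.smul_def, mul_one] at h
  exact h.trans (TensorProduct.zero_tmul _ _).symm

/-- (Lemma 1.2 of the paper, second part.) Let `R` be a commutative Noetherian local
ring, `J` an ideal of `R`, `S` a pure `R`-algebra (for instance a faithfully flat one),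
and `K` an idempotent ideal of `S` contained in `J·S`. If some nonzero `s ∈ R` has its
image in `S` lying in `K`, then `J = R`. -/
theorem ideal_eq_top_of_nonzero_mem_idempotent_ideal
    (R : Type u) (S : Type v) [CommRing R] [IsNoetherianRing R] [IsLocalRing R]
    [CommRing S] [Algebra R S]
    (J : Ideal R) (hpure : Algebra.IsPure R S)
    (K : Ideal S) (hK : K * K = K) (hKJ : K ≤ Ideal.map (algebraMap R S) J)
    (s : R) (hs : s ≠ 0) (hsK : algebraMap R S s ∈ K) :
    J = ⊤ := by
  by_contra hJ
  have hpow (n : ℕ) : s ∈ J ^ n := by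
    rw [← hpure.comap_map_eq (J ^ n), Ideal.mem_comap, Ideal.map_pow]
    cases n with
    | zero => simp
    | succ n =>
      have hKn : K ^ (n + 1) = K := IsIdempotentElem.pow_succ_eq n hK
      exact Ideal.pow_right_mono hKJ (n + 1) (hKn.symm ▸ hsK)
  have hs_mem : s ∈ ⨅ n : ℕ, J ^ n := (Submodule.mem_iInf _).mpr hpow
  rw [Ideal.iInf_pow_eq_bot_of_isLocalRing J hJ] at hs_mem
  exact hs hs_mem
end

section
/- Let R be a commutative Noetherian ring and let S be a commutative R-algebra that is finite as an R-module, flat as an R-module, and whose structure map R → S is injective. Then R → S admits an R-linear retraction, i.e. the exact sequence 0 → R → S → S/R → 0 of R-modules splits. -/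
/-- If `S` is projective as an `R`-module, the values at `1` of the `R`-linear functionals on `S`
generate the unit ideal of `S`. -/
theorem Ideal.map_range_applyₗ_one_eq_top (R S : Type*) [CommRing R] [CommRing S] [Algebra R S]
    [Module.Projective R S] :
    Ideal.map (algebraMap R S) (LinearMap.range (LinearMap.applyₗ (R := R) (M₂ := R) (1 : S))) =
      ⊤ := by
  obtain ⟨s, hs⟩ := Module.projective_def'.mp (inferInstance : Module.Projective R S)
  rw [Ideal.eq_top_iff_one]
  have h : (s 1).sum (fun p a => a • p) = (1 : S) := by
    simpa [Finsupp.linearCombination_apply] using LinearMap.congr_fun hs 1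
  suffices h_mem : (s 1).sum (fun p a => a • p) ∈ Ideal.map (algebraMap R S)
      (LinearMap.range (LinearMap.applyₗ (R := R) (M₂ := R) (1 : S))) by rwa [h] at h_mem
  refine Ideal.sum_mem _ fun p _ => ?_
  simp only [Algebra.smul_def]
  exact Ideal.mul_mem_right _ _ (Ideal.mem_map_of_mem _ ⟨Finsupp.lapply p ∘ₗ s, rfl⟩)

/-- **The direct summand property for finite flat extensions.** Let `R` be a commutative
Noetherian ring and `S` a commutative `R`-algebra which is finite and flat as an
`R`-module and whose structure map `R → S` is injective. Then `R → S` admits an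
`R`-linear retraction, i.e. the exact sequence `0 → R → S → S/R → 0` of `R`-modules
splits. -/
theorem direct_summand_of_finite_flat
    (R : Type*) [CommRing R] [IsNoetherianRing R]
    (S : Type*) [CommRing S] [Algebra R S] [Module.Finite R S] [Module.Flat R S]
    (hinj : Function.Injective (algebraMap R S)) :
    ∃ f : S →ₗ[R] R, ∀ r : R, f (algebraMap R S r) = r := by
  have : Module.FinitePresentation R S := Module.finitePresentation_of_finite R S
  have : Module.Projective R S := Module.Flat.projective_of_finitePresentation
  have hint : (algebraMap R S).IsIntegral := algebraMap_isIntegral_iff.mpr inferInstance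
  have h := (Ideal.map_eq_top_iff (algebraMap R S) hinj hint).mp
    (Ideal.map_range_applyₗ_one_eq_top R S)
  obtain ⟨f, hf⟩ := (Ideal.eq_top_iff_one _).mp h
  refine ⟨f, fun r => ?_⟩
  rw [Algebra.algebraMap_eq_smul_one, map_smul, show f 1 = 1 from hf, smul_eq_mul, mul_one]
end

section
/- Let R be a commutative ring and S a commutative R-algebra whose underlying R-module is finitely presented and whose structure map R → S is injective. Then R → S is pure if and only if it admits an R-linear retraction (equivalently, R is a direct summand of S as an R-module). -/
open TensorProduct

universe u v

/-- Let `M` be a finitely presented module and `x : M`. If `p ↦ p ⊗ x` is injective on every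
module `P`, then some linear form on `M` takes the value `1` at `x`. -/
theorem Module.FinitePresentation.exists_dual_apply_eq_one_of_tmul_injective
    {R : Type u} {M : Type v} [CommRing R] [AddCommGroup M] [Module R M]
    [Module.FinitePresentation R M] (x : M)
    (h : ∀ (P : Type u) [AddCommGroup P] [Module R P],
      Function.Injective (fun p : P => (p ⊗ₜ[R] x : P ⊗[R] M))) :
    ∃ f : M →ₗ[R] R, f x = 1 := by
  obtain ⟨n, K, e, hK⟩ := Module.FinitePresentation.exists_fin R M
  obtain ⟨m, r, hr⟩ := Submodule.fg_iff_exists_fin_generating_family.mp hK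
  obtain ⟨c, hc⟩ := K.mkQ_surjective (e x)
  -- `B φ` records the values of the form `φ` on the relations `r i` and on the lift `c` of `x`.
  let ev (w : Fin n → R) : ((Fin n → R) →ₗ[R] R) →ₗ[R] R := LinearMap.applyₗ w
  let B : ((Fin n → R) →ₗ[R] R) →ₗ[R] (Fin m → R) × R :=
    (LinearMap.pi fun i => ev (r i)).prod (ev c)
  let π := (LinearMap.range B).mkQ
  let g : (Fin n → R) →ₗ[R] M := e.symm.toLinearMap ∘ₗ K.mkQ
  have hgc : g c = x := by simp [g, hc]
  have hgr (i : Fin m) : g (r i) = 0 := by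
    have : K.mkQ (r i) = 0 := by
      rw [Submodule.mkQ_apply, Submodule.Quotient.mk_eq_zero, ← hr]
      exact Submodule.subset_span ⟨i, rfl⟩
    simp only [g, LinearMap.comp_apply, this, map_zero]
  have hg (w : Fin n → R) : g w = ∑ j, w j • g (Pi.single j 1) := by
    conv_lhs => rw [pi_eq_sum_univ' w]
    simp [map_sum]
  have hrel (j : Fin n) : c j • π (0, 1) = -∑ i, r i j • π (Pi.single i 1, 0) := by
    rw [eq_neg_iff_add_eq_zero]
    simp only [← map_smul, ← map_sum, ← map_add]
    rw [Submodule.mkQ_apply, Submodule.Quotient.mk_eq_zero]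
    refine ⟨LinearMap.proj j, ?_⟩
    refine Prod.ext ?_ ?_
    · ext k
      simp [B, ev, Prod.fst_sum, Finset.sum_apply, Pi.single_apply]
    · simp [B, ev, Prod.snd_sum]
  have hzero : π (0, 1) ⊗ₜ[R] x = 0 := by
    calc π (0, 1) ⊗ₜ[R] x = ∑ j, (c j • π (0, 1)) ⊗ₜ[R] g (Pi.single j 1) := by
          rw [← hgc, hg c, tmul_sum]
          simp only [smul_tmul]
      _ = -∑ i, π (Pi.single i 1, 0) ⊗ₜ[R] g (r i) := by
          simp only [hrel, neg_tmul, sum_tmul, Finset.sum_neg_distrib]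
          rw [Finset.sum_comm]
          simp only [hg (r _), tmul_sum, smul_tmul]
      _ = 0 := by simp [hgr]
  have hπ : π (0, 1) = 0 := h _ (by simpa using hzero)
  rw [Submodule.mkQ_apply, Submodule.Quotient.mk_eq_zero] at hπ
  obtain ⟨φ, hφ⟩ := hπ
  have hφr (i : Fin m) : φ (r i) = 0 := congrFun (congrArg Prod.fst hφ) i
  have hφc : φ c = 1 := congrArg Prod.snd hφ
  have hKφ : K ≤ LinearMap.ker φ := by
    rw [← hr, Submodule.span_le]
    rintro _ ⟨i, rfl⟩
    exact hφr i
  refine ⟨K.liftQ φ hKφ ∘ₗ e.toLinearMap, ?_⟩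
  rw [LinearMap.comp_apply, LinearEquiv.coe_coe, ← hc, Submodule.mkQ_apply,
    Submodule.liftQ_apply, hφc]

/-- An algebra admitting a linear retraction of its structure map is pure. -/
theorem Algebra.IsPure.of_retraction {R : Type u} {S : Type v} [CommRing R] [CommRing S]
    [Algebra R S] (f : S →ₗ[R] R) (hf : f 1 = 1) : Algebra.IsPure R S := by
  intro P _ _ p q hpq
  simpa [hf] using congrArg (_root_.TensorProduct.rid R P ∘ f.lTensor P) hpq

/-- (Lemma 5.1 (2) / Proposition 5.2 (3) of the paper.) Let `R` be a commutative ring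
and `S` a commutative `R`-algebra whose underlying `R`-module is finitely presented and
whose structure map is injective. Then `R → S` is pure if and only if it admits an
`R`-linear retraction, i.e. `R` is a direct summand of `S` as an `R`-module. -/
theorem isPure_iff_exists_retraction_of_finitePresentation
    (R : Type u) (S : Type v) [CommRing R] [CommRing S] [Algebra R S]
    [Module.FinitePresentation R S]
    (hinj : Function.Injective (algebraMap R S)) :
    Algebra.IsPure R S ↔ ∃ f : S →ₗ[R] R, ∀ r : R, f (algebraMap R S r) = r := by
  constructor
  · intro h
    obtain ⟨f, hf⟩ := Module.FinitePresentation.exists_dual_apply_eq_one_of_tmul_injective (1 : S) h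
    exact ⟨f, fun r => by rw [Algebra.algebraMap_eq_smul_one, map_smul, hf, smul_eq_mul, mul_one]⟩
  · rintro ⟨f, hf⟩
    exact Algebra.IsPure.of_retraction f (by simpa using hf 1)
end

section
/- Let (A, 𝔪) be a complete Noetherian local ring and B a commutative A-algebra that is finite as an A-module with injective structure map A → B. If for every n ≥ 1 the induced map A/𝔪ⁿ → B/𝔪ⁿB admits an A/𝔪ⁿ-linear retraction, then A → B admits an A-linear retraction. -/
theorem Submodule.mem_of_forall_mem_sup_maximalIdeal_pow_smul_top
    {A N : Type*} [CommRing A] [IsNoetherianRing A] [IsLocalRing A]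
    [AddCommGroup N] [Module A N] [Module.Finite A N] (P : Submodule A N) (y : N)
    (h : ∀ n : ℕ, 1 ≤ n → ∃ p ∈ P, y - p ∈ IsLocalRing.maximalIdeal A ^ n • (⊤ : Submodule A N)) :
    y ∈ P := by
  rw [← Submodule.Quotient.mk_eq_zero P, ← Submodule.mem_bot A,
    ← Ideal.iInf_pow_smul_eq_bot_of_isLocalRing (M := N ⧸ P) (IsLocalRing.maximalIdeal A)
      (Ideal.IsPrime.ne_top inferInstance), Submodule.mem_iInf]
  intro n
  obtain rfl | hn := Nat.eq_zero_or_pos n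
  · simp
  obtain ⟨p, hp, hy⟩ := h n hn
  have hmap := Submodule.mem_map_of_mem (f := P.mkQ) hy
  rw [Submodule.map_smul'', map_sub, Submodule.mkQ_apply P p,
    (Submodule.Quotient.mk_eq_zero P).2 hp, sub_zero] at hmap
  exact Submodule.smul_mono le_rfl le_top hmap

theorem Ideal.mem_smul_top_pi_of_forall_mem {A ι : Type*} [CommRing A] [Finite ι] (I : Ideal A)
    (x : ι → A) (hx : ∀ i, x i ∈ I) : x ∈ I • (⊤ : Submodule A (ι → A)) := by
  classical
  cases nonempty_fintype ι
  rw [pi_eq_sum_univ x]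
  exact Submodule.sum_mem _ fun i _ => Submodule.smul_mem_smul (hx i) trivial

/-- A map out of a finite module over a Noetherian local ring with a prescribed value at a point
exists as soon as it exists modulo every power of the maximal ideal: such maps are the solutions
of a finite linear system, so this follows from Krull's intersection theorem. -/
theorem IsLocalRing.exists_linearMap_apply_eq_of_forall_quotient_pow
    {A M : Type*} [CommRing A] [IsNoetherianRing A] [IsLocalRing A]
    [AddCommGroup M] [Module A M] [Module.Finite A M] (m : M) (a : A)
    (h : ∀ n : ℕ, 1 ≤ n → ∃ f : M →ₗ[A] A ⧸ IsLocalRing.maximalIdeal A ^ n,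
      f m = Ideal.Quotient.mk _ a) :
    ∃ f : M →ₗ[A] A, f m = a := by
  obtain ⟨q, π, hπ⟩ := Module.Finite.exists_fin' A M
  obtain ⟨b, hb⟩ := hπ m
  obtain ⟨p, r, hr⟩ := Submodule.fg_iff_exists_fin_generating_family.1
    (IsNoetherian.noetherian (LinearMap.ker π))
  let T : ((Fin q → A) →ₗ[A] A) →ₗ[A] (Option (Fin p) → A) :=
    LinearMap.pi fun o => LinearMap.applyₗ (o.elim b r)
  have hT : (fun o => o.elim a fun _ => 0 : Option (Fin p) → A) ∈ LinearMap.range T := by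
    refine Submodule.mem_of_forall_mem_sup_maximalIdeal_pow_smul_top _ _ fun n hn => ?_
    obtain ⟨f, hf⟩ := h n hn
    obtain ⟨φ, hφ⟩ := Module.projective_lifting_property
      (Submodule.mkQ (IsLocalRing.maximalIdeal A ^ n)) (f ∘ₗ π) (Submodule.mkQ_surjective _)
    have key (x : Fin q → A) : Ideal.Quotient.mk (IsLocalRing.maximalIdeal A ^ n) (φ x) = f (π x) :=
      LinearMap.congr_fun hφ x
    refine ⟨T φ, ⟨φ, rfl⟩, Ideal.mem_smul_top_pi_of_forall_mem _ _ ?_⟩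
    rintro (_ | j)
    · rw [← Ideal.Quotient.eq_zero_iff_mem]
      simp [T, key, hb, hf]
    · have hj : π (r j) = 0 := LinearMap.mem_ker.1 (hr ▸ Submodule.subset_span ⟨j, rfl⟩)
      rw [← Ideal.Quotient.eq_zero_iff_mem]
      simp [T, key, hj]
  obtain ⟨φ, hφ⟩ := hT
  have hker : LinearMap.ker π ≤ LinearMap.ker φ := by
    rw [← hr, Submodule.span_le]
    rintro _ ⟨j, rfl⟩
    exact congr_fun hφ (some j)
  refine ⟨(LinearMap.ker π).liftQ φ hker ∘ₗ (π.quotKerEquivOfSurjective hπ).symm, ?_⟩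
  have hm : (π.quotKerEquivOfSurjective hπ).symm m = Submodule.Quotient.mk b := by
    rw [LinearEquiv.symm_apply_eq, ← hb]
    rfl
  rw [LinearMap.comp_apply, LinearEquiv.coe_coe, hm, Submodule.liftQ_apply]
  exact congr_fun hφ none


/-- (Hochster's Mittag-Leffler argument, used in §3.4 of the paper.) Let `(A, 𝔪)` be a
complete Noetherian local ring and `B` a commutative `A`-algebra which is finite as an
`A`-module with injective structure map. If for every `n ≥ 1` the induced map
`A/𝔪ⁿ → B/𝔪ⁿB` admits an `A/𝔪ⁿ`-linear retraction, then `A → B` admits an `A`-linear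
retraction. -/
theorem exists_retraction_of_retractions_mod_powers
    (A : Type*) [CommRing A] [IsNoetherianRing A] [IsLocalRing A]
    [IsAdicComplete (IsLocalRing.maximalIdeal A) A]
    (B : Type*) [CommRing B] [Algebra A B] [Module.Finite A B]
    (hinj : Function.Injective (algebraMap A B))
    (hret : ∀ n : ℕ, 1 ≤ n →
      ∃ f : (B ⧸ Ideal.map (algebraMap A B) (IsLocalRing.maximalIdeal A ^ n)) →ₗ[A]
            (A ⧸ (IsLocalRing.maximalIdeal A ^ n)),
        ∀ a : A, f (Ideal.Quotient.mk _ (algebraMap A B a)) = Ideal.Quotient.mk _ a) :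
    ∃ f : B →ₗ[A] A, ∀ a : A, f (algebraMap A B a) = a := by
  obtain ⟨f, hf⟩ := IsLocalRing.exists_linearMap_apply_eq_of_forall_quotient_pow (1 : B) (1 : A)
    fun n hn => by
      obtain ⟨f, hf⟩ := hret n hn
      refine ⟨f ∘ₗ (Ideal.Quotient.mkₐ A _).toLinearMap, ?_⟩
      simpa using hf 1
  exact ⟨f, fun a => by rw [Algebra.algebraMap_eq_smul_one, map_smul, hf, smul_eq_mul, mul_one]⟩
end
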